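/- arXiv:2109.11222 — 8 statements merged into one kernel-verified Lean document; each statement's English description precedes it below -/
import Mathlib

section
/- Let v, w ∈ ℝ² be linearly independent and let Λ = {m·v + n·w : m, n ∈ ℤ}. Then √5·disp(Λ) ≥ (2+√5)·det(Λ) (with the convention that this holds trivially when disp(Λ) = ∞). In other words, the normalized dispersion disp(Λ)/det(Λ) of every two-dimensional lattice is at least φ³/√5 = (2+√5)/√5 ≈ 1.89442, where φ = (1+√5)/2 is the golden ratio. -/
/-- The lattice generated by two vectors `v w : ℝ × ℝ`. -/
def latticeGen (v w : ℝ × ℝ) : Set (ℝ × ℝ) :=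
  {p | ∃ m n : ℤ, p = (m : ℝ) • v + (n : ℝ) • w}

/-- `isEmptyBox Λ x₁ x₂ y₁ y₂` means that `(x₁,x₂) × (y₁,y₂)` is an axis-parallel
box (so `x₁ < x₂`, `y₁ < y₂`) containing no point of `Λ`. -/
def isEmptyBox (Λ : Set (ℝ × ℝ)) (x₁ x₂ y₁ y₂ : ℝ) : Prop :=
  x₁ < x₂ ∧ y₁ < y₂ ∧ ∀ p ∈ Λ, p ∉ Set.Ioo x₁ x₂ ×ˢ Set.Ioo y₁ y₂

/-- The dispersion of a point set `Λ ⊂ ℝ²`: the supremum (in `[0,∞]`) of the areas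
of the axis-parallel boxes empty amidst `Λ`. -/
noncomputable def disp (Λ : Set (ℝ × ℝ)) : ENNReal :=
  sSup {A : ENNReal | ∃ x₁ x₂ y₁ y₂ : ℝ, isEmptyBox Λ x₁ x₂ y₁ y₂ ∧
    A = ENNReal.ofReal ((x₂ - x₁) * (y₂ - y₁))}

/-- Index form of "there is an empty box of large area" for the basis `(p1,p2),(q1,q2)`. -/
def GoodBasis (p1 p2 q1 q2 : ℝ) : Prop :=
  ∃ x1 x2 y1 y2 : ℝ, x1 < x2 ∧ y1 < y2 ∧
    (∀ m n : ℤ, x1 < m * p1 + n * q1 → m * p1 + n * q1 < x2 →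
      y1 < m * p2 + n * q2 → m * p2 + n * q2 < y2 → False) ∧
    (2 + Real.sqrt 5) * |p1 * q2 - p2 * q1| ≤ Real.sqrt 5 * ((x2 - x1) * (y2 - y1))

lemma GoodBasis.swap {p1 p2 q1 q2 : ℝ} (h : GoodBasis p2 p1 q2 q1) : GoodBasis p1 p2 q1 q2 := by
  obtain ⟨x1, x2, y1, y2, hx, hy, he, ha⟩ := h
  refine ⟨y1, y2, x1, x2, hy, hx, fun m n h1 h2 h3 h4 => he m n h3 h4 h1 h2, ?_⟩
  rw [abs_sub_comm, mul_comm (y2 - y1)]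
  convert ha using 4

lemma GoodBasis.negx {p1 p2 q1 q2 : ℝ} (h : GoodBasis (-p1) p2 (-q1) q2) :
    GoodBasis p1 p2 q1 q2 := by
  obtain ⟨x1, x2, y1, y2, hx, hy, he, ha⟩ := h
  refine ⟨-x2, -x1, y1, y2, by linarith, hy, fun m n h1 h2 h3 h4 =>
    he m n (by linarith) (by linarith) h3 h4, ?_⟩
  rw [abs_sub_comm]
  convert ha using 3 <;> ring_nf

lemma GoodBasis.base {p1 p2 q1 q2 : ℝ} (i j k l : ℤ) (hd : i * l - j * k = 1 ∨ i * l - j * k = -1)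
    (h : GoodBasis (i * p1 + j * q1) (i * p2 + j * q2) (k * p1 + l * q1) (k * p2 + l * q2)) :
    GoodBasis p1 p2 q1 q2 := by
  obtain ⟨x1, x2, y1, y2, hx, hy, he, ha⟩ := h
  refine ⟨x1, x2, y1, y2, hx, hy, ?_, ?_⟩
  · intro m n h1 h2 h3 h4
    have key : ∃ s t : ℤ, s * i + t * k = m ∧ s * j + t * l = n := by
      rcases hd with hd | hd
      · exact ⟨m * l - n * k, n * i - m * j, by linear_combination m * hd,
          by linear_combination n * hd⟩
      · exact ⟨-(m * l - n * k), -(n * i - m * j), by linear_combination -m * hd,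
          by linear_combination -n * hd⟩
    obtain ⟨s, t, rfl, rfl⟩ := key
    push_cast at h1 h2 h3 h4
    exact he s t (by linarith) (by linarith) (by linarith) (by linarith)
  · have e : (i * p1 + j * q1) * (k * p2 + l * q2) - (i * p2 + j * q2) * (k * p1 + l * q1)
        = ((i * l - j * k : ℤ) : ℝ) * (p1 * q2 - p2 * q1) := by push_cast; ring
    rw [e, abs_mul] at ha
    have : |((i * l - j * k : ℤ) : ℝ)| = 1 := by
      rcases hd with hd | hd <;> rw [hd] <;> norm_num
    rwa [this, one_mul] at ha

/-- The basic empty box. -/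
lemma good_of_box {a b c d : ℝ} (ha : 0 ≤ a) (hb : 0 ≤ b) (hc : 0 ≤ c) (hd : 0 ≤ d)
    (hac : 0 < a + c) (hbd : 0 < b + d)
    (hA : (2 + Real.sqrt 5) * (a * d + b * c) ≤ Real.sqrt 5 * ((a + c) * (b + d))) :
    GoodBasis a b c (-d) := by
  refine ⟨0, a + c, -d, b, hac, by linarith, ?_, ?_⟩
  · intro m n h1 h2 h3 h4
    rcases le_or_gt m 0 with hm | hm <;> rcases le_or_gt n 0 with hn | hn
    · have hm' : (m : ℝ) ≤ 0 := by exact_mod_cast hm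
      have hn' : (n : ℝ) ≤ 0 := by exact_mod_cast hn
      nlinarith
    · have hm' : (m : ℝ) ≤ 0 := by exact_mod_cast hm
      have hn' : (1 : ℝ) ≤ n := by exact_mod_cast hn
      nlinarith
    · have hm' : (1 : ℝ) ≤ m := by exact_mod_cast hm
      have hn' : (n : ℝ) ≤ 0 := by exact_mod_cast hn
      nlinarith
    · have hm' : (1 : ℝ) ≤ m := by exact_mod_cast hm
      have hn' : (1 : ℝ) ≤ n := by exact_mod_cast hn
      nlinarith
  · have : |a * -d - b * c| = a * d + b * c := by
      rw [show a * -d - b * c = -(a * d + b * c) by ring, abs_neg, abs_of_nonneg (by positivity)]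
    rw [this]
    convert hA using 2
    ring

lemma arith {al ga B K : ℝ} (h1 : 0 ≤ al) (h2 : 0 ≤ ga) (hB : 0 ≤ B) (hK : 0 ≤ K)
    (hD : B ^ 2 + 4 * (al * ga) = 5 * K ^ 2)
    (s1 : al + ga < 2 * K) (s2 : al + B < 2 * K) (s3 : ga + B < 2 * K) : False := by
  have hp : al * ga < K ^ 2 := by nlinarith [sq_nonneg (al - ga)]
  have hBK : K < B := by
    by_contra hh
    push Not at hh
    nlinarith
  have hB2 : B < 2 * K := by linarith
  have : al * ga ≤ (2 * K - B) * (2 * K - B) := by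
    apply mul_le_mul <;> linarith
  nlinarith [mul_pos (sub_pos.2 hBK) (show 0 < 11 * K - 5 * B by linarith)]

lemma good_reduced {a b c d : ℝ} (ha : 0 ≤ a) (hac : a ≤ c) (hd : 0 ≤ d) (hdb : d ≤ b)
    (hb : 0 < b) (hc : 0 < c) : GoodBasis a b c (-d) := by
  have h5 : 0 < Real.sqrt 5 := by positivity
  have h5s : Real.sqrt 5 * Real.sqrt 5 = 5 := Real.mul_self_sqrt (by norm_num)
  set r := Real.sqrt 5 with hr
  by_cases c1 : (2 + r) * (a * d + b * c) ≤ r * ((a + c) * (b + d))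
  · exact good_of_box ha hb.le hc.le hd (by linarith) (by linarith) c1
  by_cases c2 : (2 + r) * (a * d + b * c) ≤ r * ((a + 2 * c) * b)
  · apply GoodBasis.base 1 1 0 1 (by norm_num)
    have := good_of_box (a := a + c) (b := b - d) (c := c) (d := d) (by linarith) (by linarith)
      hc.le hd (by linarith) (by linarith) (by convert c2 using 2 <;> ring)
    convert this using 1 <;> push_cast <;> ring
  by_cases c3 : (2 + r) * (a * d + b * c) ≤ r * (c * (2 * b + d))
  · apply GoodBasis.base 1 0 (-1) 1 (by norm_num)
    have := good_of_box (a := a) (b := b) (c := c - a) (d := d + b) (by linarith) (by linarith)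
      (by linarith) (by linarith) (by linarith) (by linarith) (by convert c3 using 2 <;> ring)
    convert this using 1 <;> push_cast <;> ring
  exfalso
  push Not at c1 c2 c3
  have hK : (a * d + b * c) = r * ((a * d + b * c) / r) := by field_simp
  set K := (a * d + b * c) / r with hKdef
  have hK0 : 0 ≤ K := by positivity
  have hB : 0 ≤ b * c - a * d := by nlinarith [mul_le_mul hac hdb hd hc.le]
  refine arith (al := a * b) (ga := c * d) (B := b * c - a * d) (K := K) (by positivity)
    (by positivity) hB hK0 ?_ ?_ ?_ ?_
  · calc _ = (a * d + b * c) ^ 2 := by ring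
      _ = (r * r) * K ^ 2 := by rw [hK]; ring
      _ = _ := by rw [h5s]
  · apply lt_of_mul_lt_mul_left _ h5.le; linarith
  · apply lt_of_mul_lt_mul_left _ h5.le; linarith
  · apply lt_of_mul_lt_mul_left _ h5.le; linarith

lemma good_min_pos {a b c d : ℝ} (hb : 0 < b) (ha : 0 ≤ a) (hab : a ≤ b)
    (hmin : ∀ m n : ℤ, (m ≠ 0 ∨ n ≠ 0) → b ≤ |m * a + n * c| ∨ b ≤ |m * b + n * d|) :
    GoodBasis a b c d := by
  -- shift `f` so that its second coordinate lies in `(-b, 0]`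
  set N : ℤ := ⌊-d / b⌋ with hN
  have hN1 : (N : ℝ) * b ≤ -d := by
    have := Int.floor_le (-d / b)
    rwa [le_div_iff₀ hb] at this
  have hN2 : -d < (N + 1 : ℝ) * b := by
    have := Int.lt_floor_add_one (-d / b)
    rwa [div_lt_iff₀ hb] at this
  set C := (N : ℝ) * a + c with hC
  set E := -((N : ℝ) * b + d) with hE
  have hE0 : 0 ≤ E := by linarith
  have hEb : E < b := by linarith
  have hCb : b ≤ |C| := by
    rcases hmin N 1 (by simp) with h | h
    · simpa using h
    · exfalso
      rw [show (N : ℝ) * b + (1 : ℤ) * d = -E by rw [hE]; push_cast; ring, abs_neg,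
        abs_of_nonneg hE0] at h
      linarith
  rcases le_or_gt 0 C with hC0 | hC0
  · rw [abs_of_nonneg hC0] at hCb
    apply GoodBasis.base 1 0 N 1 (by norm_num)
    have := good_reduced (a := a) (b := b) (c := C) (d := E) ha (by linarith) hE0 hEb.le hb
      (by linarith)
    convert this using 1 <;> simp [hC, hE]
  rw [abs_of_neg hC0] at hCb
  rcases hE0.eq_or_lt with h0 | h0
  · apply GoodBasis.base 1 0 (-N) (-1) (by norm_num)
    have := good_reduced (a := a) (b := b) (c := -C) (d := E) ha (by linarith) hE0 hEb.le hb
      (by linarith)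
    convert this using 1
    · simp
    · simp
    · push_cast; rw [hC]; ring
    · push_cast; rw [← h0]; linarith
  · have h1 : b ≤ |C + a| := by
      rcases hmin (N + 1) 1 (by simp) with h | h
      · convert h using 2; push_cast; rw [hC]; ring
      · exfalso
        rw [show ((N + 1 : ℤ) : ℝ) * b + (1 : ℤ) * d = b - E by rw [hE]; push_cast; ring,
          abs_of_nonneg (by linarith)] at h
        linarith
    rw [abs_of_nonpos (by linarith)] at h1
    apply GoodBasis.base 1 0 (-(N + 1)) (-1) (by norm_num)
    have := good_reduced (a := a) (b := b) (c := -(C + a)) (d := b - E) ha (by linarith)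
      (by linarith) (by linarith) hb (by linarith)
    convert this using 1
    · simp
    · simp
    · push_cast; rw [hC]; ring
    · push_cast; rw [hE]; ring

lemma good_min {a b c d : ℝ} (hb : 0 < |b|) (hab : |a| ≤ |b|)
    (hmin : ∀ m n : ℤ, (m ≠ 0 ∨ n ≠ 0) → |b| ≤ |m * a + n * c| ∨ |b| ≤ |m * b + n * d|) :
    GoodBasis a b c d := by
  wlog hb0 : 0 ≤ b generalizing a b
  · push Not at hb0
    apply GoodBasis.base (-1) 0 0 1 (by norm_num)
    have := this (a := -a) (b := -b) (by simpa using hb) (by simpa using hab) ?_ (by linarith)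
    · convert this using 1 <;> simp
    · intro m n hmn
      have := hmin (-m) n (by simpa using hmn)
      simpa using this
  wlog ha0 : 0 ≤ a generalizing a c
  · push Not at ha0
    apply GoodBasis.negx
    refine this (by simpa using hab) ?_ (by linarith)
    intro m n hmn
    rcases hmin m n hmn with h | h
    · left
      rw [← abs_neg (m * a + n * c : ℝ)] at h
      convert h using 2; ring
    · exact Or.inr h
  rw [abs_of_nonneg hb0] at hb hab hmin
  rw [abs_of_nonneg ha0] at hab
  exact good_min_pos hb ha0 hab hmin

lemma good_all (p1 p2 q1 q2 : ℝ) (hdet : p1 * q2 - p2 * q1 ≠ 0) : GoodBasis p1 p2 q1 q2 := by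
  set D := p1 * q2 - p2 * q1 with hD
  have hDpos : 0 < |D| := abs_pos.2 hdet
  let F : ℤ × ℤ → ℝ := fun z => max |z.1 * p1 + z.2 * q1| |z.1 * p2 + z.2 * q2|
  let R := F (1, 0)
  let S : Set (ℤ × ℤ) := {z | z ≠ 0 ∧ F z ≤ R}
  have bd : ∀ (u : ℤ) (X Y s t : ℝ), |X| ≤ R → |Y| ≤ R → u * D = X * s - Y * t →
      |u| ≤ ⌈R * (|s| + |t|) / |D|⌉ := by
    intro u X Y s t hX hY h
    have : (|u| : ℝ) ≤ R * (|s| + |t|) / |D| := by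
      rw [le_div_iff₀ hDpos, ← abs_mul, h]
      calc |X * s - Y * t| ≤ |X * s| + |Y * t| := abs_sub _ _
        _ = |X| * |s| + |Y| * |t| := by rw [abs_mul, abs_mul]
        _ ≤ R * |s| + R * |t| := by gcongr
        _ = _ := by ring
    have h2 := this.trans (Int.le_ceil _)
    exact_mod_cast h2
  have hfin : S.Finite := by
    refine Set.Finite.subset ((Set.finite_Icc
      (-⌈R * (|q2| + |q1|) / |D|⌉) ⌈R * (|q2| + |q1|) / |D|⌉).prod
      (Set.finite_Icc (-⌈R * (|p1| + |p2|) / |D|⌉) ⌈R * (|p1| + |p2|) / |D|⌉)) ?_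
    rintro ⟨m, n⟩ ⟨-, hz⟩
    have hX : |(m : ℝ) * p1 + n * q1| ≤ R := (le_max_left _ _).trans hz
    have hY : |(m : ℝ) * p2 + n * q2| ≤ R := (le_max_right _ _).trans hz
    exact ⟨abs_le.1 (bd m _ _ q2 q1 hX hY (by rw [hD]; ring)),
      abs_le.1 (bd n _ _ p1 p2 hY hX (by rw [hD]; ring))⟩
  have hne : S.Nonempty := ⟨(1, 0), by simp, le_refl _⟩
  obtain ⟨⟨i, j⟩, ⟨hz0, hzR⟩, hmin⟩ := Set.exists_min_image S F hfin hne
  have hmin' : ∀ z : ℤ × ℤ, z ≠ 0 → F (i, j) ≤ F z := by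
    intro z hz
    by_cases h : F z ≤ R
    · exact hmin z ⟨hz, h⟩
    · push Not at h; exact hzR.trans h.le
  have hFpos : ∀ z : ℤ × ℤ, z ≠ 0 → 0 < F z := by
    rintro ⟨m, n⟩ hz
    by_contra hh
    push Not at hh
    have hX : (m : ℝ) * p1 + n * q1 = 0 := abs_nonpos_iff.1 ((le_max_left _ _).trans hh)
    have hY : (m : ℝ) * p2 + n * q2 = 0 := abs_nonpos_iff.1 ((le_max_right _ _).trans hh)
    have hm : (m : ℝ) * D = 0 := by rw [hD]; linear_combination q2 * hX - q1 * hY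
    have hn : (n : ℝ) * D = 0 := by rw [hD]; linear_combination p1 * hY - p2 * hX
    have hm' : m = 0 := by
      have := (mul_eq_zero.1 hm).resolve_right hdet
      exact_mod_cast this
    have hn' : n = 0 := by
      have := (mul_eq_zero.1 hn).resolve_right hdet
      exact_mod_cast this
    exact hz (by rw [hm', hn']; rfl)
  -- primitivity
  have hg : Int.gcd i j = 1 := by
    have hgpos : 0 < Int.gcd i j := by
      rw [Int.gcd_pos_iff]
      by_contra hh
      push Not at hh
      exact hz0 (by rw [hh.1, hh.2]; rfl)
    obtain ⟨i', hi⟩ := Int.gcd_dvd_left (a := i) (b := j)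
    obtain ⟨j', hj⟩ := Int.gcd_dvd_right (a := i) (b := j)
    set g := Int.gcd i j with hgdef
    have hz' : ((i', j') : ℤ × ℤ) ≠ 0 := by
      intro hh
      have h1 : i' = 0 := congrArg Prod.fst hh
      have h2 : j' = 0 := congrArg Prod.snd hh
      rw [h1, mul_zero] at hi
      rw [h2, mul_zero] at hj
      exact hz0 (by rw [hi, hj]; rfl)
    have hs : F (i, j) = g * F (i', j') := by
      have hiR : (i : ℝ) = g * i' := by exact_mod_cast hi
      have hjR : (j : ℝ) = g * j' := by exact_mod_cast hj
      have hg0 : (0 : ℝ) ≤ g := by positivity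
      simp only [F]
      rw [hiR, hjR, mul_max_of_nonneg _ _ hg0]
      conv_rhs => rw [← abs_of_nonneg hg0, ← abs_mul, ← abs_mul]
      congr 2 <;> ring
    have h1 := hmin' _ hz'
    have h2 := hFpos _ hz'
    rw [hs] at h1
    have h3 : (g : ℝ) ≤ 1 := by
      by_contra hh
      push Not at hh
      nlinarith
    have h4 : g ≤ 1 := by exact_mod_cast h3
    omega
  -- complete to a basis
  have hbez : i * Int.gcdA i j + j * Int.gcdB i j = 1 := by
    rw [← Int.gcd_eq_gcd_ab, hg]; rfl
  set k := - Int.gcdB i j with hk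
  set l := Int.gcdA i j with hl
  have hil : i * l - j * k = 1 := by rw [hk]; linarith
  apply GoodBasis.base i j k l (Or.inl hil)
  have hmin2 : ∀ m n : ℤ, (m ≠ 0 ∨ n ≠ 0) → F (i, j) ≤ F (m * i + n * k, m * j + n * l) := by
    intro m n hmn
    apply hmin'
    intro hh
    have h1 : m * i + n * k = 0 := congrArg Prod.fst hh
    have h2 : m * j + n * l = 0 := congrArg Prod.snd hh
    have hm : m = 0 := by linear_combination l * h1 - k * h2 - m * hil
    have hn : n = 0 := by linear_combination i * h2 - j * h1 - n * hil
    tauto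
  have hmin3 : ∀ m n : ℤ, (m ≠ 0 ∨ n ≠ 0) →
      F (i, j) ≤ |m * (i * p1 + j * q1) + n * (k * p1 + l * q1)| ∨
      F (i, j) ≤ |m * (i * p2 + j * q2) + n * (k * p2 + l * q2)| := by
    intro m n hmn
    have := hmin2 m n hmn
    rw [show F (m * i + n * k, m * j + n * l) =
      max |m * (i * p1 + j * q1) + n * (k * p1 + l * q1)|
        |m * (i * p2 + j * q2) + n * (k * p2 + l * q2)| by
        simp only [F]; push_cast; congr 2 <;> ring] at this
    exact le_max_iff.1 this
  have hpos := hFpos _ hz0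
  rcases le_total |(i : ℝ) * p1 + j * q1| |(i : ℝ) * p2 + j * q2| with h | h
  · have hF : F (i, j) = |(i : ℝ) * p2 + j * q2| := max_eq_right h
    rw [hF] at hpos hmin3
    exact good_min hpos h hmin3
  · have hF : F (i, j) = |(i : ℝ) * p1 + j * q1| := max_eq_left h
    rw [hF] at hpos hmin3
    exact (good_min hpos h (fun m n hmn => (hmin3 m n hmn).symm)).swap

/-- The normalized dispersion of every two-dimensional lattice is at least
`φ³/√5 = (2+√5)/√5`. -/
theorem stmt0 (v w : ℝ × ℝ) (h : LinearIndependent ℝ ![v, w]) :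
    ENNReal.ofReal (Real.sqrt 5) * disp (latticeGen v w) ≥
      ENNReal.ofReal ((2 + Real.sqrt 5) * |v.1 * w.2 - v.2 * w.1|) := by
  have hdet : v.1 * w.2 - v.2 * w.1 ≠ 0 := by
    intro h0
    rw [LinearIndependent.pair_iff] at h
    have e1 := h w.2 (-v.2) (by ext <;> simp <;> linarith)
    have e2 := h w.1 (-v.1) (by ext <;> simp <;> linarith)
    have := h 1 0 (by ext <;> simp <;> linarith [e1.2, e2.2])
    simp at this
  obtain ⟨x1, x2, y1, y2, hx, hy, he, ha⟩ := good_all v.1 v.2 w.1 w.2 hdet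
  have hle : ENNReal.ofReal ((x2 - x1) * (y2 - y1)) ≤ disp (latticeGen v w) := by
    apply le_sSup
    refine ⟨x1, x2, y1, y2, ⟨hx, hy, ?_⟩, rfl⟩
    rintro p ⟨m, n, rfl⟩ hp
    simp only [Set.mem_prod, Set.mem_Ioo, Prod.fst_add, Prod.snd_add, Prod.smul_fst,
      Prod.smul_snd, smul_eq_mul] at hp
    exact he m n hp.1.1 hp.1.2 hp.2.1 hp.2.2
  calc ENNReal.ofReal ((2 + Real.sqrt 5) * |v.1 * w.2 - v.2 * w.1|)
      ≤ ENNReal.ofReal (Real.sqrt 5 * ((x2 - x1) * (y2 - y1))) := ENNReal.ofReal_le_ofReal ha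
    _ = ENNReal.ofReal (Real.sqrt 5) * ENNReal.ofReal ((x2 - x1) * (y2 - y1)) :=
        ENNReal.ofReal_mul (Real.sqrt_nonneg _)
    _ ≤ _ := by gcongr
end

section
/- Let φ = (1+√5)/2 and let Λ₅ be the lattice generated by (1, 1) and (φ, 1−φ). Then det(Λ₅) = √5 and disp(Λ₅) = 2 + √5 = φ³; that is, the normalized dispersion of Λ₅ equals φ³/√5 ≈ 1.89442. -/
/-- Emptiness of a box in coordinates, with `f` the golden ratio. -/
def EmptyC (f x y W H : ℝ) : Prop :=
  ∀ m n : ℤ, x < m + n * f → m + n * f < x + W → y < m + n * (1 - f) →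
    m + n * (1 - f) < y + H → False

lemma emptyC_up {f : ℝ} (hf : f * f = f + 1) (h1 : 1 < f) {x y W H : ℝ}
    (h : EmptyC f x y W H) :
    EmptyC f (f * x) (-((f - 1) * (y + H))) (f * W) ((f - 1) * H) := by
  intro m n a b c d
  have hq : 0 < f - 1 := by linarith
  have hf0 : 0 < f := by linarith
  have hi : f * (f - 1) = 1 := by linarith
  have e1 : ((n - m : ℤ) : ℝ) + (m : ℤ) * f = (f - 1) * (m + n * f) := by
    push_cast; linear_combination (-(n : ℝ)) * hf
  have e2 : ((n - m : ℤ) : ℝ) + (m : ℤ) * (1 - f) = -(f * (m + n * (1 - f))) := by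
    push_cast; linear_combination (-(n : ℝ)) * hf
  have k (z : ℝ) : (f - 1) * (f * z) = z := by linear_combination z * hi
  have k' (z : ℝ) : f * ((f - 1) * z) = z := by linear_combination z * hi
  apply h (n - m) m
  · rw [e1]; have := mul_lt_mul_of_pos_left a hq; rwa [k] at this
  · rw [e1]; have := mul_lt_mul_of_pos_left b hq; rwa [← mul_add, k] at this
  · rw [e2]; have := mul_lt_mul_of_pos_left d hf0
    have e3 := k' H
    have e4 := k' (y + H)
    have : f * (-((f - 1) * (y + H)) + (f - 1) * H) = -y := by linear_combination e3 - e4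
    linarith
  · rw [e2]; have := mul_lt_mul_of_pos_left c hf0
    have e4 := k' (y + H)
    have : f * (-((f - 1) * (y + H))) = -(y + H) := by linear_combination - e4
    linarith

lemma emptyC_down {f : ℝ} (hf : f * f = f + 1) (h1 : 1 < f) {x y W H : ℝ}
    (h : EmptyC f x y W H) :
    EmptyC f ((f - 1) * x) (-(f * (y + H))) ((f - 1) * W) (f * H) := by
  intro m n a b c d
  have hq : 0 < f - 1 := by linarith
  have hf0 : 0 < f := by linarith
  have hi : f * (f - 1) = 1 := by linarith
  have e1 : ((n : ℤ) : ℝ) + (m + n : ℤ) * f = f * (m + n * f) := by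
    push_cast; linear_combination (-(n : ℝ)) * hf
  have e2 : ((n : ℤ) : ℝ) + (m + n : ℤ) * (1 - f) = -((f - 1) * (m + n * (1 - f))) := by
    push_cast; linear_combination (-(n : ℝ)) * hf
  have k (z : ℝ) : (f - 1) * (f * z) = z := by linear_combination z * hi
  have k' (z : ℝ) : f * ((f - 1) * z) = z := by linear_combination z * hi
  apply h n (m + n)
  · rw [e1]; have := mul_lt_mul_of_pos_left a hf0; rwa [k'] at this
  · rw [e1]; have := mul_lt_mul_of_pos_left b hf0; rwa [← mul_add, k'] at this
  · rw [e2]; have := mul_lt_mul_of_pos_left d hq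
    have e3 := k H
    have e4 := k (y + H)
    have : (f - 1) * (-(f * (y + H)) + f * H) = -y := by linear_combination e3 - e4
    linarith
  · rw [e2]; have := mul_lt_mul_of_pos_left c hq
    have e4 := k (y + H)
    have : (f - 1) * (-(f * (y + H))) = -(y + H) := by linear_combination - e4
    linarith

lemma emptyC_zpow {f : ℝ} (hf : f * f = f + 1) (h1 : 1 < f) {W H : ℝ}
    (h : ∃ x y, EmptyC f x y W H) (n : ℤ) :
    ∃ x y, EmptyC f x y (f ^ n * W) (f ^ (-n) * H) := by
  have hf0 : f ≠ 0 := by linarith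
  have hinv : f⁻¹ = f - 1 := by
    apply inv_eq_of_mul_eq_one_right; linarith
  induction n using Int.induction_on with
  | zero => simpa using h
  | succ i ih =>
    obtain ⟨x, y, h⟩ := ih
    have a1 : f ^ ((i : ℤ) + 1) * W = f * (f ^ (i : ℤ) * W) := by
      rw [zpow_add₀ hf0, zpow_one]; ring
    have a2 : f ^ (-((i : ℤ) + 1)) * H = (f - 1) * (f ^ (-(i : ℤ)) * H) := by
      rw [neg_add, zpow_add₀ hf0, ← hinv, zpow_neg_one]; ring
    rw [a1, a2]
    exact ⟨_, _, emptyC_up hf h1 h⟩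
  | pred i ih =>
    obtain ⟨x, y, h⟩ := ih
    have a1 : f ^ (-(i : ℤ) - 1) * W = (f - 1) * (f ^ (-(i : ℤ)) * W) := by
      rw [sub_eq_add_neg, zpow_add₀ hf0, ← hinv, zpow_neg_one]; ring
    have a2 : f ^ (-(-(i : ℤ) - 1)) * H = f * (f ^ (-(-(i : ℤ))) * H) := by
      rw [neg_sub, sub_eq_add_neg, zpow_add₀ hf0, zpow_one]; ring
    rw [a1, a2]
    exact ⟨_, _, emptyC_down hf h1 h⟩

lemma not_emptyC {f : ℝ} (h1 : 1 < f) {x y W H : ℝ}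
    (hW : f < W) (hH : f < H) : ¬ EmptyC f x y W H := by
  intro h
  have start : ∃ m n : ℤ, x < m + n * f ∧ m + n * f < x + W := by
    refine ⟨⌊x⌋ + 1, 0, ?_, ?_⟩
    · push_cast; linarith [Int.lt_floor_add_one x]
    · push_cast; linarith [Int.floor_le x]
  obtain ⟨m₀, n₀, hs⟩ := start
  have down : ∀ k : ℕ, ∃ m n : ℤ, x < m + n * f ∧ m + n * f < x + W ∧
      m + n * (1 - f) ≤ (m₀ + n₀ * (1 - f)) - k := by
    intro k
    induction k with
    | zero => exact ⟨m₀, n₀, hs.1, hs.2, by simp⟩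
    | succ k ih =>
      obtain ⟨m, n, a, b, c⟩ := ih
      by_cases hc : (m : ℝ) + n * f + f - 1 < x + W
      · refine ⟨m - 1, n + 1, ?_, ?_, ?_⟩ <;> push_cast <;> linarith
      · refine ⟨m - 1, n, ?_, ?_, ?_⟩ <;> push_cast <;> linarith
  obtain ⟨k, hk⟩ := exists_nat_ge (m₀ + n₀ * (1 - f) - y)
  obtain ⟨m₁, n₁, a₁, b₁, c₁⟩ := down k
  have up : ∀ k : ℕ, ∃ m n : ℤ, x < m + n * f ∧ m + n * f < x + W ∧
      m + n * (1 - f) ≤ y ∧ (m₁ + n₁ * (1 - f)) + k ≤ m + n * (1 - f) := by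
    intro k
    induction k with
    | zero => exact ⟨m₁, n₁, a₁, b₁, by linarith, by simp⟩
    | succ k ih =>
      obtain ⟨m, n, a, b, c, d⟩ := ih
      by_cases hc : x < (m : ℝ) + n * f + 1 - f
      · refine ⟨m + 1, n - 1, ?_, ?_, ?_, ?_⟩
        · push_cast; linarith
        · push_cast; linarith
        · by_contra! h'
          refine h (m + 1) (n - 1) ?_ ?_ h' ?_ <;> push_cast <;> linarith
        · push_cast; linarith
      · refine ⟨m + 1, n, ?_, ?_, ?_, ?_⟩
        · push_cast; linarith
        · push_cast; linarith
        · by_contra! h'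
          refine h (m + 1) n ?_ ?_ h' ?_ <;> push_cast <;> linarith
        · push_cast; linarith
  obtain ⟨j, hj⟩ := exists_nat_gt (y - (m₁ + n₁ * (1 - f)))
  obtain ⟨m, n, a, b, c, d⟩ := up j
  linarith

lemma emptyC_area {f : ℝ} (hf : f * f = f + 1) (h1 : 1 < f) {x y W H : ℝ}
    (hW : 0 < W) (h : EmptyC f x y W H) : W * H ≤ 2 * f + 1 := by
  by_contra! hA
  have hf0 : 0 < f := by linarith
  obtain ⟨n, hn1, hn2⟩ := exists_mem_Ioc_zpow hW h1
  obtain ⟨x', y', h'⟩ := emptyC_zpow hf h1 ⟨x, y, h⟩ (1 - n)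
  have p : 0 < f ^ (1 - n) := zpow_pos hf0 _
  have w1 : f < f ^ (1 - n) * W := by
    have := mul_lt_mul_of_pos_left hn1 p
    rwa [← zpow_add₀ hf0.ne', sub_add_cancel, zpow_one] at this
  have w2 : f ^ (1 - n) * W ≤ f * f := by
    have := mul_le_mul_of_nonneg_left hn2 p.le
    rw [← zpow_add₀ hf0.ne', show 1 - n + (n + 1) = (2 : ℤ) by ring] at this
    calc _ ≤ _ := this
      _ = f * f := by rw [zpow_two]
  have hprod : (f ^ (1 - n) * W) * (f ^ (-(1 - n)) * H) = W * H := by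
    rw [zpow_neg]; field_simp
  refine not_emptyC h1 w1 ?_ h'
  by_contra! hh
  nlinarith [mul_le_mul_of_nonneg_left hh (hf0.trans w1).le,
    mul_le_mul_of_nonneg_right w2 hf0.le]

/-- The lattice Λ₅ generated by (1,1) and (φ, 1−φ) has determinant √5 and
dispersion 2 + √5 = φ³. -/
theorem stmt1 :
    |(1 : ℝ) * (1 - (1 + Real.sqrt 5) / 2) - 1 * ((1 + Real.sqrt 5) / 2)| = Real.sqrt 5 ∧
    disp (latticeGen (1, 1) ((1 + Real.sqrt 5) / 2, 1 - (1 + Real.sqrt 5) / 2)) =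
      ENNReal.ofReal (2 + Real.sqrt 5) := by
  have s2 : Real.sqrt 5 * Real.sqrt 5 = 5 := Real.mul_self_sqrt (by norm_num)
  have s0 : 0 ≤ Real.sqrt 5 := Real.sqrt_nonneg 5
  obtain ⟨f, hfd⟩ : ∃ f, f = (1 + Real.sqrt 5) / 2 := ⟨_, rfl⟩
  have hs : Real.sqrt 5 = 2 * f - 1 := by linarith
  rw [← hfd]
  rw [hs] at s2 s0 ⊢
  have hf : f * f = f + 1 := by linarith
  have h1 : 1.6 < f := by nlinarith
  have h2 : f < 1.7 := by nlinarith
  constructor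
  · rw [show (1 : ℝ) * (1 - f) - 1 * f = -(2 * f - 1) by ring, abs_neg, abs_of_nonneg s0]
  apply le_antisymm
  · apply sSup_le
    rintro A ⟨x₁, x₂, y₁, y₂, ⟨hx, hy, he⟩, rfl⟩
    apply ENNReal.ofReal_le_ofReal
    have : EmptyC f x₁ y₁ (x₂ - x₁) (y₂ - y₁) := by
      intro m n a b c d
      refine he (m + n * f, m + n * (1 - f)) ⟨m, n, by simp⟩ ?_
      refine ⟨⟨a, ?_⟩, ⟨c, ?_⟩⟩ <;> simp only <;> linarith
    have := emptyC_area hf (by linarith) (by linarith) this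
    linarith
  · apply le_sSup
    refine ⟨0, f + 1, 1 - f, 1, ⟨by linarith, by linarith, ?_⟩, ?_⟩
    · rintro p ⟨m, n, rfl⟩ ⟨⟨a, b⟩, ⟨c, d⟩⟩
      simp at a b c d
      have n1 : (-1 : ℝ) < n := by nlinarith
      have n2 : (n : ℝ) < 2 := by nlinarith
      have n1' : -1 < n := by exact_mod_cast n1
      have n2' : n < 2 := by exact_mod_cast n2
      obtain rfl | rfl : n = 0 ∨ n = 1 := by omega
      · simp at a b c d
        have d' : m < 1 := by exact_mod_cast d
        omega
      · have m1 : (0 : ℝ) < m := by push_cast at *; linarith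
        have m2 : (m : ℝ) < 1 := by push_cast at *; linarith
        have m1' : 0 < m := by exact_mod_cast m1
        have m2' : m < 1 := by exact_mod_cast m2
        omega
    · congr 1; linear_combination -hf
end

section
/- Let Λ₂ be the lattice generated by (1, 1) and (1+√2, 1−√2). Then det(Λ₂) = 2√2 and disp(Λ₂) = 3 + 2√2, so its normalized dispersion is (3+2√2)/(2√2) ≈ 2.06066. Moreover, for every lattice Λ generated by two linearly independent vectors in ℝ², either √5·disp(Λ) = (2+√5)·det(Λ) (the minimal possible normalized dispersion φ³/√5) or 2√2·disp(Λ) ≥ (3+2√2)·det(Λ); that is, (3+2√2)/(2√2) is the second smallest normalized dispersion among all two-dimensional lattices. -/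
/-! ### Part 1: the abstract dynamics on ratios -/

structure Adm (T : ℝ → ℝ → Prop) : Prop where
  pos : ∀ {X Y}, T X Y → 0 < X ∧ 0 < Y
  ne : ∀ {X Y}, T X Y → X ≠ 1 ∧ Y ≠ 1
  inv : ∀ {X Y}, T X Y → T X⁻¹ Y⁻¹
  fwd : ∀ {X Y}, T X Y → 1 < X → T (X - 1) (Y + 1)
  bwd : ∀ {X Y}, T X Y → 1 < Y → T (X + 1) (Y - 1)
  bd : ∀ {X Y}, T X Y → (X + 1) * (Y + 1) < (1 + 3 / 4 * Real.sqrt 2) * (X + Y)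

def flipT (T : ℝ → ℝ → Prop) : ℝ → ℝ → Prop := fun X Y => T Y X

theorem Adm.flip {T : ℝ → ℝ → Prop} (h : Adm T) : Adm (flipT T) where
  pos := fun t => (h.pos t).symm
  ne := fun t => (h.ne t).symm
  inv := fun t => h.inv t
  fwd := fun t => h.bwd t
  bwd := fun t => h.fwd t
  bd := fun t => by have := h.bd t; linarith

def Red (T : ℝ → ℝ → Prop) (X Y : ℝ) : Prop := T X Y ∧ 1 < X ∧ Y < 1

theorem sqrt2_bds : 1.414 < Real.sqrt 2 ∧ Real.sqrt 2 < 1.41425 := by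
  constructor
  · apply Real.lt_sqrt_of_sq_lt; norm_num
  · rw [Real.sqrt_lt' (by norm_num)]; norm_num

theorem Adm.bd' {T : ℝ → ℝ → Prop} (h : Adm T) {X Y : ℝ} (t : T X Y) :
    (X + 1) * (Y + 1) < 2.0607 * (X + Y) := by
  have h1 := h.bd t
  have h2 := sqrt2_bds
  have h3 := h.pos t
  nlinarith [h3.1, h3.2, mul_pos (sub_pos.2 h2.2) (add_pos h3.1 h3.2)]

theorem Adm.dual {T : ℝ → ℝ → Prop} (h : Adm T) {X Y : ℝ} (t : Red T X Y) :
    Red (flipT T) Y⁻¹ X⁻¹ :=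
  ⟨h.inv t.1, (one_lt_inv₀ (h.pos t.1).2).2 t.2.2, inv_lt_one_of_one_lt₀ t.2.1⟩

theorem Adm.toRed {T : ℝ → ℝ → Prop} (h : Adm T) {X Y : ℝ} (t : T X Y) (hX : X < 1)
    (hY : 1 < Y) : Red T X⁻¹ Y⁻¹ :=
  ⟨h.inv t, (one_lt_inv₀ (h.pos t).1).2 hX, inv_lt_one_of_one_lt₀ hY⟩

theorem Adm.next1 {T : ℝ → ℝ → Prop} (h : Adm T) {X Y : ℝ} (t : Red T X Y) (hX : X < 2) :
    Red T (X - 1)⁻¹ (Y + 1)⁻¹ := by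
  have hp := h.pos t.1
  exact h.toRed (h.fwd t.1 t.2.1) (by linarith) (by linarith)

theorem Adm.fwd2 {T : ℝ → ℝ → Prop} (h : Adm T) {X Y : ℝ} (t : Red T X Y) (hX : 2 < X) :
    T (X - 2) (Y + 2) := by
  have := h.fwd (h.fwd t.1 t.2.1) (by linarith)
  convert this using 1 <;> ring

theorem Adm.fwd3 {T : ℝ → ℝ → Prop} (h : Adm T) {X Y : ℝ} (t : Red T X Y) (hX : 3 < X) :
    T (X - 3) (Y + 3) := by
  have := h.fwd (h.fwd2 t (by linarith)) (by linarith)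
  convert this using 1 <;> ring

theorem Adm.next2 {T : ℝ → ℝ → Prop} (h : Adm T) {X Y : ℝ} (t : Red T X Y) (h2 : 2 < X)
    (hX : X < 3) : Red T (X - 2)⁻¹ (Y + 2)⁻¹ := by
  have hp := h.pos t.1
  exact h.toRed (h.fwd2 t h2) (by linarith) (by linarith)

theorem Adm.next3 {T : ℝ → ℝ → Prop} (h : Adm T) {X Y : ℝ} (t : Red T X Y) (h2 : 3 < X)
    (hX : X < 4) : Red T (X - 3)⁻¹ (Y + 3)⁻¹ := by
  have hp := h.pos t.1
  exact h.toRed (h.fwd3 t h2) (by linarith) (by linarith)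

theorem Adm.ne2 {T : ℝ → ℝ → Prop} (h : Adm T) {X Y : ℝ} (t : Red T X Y) : X ≠ 2 := by
  intro e
  exact (h.ne (h.fwd t.1 t.2.1)).1 (by rw [e]; norm_num)

theorem Adm.ne3 {T : ℝ → ℝ → Prop} (h : Adm T) {X Y : ℝ} (t : Red T X Y) : X ≠ 3 := by
  intro e
  exact (h.ne (h.fwd2 t (by rw [e]; norm_num))).1 (by rw [e]; norm_num)

theorem Adm.lt4 {T : ℝ → ℝ → Prop} (h : Adm T) {X Y : ℝ} (t : Red T X Y) : X < 4 := by
  by_contra! hc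
  have hp := h.pos t.1
  have h1 := h.bd' (h.fwd2 t (by linarith))
  nlinarith [mul_nonneg (sub_nonneg.2 hc) hp.2.le]

theorem gt_of_inv {x k : ℝ} (hx : 0 < x) (h : x⁻¹ < k) : 1 < k * x := by
  have := mul_lt_mul_of_pos_right h hx
  rwa [inv_mul_cancel₀ hx.ne'] at this

theorem lt_of_inv {x k : ℝ} (hx : 0 < x) (h : k < x⁻¹) : k * x < 1 := by
  have := mul_lt_mul_of_pos_right h hx
  rwa [inv_mul_cancel₀ hx.ne'] at this

theorem Adm.lt3 {T : ℝ → ℝ → Prop} (h : Adm T) {X Y : ℝ} (t : Red T X Y) : X < 3 := by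
  by_contra! hc
  have hp := h.pos t.1
  have h3 : 3 < X := lt_of_le_of_ne hc (h.ne3 t).symm
  have h4 := h.lt4 t
  have a1 := gt_of_inv (by linarith) (h.lt4 (h.next3 t h3 h4))
  have a2 := gt_of_inv hp.2 (h.flip.lt4 (h.dual t))
  have h1 := h.bd' (h.fwd t.1 t.2.1)
  nlinarith [mul_pos (sub_pos.2 a1) (sub_pos.2 a2)]

theorem Adm.gt43 {T : ℝ → ℝ → Prop} (h : Adm T) {X Y : ℝ} (t : Red T X Y) : 4 / 3 < X := by
  by_contra! hc
  have a1 := gt_of_inv (by linarith [t.2.1]) (h.lt3 (h.next1 t (by linarith)))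
  linarith

theorem Adm.lt74 {T : ℝ → ℝ → Prop} (h : Adm T) {X Y : ℝ} (t : Red T X Y) (hX : X < 2) :
    X < 7 / 4 := by
  have a1 := lt_of_inv (by linarith [t.2.1]) (h.gt43 (h.next1 t hX))
  linarith

theorem Adm.two {T : ℝ → ℝ → Prop} (h : Adm T) {X Y : ℝ} (t : Red T X Y) (hX : 2 < X) :
    2 < (X - 2)⁻¹ ∧ 2 < Y⁻¹ := by
  have hp := h.pos t.1
  have h3 := h.lt3 t
  have n := h.next2 t hX h3
  have d := h.dual t
  have a1 := gt_of_inv (by linarith) (h.lt3 n)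
  have a2 := gt_of_inv hp.2 (h.flip.lt3 d)
  have h1 := h.bd' (h.fwd t.1 t.2.1)
  have h2 := t.2.2
  constructor
  · by_contra! hc
    have b := gt_of_inv (by linarith) (h.lt74 n (lt_of_le_of_ne hc (h.ne2 n)))
    nlinarith [mul_pos (sub_pos.2 b) (sub_pos.2 a2)]
  · by_contra! hc
    have b := gt_of_inv hp.2 (h.flip.lt74 d (lt_of_le_of_ne hc (h.flip.ne2 d)))
    nlinarith [mul_pos (sub_pos.2 b) (sub_pos.2 a1)]

theorem eq_of_pow {x y : ℝ} (h : ∀ n : ℕ, |x - y| ≤ (1 / 2) ^ n) : x = y := by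
  have h1 : |x - y| ≤ 0 :=
    ge_of_tendsto' (tendsto_pow_atTop_nhds_zero_of_lt_one (by norm_num) (by norm_num)) h
  have := abs_nonpos_iff.1 h1
  linarith

theorem Adm.silver {T : ℝ → ℝ → Prop} (h : Adm T) (n : ℕ) : ∀ {X Y : ℝ}, Red T X Y → 2 < X →
    |X - (1 + Real.sqrt 2)| ≤ (1 / 2) ^ n := by
  have hs := sqrt2_bds
  have hsq : Real.sqrt 2 * Real.sqrt 2 = 2 := Real.mul_self_sqrt (by norm_num)
  induction n with
  | zero =>
    intro X Y t hX
    have := h.lt3 t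
    rw [abs_le]; constructor <;> norm_num <;> linarith
  | succ n ih =>
    intro X Y t hX
    have h3 := h.lt3 t
    have h2 := (h.two t hX).1
    have hlt := lt_of_inv (by linarith) h2
    have i := ih (h.next2 t hX h3) h2
    have hne : X - 2 ≠ 0 := by linarith
    have e : X - (1 + Real.sqrt 2) =
        -((X - 2) * (Real.sqrt 2 - 1) * ((X - 2)⁻¹ - (1 + Real.sqrt 2))) := by
      field_simp
      linear_combination (-(X - 2)) * hsq
    rw [e, abs_neg, abs_mul, abs_of_pos (mul_pos (by linarith) (by linarith)), pow_succ]
    have : (X - 2) * (Real.sqrt 2 - 1) ≤ 1 / 2 := by nlinarith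
    have h0 := abs_nonneg ((X - 2)⁻¹ - (1 + Real.sqrt 2))
    nlinarith

theorem Adm.le2 {T : ℝ → ℝ → Prop} (h : Adm T) {X Y : ℝ} (t : Red T X Y) : X < 2 := by
  by_contra! hc
  have hX : 2 < X := lt_of_le_of_ne hc (h.ne2 t).symm
  have hp := h.pos t.1
  have hsq : Real.sqrt 2 * Real.sqrt 2 = 2 := Real.mul_self_sqrt (by norm_num)
  have e1 : X = 1 + Real.sqrt 2 := eq_of_pow fun n => h.silver n t hX
  have e2 : Y⁻¹ = 1 + Real.sqrt 2 :=
    eq_of_pow fun n => h.flip.silver n (h.dual t) (h.two t hX).2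
  have e3 : Y = Real.sqrt 2 - 1 := by
    rw [← inv_inv Y, e2]
    apply inv_eq_of_mul_eq_one_right
    linear_combination hsq
  have := h.bd (h.fwd t.1 t.2.1)
  rw [e1, e3] at this
  nlinarith

theorem sqrt5_bds : 2.2 < Real.sqrt 5 ∧ Real.sqrt 5 < 2.25 := by
  constructor
  · apply Real.lt_sqrt_of_sq_lt; norm_num
  · rw [Real.sqrt_lt' (by norm_num)]; norm_num

theorem Adm.golden {T : ℝ → ℝ → Prop} (h : Adm T) (n : ℕ) : ∀ {X Y : ℝ}, Red T X Y →
    |X - (1 + Real.sqrt 5) / 2| ≤ (1 / 2) ^ n := by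
  have hs := sqrt5_bds
  have hsq : Real.sqrt 5 * Real.sqrt 5 = 5 := Real.mul_self_sqrt (by norm_num)
  induction n with
  | zero =>
    intro X Y t
    have := h.le2 t
    have := t.2.1
    rw [abs_le]; constructor <;> norm_num <;> linarith
  | succ n ih =>
    intro X Y t
    have h3 := h.le2 t
    have h2 := h.lt74 t h3
    have h1 := t.2.1
    have i := ih (h.next1 t h3)
    have hne : X - 1 ≠ 0 := by linarith
    have e : X - (1 + Real.sqrt 5) / 2 =
        -((X - 1) * ((1 + Real.sqrt 5) / 2 - 1) * ((X - 1)⁻¹ - (1 + Real.sqrt 5) / 2)) := by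
      field_simp
      linear_combination (-(X - 1)) * hsq
    rw [e, abs_neg, abs_mul, abs_of_pos (mul_pos (by linarith) (by linarith)), pow_succ]
    have : (X - 1) * ((1 + Real.sqrt 5) / 2 - 1) ≤ 1 / 2 := by nlinarith
    have h0 := abs_nonneg ((X - 1)⁻¹ - (1 + Real.sqrt 5) / 2)
    nlinarith

theorem Adm.exRed1 {T : ℝ → ℝ → Prop} (h : Adm T) (n : ℕ) : ∀ {X Y : ℝ}, T X Y → X < n + 1 →
    1 < Y → ∃ X' Y', Red T X' Y' := by
  induction n with
  | zero =>
    intro X Y t hX hY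
    exact ⟨_, _, h.toRed t (by simpa using hX) hY⟩
  | succ n ih =>
    intro X Y t hX hY
    rcases lt_or_gt_of_ne (h.ne t).1 with h1 | h1
    · exact ⟨_, _, h.toRed t h1 hY⟩
    · push_cast at hX
      exact ih (h.fwd t h1) (by linarith) (by linarith)

theorem Adm.exRed {T : ℝ → ℝ → Prop} (h : Adm T) {X Y : ℝ} (t : T X Y) :
    ∃ X' Y', Red T X' Y' := by
  have key : ∀ {X Y : ℝ}, T X Y → 1 < Y → ∃ X' Y', Red T X' Y' := by
    intro X Y t hY
    obtain ⟨n, hn⟩ := exists_nat_gt X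
    exact h.exRed1 n t (by linarith) hY
  rcases lt_or_gt_of_ne (h.ne t).2 with h1 | h1
  · exact key (h.inv t) ((one_lt_inv₀ (h.pos t).2).2 h1)
  · exact key t h1

theorem Adm.main {T : ℝ → ℝ → Prop} (h : Adm T) {X Y : ℝ} (t : T X Y) :
    T ((1 + Real.sqrt 5) / 2) ((1 + Real.sqrt 5) / 2)⁻¹ := by
  obtain ⟨X', Y', r⟩ := h.exRed t
  have e1 : X' = (1 + Real.sqrt 5) / 2 := eq_of_pow fun n => h.golden n r
  have e2 : Y'⁻¹ = (1 + Real.sqrt 5) / 2 := eq_of_pow fun n => h.flip.golden n (h.dual r)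
  have := r.1
  rw [e1] at this
  rwa [← e2, inv_inv, e2]

/-! ### Part 2: lattices -/

theorem gen_sub_le (v w : ℝ × ℝ) : latticeGen (v - w) w ⊆ latticeGen v w := by
  rintro p ⟨m, n, rfl⟩
  refine ⟨m, n - m, ?_⟩
  push_cast
  module

theorem gen_add_le (v w : ℝ × ℝ) : latticeGen (v + w) w ⊆ latticeGen v w := by
  rintro p ⟨m, n, rfl⟩
  refine ⟨m, n + m, ?_⟩
  push_cast
  module

theorem gen_add (v w : ℝ × ℝ) : latticeGen (v + w) w = latticeGen v w := by
  apply Set.Subset.antisymm (gen_add_le v w)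
  have := gen_sub_le (v + w) w
  rwa [add_sub_cancel_right] at this

theorem gen_sub (v w : ℝ × ℝ) : latticeGen (v - w) w = latticeGen v w := by
  have := gen_add (v - w) w
  rw [sub_add_cancel] at this
  exact this.symm

theorem gen_comm (v w : ℝ × ℝ) : latticeGen v w = latticeGen w v := by
  ext p
  constructor <;> rintro ⟨m, n, rfl⟩ <;> exact ⟨n, m, add_comm _ _⟩

theorem gen_neg_le (v w : ℝ × ℝ) : latticeGen (-v) w ⊆ latticeGen v w := by
  rintro p ⟨m, n, rfl⟩
  refine ⟨-m, n, ?_⟩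
  push_cast
  module

theorem gen_neg (v w : ℝ × ℝ) : latticeGen (-v) w = latticeGen v w := by
  apply Set.Subset.antisymm (gen_neg_le v w)
  have := gen_neg_le (-v) w
  rwa [neg_neg] at this

theorem gen_mem_add {v w p q : ℝ × ℝ} (hp : p ∈ latticeGen v w) (hq : q ∈ latticeGen v w) :
    p + q ∈ latticeGen v w := by
  obtain ⟨m, n, rfl⟩ := hp
  obtain ⟨m', n', rfl⟩ := hq
  refine ⟨m + m', n + n', ?_⟩
  push_cast
  module

theorem gen_mem_smul {v w p : ℝ × ℝ} (k : ℤ) (hp : p ∈ latticeGen v w) :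
    (k : ℝ) • p ∈ latticeGen v w := by
  obtain ⟨m, n, rfl⟩ := hp
  refine ⟨k * m, k * n, ?_⟩
  push_cast
  module

theorem gen_mem_neg {v w p : ℝ × ℝ} (hp : p ∈ latticeGen v w) : -p ∈ latticeGen v w := by
  have := gen_mem_smul (-1) hp
  simpa using this

/-- disp is at least the area of each empty box. -/
theorem le_disp {Λ : Set (ℝ × ℝ)} {x₁ x₂ y₁ y₂ : ℝ} (h : isEmptyBox Λ x₁ x₂ y₁ y₂) :
    ENNReal.ofReal ((x₂ - x₁) * (y₂ - y₁)) ≤ disp Λ :=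
  le_sSup ⟨x₁, x₂, y₁, y₂, h, rfl⟩

theorem top_of_large {x : ENNReal} {s : ℝ} (hs : 0 < s)
    (h : ∀ N : ℝ, 0 < N → ENNReal.ofReal (s * N) ≤ x) : x = ⊤ := by
  by_contra hx
  have h1 := h ((x.toReal + 1) / s) (by positivity)
  rw [mul_div_cancel₀ _ hs.ne'] at h1
  have h2 := ENNReal.toReal_mono hx h1
  rw [ENNReal.toReal_ofReal (by positivity)] at h2
  linarith

theorem int_gap {s : ℝ} (hs : s ≠ 0) (k : ℤ) (h0 : 0 < s * k) (h1 : s * k < |s|) : False := by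
  have e : s * k = |s * k| := (abs_of_pos h0).symm
  rw [e, abs_mul] at h0 h1
  have hs' : 0 < |s| := abs_pos.2 hs
  have h2 : 0 < |(k : ℝ)| := pos_of_mul_pos_right h0 hs'.le
  have h3 : |(k : ℝ)| < 1 := by
    by_contra! hc
    nlinarith
  rw [← Int.cast_abs] at h2 h3
  have h4 : 0 < |k| := by exact_mod_cast h2
  have h5 : |k| < 1 := by exact_mod_cast h3
  omega

theorem disp_top_x {Λ : Set (ℝ × ℝ)} {s : ℝ} (hs : s ≠ 0)
    (h : ∀ p ∈ Λ, ∃ k : ℤ, p.1 = s * k) : disp Λ = ⊤ := by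
  apply top_of_large (abs_pos.2 hs)
  intro N hN
  have : isEmptyBox Λ 0 |s| 0 N := by
    refine ⟨abs_pos.2 hs, hN, ?_⟩
    rintro p hp ⟨⟨h1, h2⟩, -⟩
    obtain ⟨k, hk⟩ := h p hp
    rw [hk] at h1 h2
    exact int_gap hs k h1 h2
  simpa using le_disp this

theorem disp_top_y {Λ : Set (ℝ × ℝ)} {s : ℝ} (hs : s ≠ 0)
    (h : ∀ p ∈ Λ, ∃ k : ℤ, p.2 = s * k) : disp Λ = ⊤ := by
  apply top_of_large (abs_pos.2 hs)
  intro N hN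
  have : isEmptyBox Λ 0 N 0 |s| := by
    refine ⟨hN, abs_pos.2 hs, ?_⟩
    rintro p hp ⟨-, ⟨h1, h2⟩⟩
    obtain ⟨k, hk⟩ := h p hp
    rw [hk] at h1 h2
    exact int_gap hs k h1 h2
  simpa [mul_comm] using le_disp this

theorem disp_top_x' {v w : ℝ × ℝ} (h0 : w.1 ≠ 0) (j : ℤ) (h : v.1 = w.1 * j) :
    disp (latticeGen v w) = ⊤ := by
  apply disp_top_x h0
  rintro p ⟨m, n, rfl⟩
  refine ⟨m * j + n, ?_⟩
  simp [h]
  ring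

theorem disp_top_y' {v w : ℝ × ℝ} (h0 : w.2 ≠ 0) (j : ℤ) (h : v.2 = w.2 * j) :
    disp (latticeGen v w) = ⊤ := by
  apply disp_top_y h0
  rintro p ⟨m, n, rfl⟩
  refine ⟨m * j + n, ?_⟩
  simp [h]
  ring

/-- `Λ` has a basis in opposite quadrants with the given absolute coordinates. -/
structure SB (Λ : Set (ℝ × ℝ)) (D a b c d : ℝ) : Prop where
  ha : 0 < a
  hb : 0 < b
  hc : 0 < c
  hd : 0 < d
  hD : a * d + b * c = D
  gen : ∃ σ : ℝ, (σ = 1 ∨ σ = -1) ∧ latticeGen (a, σ * b) (c, -(σ * d)) = Λ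

theorem SB.swap {Λ : Set (ℝ × ℝ)} {D a b c d : ℝ} (h : SB Λ D a b c d) : SB Λ D c d a b := by
  refine ⟨h.hc, h.hd, h.ha, h.hb, by linarith [h.hD], ?_⟩
  obtain ⟨σ, hσ, e⟩ := h.gen
  refine ⟨-σ, by rcases hσ with rfl | rfl <;> simp, ?_⟩
  rw [← e, gen_comm]
  simp

theorem SB.fwd {Λ : Set (ℝ × ℝ)} {D a b c d : ℝ} (h : SB Λ D a b c d) (hac : c < a) :
    SB Λ D (a - c) (b + d) c d := by
  refine ⟨by linarith, by linarith [h.hb, h.hd], h.hc, h.hd, by linarith [h.hD], ?_⟩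
  obtain ⟨σ, hσ, e⟩ := h.gen
  refine ⟨σ, hσ, ?_⟩
  rw [← e, ← gen_sub (a, σ * b)]
  congr 1
  ext <;> simp
  ring

theorem SB.bwd {Λ : Set (ℝ × ℝ)} {D a b c d : ℝ} (h : SB Λ D a b c d) (hac : d < b) :
    SB Λ D (a + c) (b - d) c d := by
  refine ⟨by linarith [h.ha, h.hc], by linarith [h.hb, h.hd], h.hc, h.hd, by linarith [h.hD], ?_⟩
  obtain ⟨σ, hσ, e⟩ := h.gen
  refine ⟨σ, hσ, ?_⟩
  rw [← e, ← gen_add (a, σ * b)]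
  congr 1
  ext <;> simp
  ring

theorem SB.ne_x {Λ : Set (ℝ × ℝ)} {D a b c d : ℝ} (h : SB Λ D a b c d) (hT : disp Λ ≠ ⊤) :
    a ≠ c := by
  rintro rfl
  obtain ⟨σ, hσ, e⟩ := h.gen
  apply hT
  rw [← e]
  exact disp_top_x' h.hc.ne' 1 (by simp)

theorem SB.ne_y {Λ : Set (ℝ × ℝ)} {D a b c d : ℝ} (h : SB Λ D a b c d) (hT : disp Λ ≠ ⊤) :
    b ≠ d := by
  rintro rfl
  obtain ⟨σ, hσ, e⟩ := h.gen
  apply hT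
  rw [← e]
  have := h.hb
  exact disp_top_y' (by rcases hσ with rfl | rfl <;> simp [this.ne']) (-1) (by simp)

theorem box_aux {a b c d : ℝ} (ha : 0 < a) (hb : 0 < b) (hc : 0 < c) (hd : 0 < d) (m n : ℤ)
    (h1 : 0 < m * a + n * c) (h2 : m * a + n * c < a + c) (h3 : -d < m * b - n * d)
    (h4 : m * b - n * d < b) : False := by
  rcases le_or_gt m 0 with hm | hm <;> rcases le_or_gt n 0 with hn | hn
  · have hm' : (m : ℝ) ≤ 0 := by exact_mod_cast hm
    have hn' : (n : ℝ) ≤ 0 := by exact_mod_cast hn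
    nlinarith
  · have hm' : (m : ℝ) ≤ 0 := by exact_mod_cast hm
    have hn' : (1 : ℝ) ≤ n := by exact_mod_cast hn
    nlinarith
  · have hm' : (1 : ℝ) ≤ m := by exact_mod_cast hm
    have hn' : (n : ℝ) ≤ 0 := by exact_mod_cast hn
    nlinarith
  · have hm' : (1 : ℝ) ≤ m := by exact_mod_cast hm
    have hn' : (1 : ℝ) ≤ n := by exact_mod_cast hn
    nlinarith

theorem SB.le_disp {Λ : Set (ℝ × ℝ)} {D a b c d : ℝ} (h : SB Λ D a b c d) :
    ENNReal.ofReal ((a + c) * (b + d)) ≤ disp Λ := by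
  obtain ⟨ha, hb, hc, hd, -, σ, hσ, rfl⟩ := h
  rcases hσ with rfl | rfl
  · have : isEmptyBox (latticeGen (a, 1 * b) (c, -(1 * d))) 0 (a + c) (-d) b := by
      refine ⟨by linarith, by linarith, ?_⟩
      rintro p ⟨m, n, rfl⟩ ⟨⟨h1, h2⟩, ⟨h3, h4⟩⟩
      simp at h1 h2 h3 h4
      exact box_aux ha hb hc hd m n h1 h2 (by linarith) (by linarith)
    simpa using _root_.le_disp this
  · have : isEmptyBox (latticeGen (a, -1 * b) (c, -(-1 * d))) 0 (a + c) (-b) d := by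
      refine ⟨by linarith, by linarith, ?_⟩
      rintro p ⟨m, n, rfl⟩ ⟨⟨h1, h2⟩, ⟨h3, h4⟩⟩
      simp at h1 h2 h3 h4
      exact box_aux ha hb hc hd m n h1 h2 (by linarith) (by linarith)
    have h2 := _root_.le_disp this
    rwa [sub_zero, sub_neg_eq_add, add_comm d b] at h2

/-- Euclidean descent from a basis in one quadrant to one in opposite quadrants. -/
theorem descent {Λ : Set (ℝ × ℝ)} (hT : disp Λ ≠ ⊤) {σ : ℝ} (hσ : σ = 1 ∨ σ = -1) (N : ℕ) :
    ∀ (m n : ℤ) (a b c d : ℝ), m + n ≤ N → 0 < m → 0 < n → 0 < a → 0 < b → 0 < c → 0 < d →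
      latticeGen (a, σ * b) (c, σ * d) = Λ → (m * a - n * c) * (m * b - n * d) < 0 →
      ∃ a' b' c' d', SB Λ |a * d - b * c| a' b' c' d' := by
  induction N with
  | zero => intro m n; intros; push_cast at *; omega
  | succ N ih =>
    intro m n a b c d hN hm hn ha hb hc hd e hz
    have hσ0 : σ ≠ 0 := by rcases hσ with rfl | rfl <;> norm_num
    have hm' : (0 : ℝ) < m := by exact_mod_cast hm
    have hn' : (0 : ℝ) < n := by exact_mod_cast hn
    have hac : a ≠ c := by
      rintro rfl
      exact hT (e ▸ disp_top_x' hc.ne' 1 (by simp))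
    have hbd : b ≠ d := by
      rintro rfl
      exact hT (e ▸ disp_top_y' (by simp [hσ0, hd.ne']) 1 (by simp))
    have e1 : latticeGen (a - c, σ * (b - d)) (c, σ * d) = Λ := by
      rw [← e, ← gen_sub (a, σ * b)]
      congr 1
      ext <;> simp
      ring
    have e2 : latticeGen (c - a, σ * (d - b)) (a, σ * b) = Λ := by
      rw [← e, gen_comm (a, σ * b), ← gen_sub (c, σ * d)]
      congr 1
      ext <;> simp
      ring
    rcases lt_or_gt_of_ne hac with h1 | h1 <;> rcases lt_or_gt_of_ne hbd with h2 | h2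
    · -- both larger: subtract
      have hmn : n < m := by
        by_contra! hle
        have hle' : (m : ℝ) ≤ n := by exact_mod_cast hle
        have i1 : m * a - n * c < 0 := by nlinarith
        have i2 : m * b - n * d < 0 := by nlinarith
        nlinarith
      obtain ⟨a', b', c', d', s⟩ := ih n (m - n) (c - a) (d - b) a b (by push_cast at hN; linarith)
        hn (by linarith) (by linarith) (by linarith) ha hb e2 (by push_cast; nlinarith)
      refine ⟨a', b', c', d', ?_⟩
      convert s using 1
      rw [abs_sub_comm]
      congr 1; ring
    · refine ⟨c - a, b - d, a, b, by linarith, by linarith, ha, hb, ?_, -σ, ?_, ?_⟩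
      · rw [abs_of_neg] <;> nlinarith
      · rcases hσ with rfl | rfl <;> simp
      · rw [← e2]; congr 1 <;> ext <;> simp; ring
    · refine ⟨a - c, d - b, c, d, by linarith, by linarith, hc, hd, ?_, -σ, ?_, ?_⟩
      · rw [abs_of_pos] <;> nlinarith
      · rcases hσ with rfl | rfl <;> simp
      · rw [← e1]; congr 1 <;> ext <;> simp; ring
    · have hmn : m < n := by
        by_contra! hle
        have hle' : (n : ℝ) ≤ m := by exact_mod_cast hle
        have i1 : 0 < m * a - n * c := by nlinarith
        have i2 : 0 < m * b - n * d := by nlinarith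
        nlinarith
      obtain ⟨a', b', c', d', s⟩ := ih m (n - m) (a - c) (b - d) c d (by push_cast at hN; linarith)
        hm (by linarith) (by linarith) (by linarith) hc hd e1 (by push_cast; nlinarith)
      refine ⟨a', b', c', d', ?_⟩
      convert s using 1
      congr 1; ring

theorem exists_sep {a b c d : ℝ} (hc : 0 < c) (hd : 0 < d) (ha : 0 < a) (hb : 0 < b)
    (h : a * d - b * c ≠ 0) :
    ∃ m n : ℤ, 0 < m ∧ 0 < n ∧ (m * a - n * c) * (m * b - n * d) < 0 := by
  have key : ∀ x y : ℝ, 0 < x → x < y → ∃ m n : ℤ, 0 < m ∧ 0 < n ∧ m * x < n ∧ n < m * y := by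
    intro x y hx hxy
    obtain ⟨q, h1, h2⟩ := exists_rat_btwn hxy
    have hq : (0 : ℚ) < q := by exact_mod_cast hx.trans h1
    have hden : (0 : ℝ) < q.den := by exact_mod_cast q.den_pos
    have e : (q : ℝ) = q.num / q.den := by exact_mod_cast (Rat.num_div_den q).symm
    rw [e] at h1 h2
    rw [lt_div_iff₀ hden] at h1
    rw [div_lt_iff₀ hden] at h2
    refine ⟨q.den, q.num, by exact_mod_cast q.den_pos, Rat.num_pos.2 hq, ?_, ?_⟩
    · push_cast; linarith
    · push_cast; linarith
  have hne : a / c ≠ b / d := by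
    intro e
    rw [div_eq_div_iff hc.ne' hd.ne'] at e
    exact h (by linarith)
  have hac : a = a / c * c := by field_simp
  have hbd : b = b / d * d := by field_simp
  rcases lt_or_gt_of_ne hne with hlt | hlt
  · obtain ⟨m, n, hm, hn, h1, h2⟩ := key _ _ (by positivity) hlt
    refine ⟨m, n, hm, hn, mul_neg_of_neg_of_pos ?_ ?_⟩
    · nlinarith [mul_lt_mul_of_pos_right h1 hc]
    · nlinarith [mul_lt_mul_of_pos_right h2 hd]
  · obtain ⟨m, n, hm, hn, h1, h2⟩ := key _ _ (by positivity) hlt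
    refine ⟨m, n, hm, hn, mul_neg_of_pos_of_neg ?_ ?_⟩
    · nlinarith [mul_lt_mul_of_pos_right h2 hc]
    · nlinarith [mul_lt_mul_of_pos_right h1 hd]

theorem exists_SB_pos {v w : ℝ × ℝ} (hT : disp (latticeGen v w) ≠ ⊤)
    (hD : v.1 * w.2 - v.2 * w.1 ≠ 0) (hv : 0 < v.1) (hw : 0 < w.1) :
    ∃ a b c d, SB (latticeGen v w) |v.1 * w.2 - v.2 * w.1| a b c d := by
  obtain ⟨a, y⟩ := v
  obtain ⟨c, z⟩ := w
  simp only at *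
  have hy : y ≠ 0 := by
    rintro rfl
    apply hT
    apply disp_top_y' _ 0 (by simp)
    rintro h
    simp only at h
    exact hD (by rw [h]; ring)
  have hz : z ≠ 0 := by
    rintro rfl
    apply hT
    rw [gen_comm]
    exact disp_top_y' hy 0 (by simp)
  rcases lt_or_gt_of_ne hy with h1 | h1 <;> rcases lt_or_gt_of_ne hz with h2 | h2
  · obtain ⟨m, n, hm, hn, h⟩ := exists_sep hw (neg_pos.2 h2) hv (neg_pos.2 h1)
      (by intro e; exact hD (by linarith))
    obtain ⟨a', b', c', d', s⟩ := descent hT (Or.inr rfl) (m + n).toNat m n a (-y) c (-z) (by omega)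
      hm hn hv (by linarith) hw (by linarith) (by simp) h
    refine ⟨a', b', c', d', ?_⟩
    convert s using 1
    rw [← abs_neg]; congr 1; ring
  · refine ⟨a, -y, c, z, hv, by linarith, hw, h2, ?_, -1, Or.inr rfl, by simp⟩
    rw [abs_of_pos] <;> nlinarith
  · refine ⟨a, y, c, -z, hv, h1, hw, by linarith, ?_, 1, Or.inl rfl, by simp⟩
    rw [abs_of_neg] <;> nlinarith
  · obtain ⟨m, n, hm, hn, h⟩ := exists_sep hw h2 hv h1 hD
    exact descent hT (Or.inl rfl) (m + n).toNat m n a y c z (by omega)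
      hm hn hv h1 hw h2 (by simp) h

theorem exists_SB {v w : ℝ × ℝ} (hT : disp (latticeGen v w) ≠ ⊤)
    (hD : v.1 * w.2 - v.2 * w.1 ≠ 0) :
    ∃ a b c d, SB (latticeGen v w) |v.1 * w.2 - v.2 * w.1| a b c d := by
  have hv : v.1 ≠ 0 := by
    intro h
    apply hT
    apply disp_top_x' _ 0 (by simp [h])
    intro h'
    exact hD (by rw [h, h']; ring)
  have hw : w.1 ≠ 0 := by
    intro h
    apply hT
    rw [gen_comm]
    exact disp_top_x' hv 0 (by simp [h])
  have key : ∀ {v w : ℝ × ℝ}, disp (latticeGen v w) ≠ ⊤ → v.1 * w.2 - v.2 * w.1 ≠ 0 →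
      0 < v.1 → w.1 ≠ 0 →
      ∃ a b c d, SB (latticeGen v w) |v.1 * w.2 - v.2 * w.1| a b c d := by
    intro v w hT hD hv hw
    rcases lt_or_gt_of_ne hw with h | h
    · have e : latticeGen v (-w) = latticeGen v w := by
        rw [gen_comm, gen_neg, gen_comm]
      obtain ⟨a, b, c, d, s⟩ := exists_SB_pos (v := v) (w := -w) (by rwa [e])
        (by simp; intro h'; exact hD (by linarith)) hv (by simpa using h)
      rw [e] at s
      refine ⟨a, b, c, d, ?_⟩
      convert s using 1
      rw [← abs_neg]; congr 1; simp; ring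
    · exact exists_SB_pos hT hD hv h
  rcases lt_or_gt_of_ne hv with h | h
  · obtain ⟨a, b, c, d, s⟩ := key (v := -v) (w := w) (by rwa [gen_neg])
      (by simp; intro h'; exact hD (by linarith)) (by simpa using h) hw
    rw [gen_neg] at s
    refine ⟨a, b, c, d, ?_⟩
    convert s using 1
    rw [← abs_neg]; congr 1; simp; ring
  · exact key hT hD h hw

/-! ### Part 3: upper bounds for the dispersion -/

theorem upper_core {v w : ℝ × ℝ} {α β p q x₁ x₂ y₁ y₂ : ℝ} (hα : 0 < α) (hβ : 0 < β)
    (hp : 0 < p) (hq : 0 < q) (hu : ((α, p) : ℝ × ℝ) ∈ latticeGen v w)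
    (hv : ((-β, q) : ℝ × ℝ) ∈ latticeGen v w)
    (hbox : isEmptyBox (latticeGen v w) x₁ x₂ y₁ y₂)
    (h1 : α < x₂ - x₁) (h2 : β < x₂ - x₁) : y₂ - y₁ ≤ p + q := by
  set Λ := latticeGen v w with hΛ
  obtain ⟨hx, hy, hemp⟩ := hbox
  set μ := min p q with hμ
  have hμ0 : 0 < μ := lt_min hp hq
  have hμp : μ ≤ p := min_le_left _ _
  have hμq : μ ≤ q := min_le_right _ _
  have up : ∀ x y : ℝ, (x, y) ∈ Λ → x₁ < x → x < x₂ →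
      ∃ x' y', (x', y') ∈ Λ ∧ x₁ < x' ∧ x' < x₂ ∧ y + μ ≤ y' ∧ y' ≤ y + (p + q) := by
    intro x y hxy ha hb
    by_cases c1 : x + α < x₂
    · exact ⟨x + α, y + p, gen_mem_add hxy hu, by linarith, c1, by linarith, by linarith⟩
    by_cases c2 : x₁ < x - β
    · exact ⟨x + -β, y + q, gen_mem_add hxy hv, by linarith, by linarith, by linarith,
        by linarith⟩
    push Not at c1 c2
    exact ⟨x + α + -β, y + p + q, gen_mem_add (gen_mem_add hxy hu) hv, by linarith, by linarith,
      by linarith, by linarith⟩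
  have down : ∀ x y : ℝ, (x, y) ∈ Λ → x₁ < x → x < x₂ →
      ∃ x' y', (x', y') ∈ Λ ∧ x₁ < x' ∧ x' < x₂ ∧ y' ≤ y - μ := by
    intro x y hxy ha hb
    by_cases c1 : x₁ < x - α
    · exact ⟨x + -α, y + -p, gen_mem_add hxy (gen_mem_neg hu), by linarith, by linarith,
        by linarith⟩
    by_cases c2 : x + β < x₂
    · exact ⟨x + - -β, y + -q, gen_mem_add hxy (gen_mem_neg hv), by linarith, by linarith,
        by linarith⟩
    push Not at c1 c2
    exact ⟨x + -α + - -β, y + -p + -q,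
      gen_mem_add (gen_mem_add hxy (gen_mem_neg hu)) (gen_mem_neg hv), by linarith, by linarith,
      by linarith⟩
  -- a point in the strip
  have start : ∃ x y, (x, y) ∈ Λ ∧ x₁ < x ∧ x < x₂ := by
    have g := gen_mem_smul (⌊x₁ / α⌋ + 1) hu
    have f1 := Int.lt_floor_add_one (x₁ / α)
    have f2 := Int.floor_le (x₁ / α)
    rw [div_lt_iff₀ hα] at f1
    rw [le_div_iff₀ hα] at f2
    refine ⟨_, _, g, ?_, ?_⟩
    · simp only [smul_eq_mul]; push_cast; linarith
    · simp only [smul_eq_mul]; push_cast; linarith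
  -- a low point in the strip
  have low : ∃ x y, (x, y) ∈ Λ ∧ x₁ < x ∧ x < x₂ ∧ y ≤ y₁ := by
    obtain ⟨x, y, g, a1, a2⟩ := start
    have it : ∀ n : ℕ, ∃ x' y', (x', y') ∈ Λ ∧ x₁ < x' ∧ x' < x₂ ∧ y' ≤ y - n * μ := by
      intro n
      induction n with
      | zero => exact ⟨x, y, g, a1, a2, by simp⟩
      | succ n ih =>
        obtain ⟨x', y', g', b1, b2, b3⟩ := ih
        obtain ⟨x'', y'', g'', c1, c2, c3⟩ := down x' y' g' b1 b2
        exact ⟨x'', y'', g'', c1, c2, by push_cast; linarith⟩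
    obtain ⟨n, hn⟩ := exists_nat_gt ((y - y₁) / μ)
    rw [div_lt_iff₀ hμ0] at hn
    obtain ⟨x', y', g', b1, b2, b3⟩ := it n
    exact ⟨x', y', g', b1, b2, by linarith⟩
  by_contra! hlarge
  obtain ⟨x, y, g, a1, a2, a3⟩ := low
  have it : ∀ n : ℕ, ∃ x' y', (x', y') ∈ Λ ∧ x₁ < x' ∧ x' < x₂ ∧ y' ≤ y₁ ∧ y + n * μ ≤ y' := by
    intro n
    induction n with
    | zero => exact ⟨x, y, g, a1, a2, a3, by simp⟩
    | succ n ih =>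
      obtain ⟨x', y', g', b1, b2, b3, b4⟩ := ih
      obtain ⟨x'', y'', g'', c1, c2, c3, c4⟩ := up x' y' g' b1 b2
      refine ⟨x'', y'', g'', c1, c2, ?_, by push_cast; linarith⟩
      by_contra! hc
      exact hemp _ g'' ⟨⟨c1, c2⟩, ⟨hc, by simp only; linarith⟩⟩
  obtain ⟨n, hn⟩ := exists_nat_gt ((y₁ - y) / μ)
  rw [div_lt_iff₀ hμ0] at hn
  obtain ⟨x', y', g', b1, b2, b3, b4⟩ := it n
  linarith

theorem upper {v w : ℝ × ℝ} {α β p q τ x₁ x₂ y₁ y₂ : ℝ} (hα : 0 < α) (hβ : 0 < β)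
    (hp : 0 < p) (hq : 0 < q) (hτ : τ = 1 ∨ τ = -1)
    (hu : ((α, τ * p) : ℝ × ℝ) ∈ latticeGen v w)
    (hv : ((β, -(τ * q)) : ℝ × ℝ) ∈ latticeGen v w)
    (hbox : isEmptyBox (latticeGen v w) x₁ x₂ y₁ y₂)
    (h1 : α < x₂ - x₁) (h2 : β < x₂ - x₁) : y₂ - y₁ ≤ p + q := by
  rcases hτ with rfl | rfl
  · have hv' := gen_mem_neg hv
    simp at hu hv'
    exact upper_core hα hβ hp hq hu hv' hbox h1 h2
  · have hu' := gen_mem_neg hu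
    simp at hu' hv
    rw [add_comm]
    exact upper_core hβ hα hq hp hv hu' hbox h2 h1

/-- the sequence of quasi-units. -/
theorem units_mem {v w : ℝ × ℝ} {c b ε τ : ℝ} (r : ℤ) (hε : 0 < ε) (hr : ε * ε = r * ε + 1)
    (hτ : τ = 1 ∨ τ = -1)
    (h0 : ((c, τ * b) : ℝ × ℝ) ∈ latticeGen v w)
    (h1 : ((c * ε, -(τ * (b * ε⁻¹))) : ℝ × ℝ) ∈ latticeGen v w) (k : ℤ) :
    ∃ τ : ℝ, (τ = 1 ∨ τ = -1) ∧
      ((c * ε ^ k, τ * (b * (ε ^ k)⁻¹)) : ℝ × ℝ) ∈ latticeGen v w ∧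
      ((c * (ε ^ k * ε), -(τ * (b * (ε ^ k * ε)⁻¹))) : ℝ × ℝ) ∈ latticeGen v w := by
  have hε' := hε.ne'
  induction k using Int.induction_on with
  | zero => exact ⟨τ, hτ, by simpa using h0, by simpa using h1⟩
  | succ i ih =>
    obtain ⟨σ, hσ, g0, g1⟩ := ih
    have hE : (0 : ℝ) < ε ^ (i : ℤ) := by positivity
    refine ⟨-σ, by rcases hσ with rfl | rfl <;> simp, ?_, ?_⟩
    · rw [zpow_add_one₀ hε']
      convert g1 using 2
      ring
    · rw [zpow_add_one₀ hε']
      convert gen_mem_add g0 (gen_mem_smul r g1) using 1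
      generalize ε ^ (i : ℤ) = E at *
      ext
      · simp only [Prod.smul_mk, Prod.mk_add_mk, smul_eq_mul]
        linear_combination c * E * hr
      · simp only [Prod.smul_mk, Prod.mk_add_mk, smul_eq_mul]
        field_simp
        linear_combination (-σ * b) * hr
  | pred i ih =>
    obtain ⟨σ, hσ, g0, g1⟩ := ih
    have hE : (0 : ℝ) < ε ^ (-(i : ℤ)) := by positivity
    refine ⟨-σ, by rcases hσ with rfl | rfl <;> simp, ?_, ?_⟩
    · rw [zpow_sub_one₀ hε']
      convert gen_mem_add g1 (gen_mem_smul (-r) g0) using 1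
      generalize ε ^ (-(i : ℤ)) = E at *
      ext
      · simp only [Prod.smul_mk, Prod.mk_add_mk, smul_eq_mul]
        push_cast
        field_simp
        linear_combination (-c) * hr
      · simp only [Prod.smul_mk, Prod.mk_add_mk, smul_eq_mul]
        push_cast
        field_simp
        linear_combination (-σ * b) * hr
    · rw [zpow_sub_one₀ hε', inv_mul_cancel_right₀ hε']
      convert g0 using 2
      ring

theorem disp_le {Λ : Set (ℝ × ℝ)} {A : ℝ}
    (h : ∀ x₁ x₂ y₁ y₂, isEmptyBox Λ x₁ x₂ y₁ y₂ → (x₂ - x₁) * (y₂ - y₁) ≤ A) :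
    disp Λ ≤ ENNReal.ofReal A := by
  apply sSup_le
  rintro _ ⟨x₁, x₂, y₁, y₂, hb, rfl⟩
  exact ENNReal.ofReal_le_ofReal (h _ _ _ _ hb)

theorem golden_upper {v w : ℝ × ℝ} {c b ε τ : ℝ} (hc : 0 < c) (hb : 0 < b) (hε : 1 < ε)
    (hr : ε * ε = ε + 1)
    (hτ : τ = 1 ∨ τ = -1)
    (h0 : ((c, τ * b) : ℝ × ℝ) ∈ latticeGen v w)
    (h1 : ((c * ε, -(τ * (b * ε⁻¹))) : ℝ × ℝ) ∈ latticeGen v w) :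
    disp (latticeGen v w) ≤ ENNReal.ofReal (c * b * (ε * ε * ε)) := by
  apply disp_le
  intro x₁ x₂ y₁ y₂ hbox
  have hW : 0 < (x₂ - x₁) / (c * ε) := div_pos (sub_pos.2 hbox.1) (by positivity)
  obtain ⟨k, k1, k2⟩ := exists_mem_Ioc_zpow hW hε
  have hε0 : 0 < ε := by linarith
  obtain ⟨σ, hσ, g0, g1⟩ := units_mem 1 hε0 (by push_cast; linarith) hτ h0 h1 k
  rw [zpow_add_one₀ hε0.ne'] at k2
  have hE : (0 : ℝ) < ε ^ k := by positivity
  generalize ε ^ k = E at *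
  rw [lt_div_iff₀ (by positivity)] at k1
  rw [div_le_iff₀ (by positivity)] at k2
  have hcE : 0 < c * E := by positivity
  have hH := upper (by positivity) (by positivity) (by positivity) (by positivity) hσ g0 g1 hbox
    (by nlinarith) (by linarith)
  calc (x₂ - x₁) * (y₂ - y₁) ≤ (E * ε * (c * ε)) * (b * E⁻¹ + b * (E * ε)⁻¹) :=
        mul_le_mul k2 hH (sub_pos.2 hbox.2.1).le (by positivity)
    _ = c * b * (ε * ε * ε) := by
        field_simp
        linarith

theorem silver_upper :
    disp (latticeGen (1, 1) (1 + Real.sqrt 2, 1 - Real.sqrt 2)) ≤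
      ENNReal.ofReal (3 + 2 * Real.sqrt 2) := by
  have hs := sqrt2_bds
  have hsq : Real.sqrt 2 * Real.sqrt 2 = 2 := Real.mul_self_sqrt (by norm_num)
  apply disp_le
  intro x₁ x₂ y₁ y₂ hbox
  set ε := 1 + Real.sqrt 2 with hεd
  have hr : ε * ε = 2 * ε + 1 := by rw [hεd]; linear_combination hsq
  have hε : 1 < ε := by linarith
  have hε0 : 0 < ε := by linarith
  have hinv : ε⁻¹ = Real.sqrt 2 - 1 := by
    apply inv_eq_of_mul_eq_one_right
    rw [hεd]; linear_combination hsq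
  have hW : 0 < (x₂ - x₁) / ε := div_pos (sub_pos.2 hbox.1) (by positivity)
  obtain ⟨k, k1, k2⟩ := exists_mem_Ioc_zpow hW hε
  obtain ⟨σ, hσ, g0, g1⟩ := units_mem (v := (1, 1)) (w := (ε, 1 - Real.sqrt 2))
    (c := 1) (b := 1) (τ := 1) 2 hε0 (by push_cast; linarith)
    (Or.inl rfl) ⟨1, 0, by simp⟩ ⟨0, 1, by simp [hinv]⟩ k
  rw [zpow_add_one₀ hε0.ne'] at k2
  have hE : (0 : ℝ) < ε ^ k := by positivity
  generalize ε ^ k = E at *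
  rw [lt_div_iff₀ (by positivity)] at k1
  rw [div_le_iff₀ (by positivity)] at k2
  have hA : 3 + 2 * Real.sqrt 2 = ε * ε := by rw [hr, hεd]; ring
  rw [hA]
  have hEε : E < E * ε := by nlinarith
  have hy := (sub_pos.2 hbox.2.1).le
  rcases le_or_gt (x₂ - x₁) (E * (1 + ε)) with hcase | hcase
  · have hH := upper (by positivity) (by positivity) (by positivity) (by positivity) hσ g0 g1 hbox
      (by linarith) (by linarith)
    calc (x₂ - x₁) * (y₂ - y₁) ≤ (E * (1 + ε)) * (1 * E⁻¹ + 1 * (E * ε)⁻¹) :=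
          mul_le_mul hcase hH hy (by positivity)
      _ = (1 + ε) * (1 + ε⁻¹) := by field_simp
      _ ≤ ε * ε := by rw [hinv, hr, hεd]; nlinarith
  · have g2 := gen_mem_add g0 g1
    have e : ((1 * E, σ * (1 * E⁻¹)) : ℝ × ℝ) + (1 * (E * ε), -(σ * (1 * (E * ε)⁻¹))) =
        (E * (1 + ε), σ * (E⁻¹ - (E * ε)⁻¹)) := by
      ext
      · simp; ring
      · simp; ring
    rw [e] at g2
    have hlt : (E * ε)⁻¹ < E⁻¹ := inv_strictAnti₀ hE hEε
    have hH := upper (by positivity) (by positivity) (sub_pos.2 hlt) (by positivity) hσ g2 g1 hbox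
      (by linarith) (by linarith)
    calc (x₂ - x₁) * (y₂ - y₁) ≤ (E * ε * ε) * (E⁻¹ - (E * ε)⁻¹ + 1 * (E * ε)⁻¹) :=
          mul_le_mul k2 hH hy (by positivity)
      _ = ε * ε := by field_simp; ring

theorem silver_lower :
    ENNReal.ofReal (3 + 2 * Real.sqrt 2) ≤
    disp (latticeGen (1, 1) (1 + Real.sqrt 2, 1 - Real.sqrt 2)) := by
  have hs := sqrt2_bds
  have hsq : Real.sqrt 2 * Real.sqrt 2 = 2 := Real.mul_self_sqrt (by norm_num)
  have s : SB (latticeGen (1, 1) (1 + Real.sqrt 2, 1 - Real.sqrt 2))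
      ((2 + Real.sqrt 2) * (Real.sqrt 2 - 1) + (2 - Real.sqrt 2) * (1 + Real.sqrt 2))
      (2 + Real.sqrt 2)
      (2 - Real.sqrt 2) (1 + Real.sqrt 2) (Real.sqrt 2 - 1) := by
    refine ⟨by linarith, by linarith, by linarith, by linarith, rfl, 1, Or.inl rfl, ?_⟩
    rw [← gen_add (1, 1)]
    congr 1 <;> ext <;> simp <;> ring
  convert s.le_disp using 2
  ring

/-! ### Part 4: assembly -/

theorem mul_lt_of_not_ge {x : ENNReal} {k A B : ℝ} (hk : 0 < k)
    (hA : ENNReal.ofReal A ≤ x) (h : ¬ ENNReal.ofReal k * x ≥ ENNReal.ofReal B) : k * A < B := by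
  by_contra! hc
  apply h
  calc ENNReal.ofReal B ≤ ENNReal.ofReal (k * A) := ENNReal.ofReal_le_ofReal hc
    _ = ENNReal.ofReal k * ENNReal.ofReal A := ENNReal.ofReal_mul hk.le
    _ ≤ _ := by gcongr

theorem adm_of_lattice {Λ : Set (ℝ × ℝ)} {D : ℝ}
    (hT : disp Λ ≠ ⊤) (hlt : ¬ ENNReal.ofReal (2 * Real.sqrt 2) * disp Λ ≥
        ENNReal.ofReal ((3 + 2 * Real.sqrt 2) * D)) :
    Adm (fun X Y => ∃ a b c d, SB Λ D a b c d ∧ X = a / c ∧ Y = b / d) where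
  pos := by
    rintro X Y ⟨a, b, c, d, s, rfl, rfl⟩
    exact ⟨div_pos s.ha s.hc, div_pos s.hb s.hd⟩
  ne := by
    rintro X Y ⟨a, b, c, d, s, rfl, rfl⟩
    rw [Ne, Ne, div_eq_one_iff_eq s.hc.ne', div_eq_one_iff_eq s.hd.ne']
    exact ⟨s.ne_x hT, s.ne_y hT⟩
  inv := by
    rintro X Y ⟨a, b, c, d, s, rfl, rfl⟩
    exact ⟨c, d, a, b, s.swap, by rw [inv_div], by rw [inv_div]⟩
  fwd := by
    rintro X Y ⟨a, b, c, d, s, rfl, rfl⟩ h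
    rw [lt_div_iff₀ s.hc, one_mul] at h
    have := s.hc.ne'
    have := s.hd.ne'
    exact ⟨_, _, _, _, s.fwd h, by field_simp, by field_simp⟩
  bwd := by
    rintro X Y ⟨a, b, c, d, s, rfl, rfl⟩ h
    rw [lt_div_iff₀ s.hd, one_mul] at h
    have := s.hc.ne'
    have := s.hd.ne'
    exact ⟨_, _, _, _, s.bwd h, by field_simp, by field_simp⟩
  bd := by
    rintro X Y ⟨a, b, c, d, s, rfl, rfl⟩
    have hs := sqrt2_bds
    have hsq : Real.sqrt 2 * Real.sqrt 2 = 2 := Real.mul_self_sqrt (by norm_num)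
    have key := mul_lt_of_not_ge (by linarith) s.le_disp hlt
    rw [← s.hD] at key
    have hc := s.hc
    have hd := s.hd
    have e1 : (a / c + 1) * (b / d + 1) = ((a + c) * (b + d)) / (c * d) := by field_simp
    have e2 : (1 + 3 / 4 * Real.sqrt 2) * (a / c + b / d) =
        ((1 + 3 / 4 * Real.sqrt 2) * (a * d + b * c)) / (c * d) := by
      field_simp
    rw [e1, e2]
    apply div_lt_div_of_pos_right _ (by positivity)
    have h3 : (2 * Real.sqrt 2) * ((a + c) * (b + d)) <
        (2 * Real.sqrt 2) * ((1 + 3 / 4 * Real.sqrt 2) * (a * d + b * c)) := by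
      refine lt_of_lt_of_eq key ?_
      linear_combination (-(3 / 2) * (a * d + b * c)) * hsq
    exact lt_of_mul_lt_mul_left h3 (by linarith)

theorem golden_of_SB {v w : ℝ × ℝ} {D a b c d : ℝ} (s : SB (latticeGen v w) D a b c d)
    (h1 : (1 + Real.sqrt 5) / 2 = a / c) (h2 : ((1 + Real.sqrt 5) / 2)⁻¹ = b / d) :
    ENNReal.ofReal (Real.sqrt 5) * disp (latticeGen v w) =
        ENNReal.ofReal ((2 + Real.sqrt 5) * D) := by
  have hs := sqrt5_bds
  have hsq : Real.sqrt 5 * Real.sqrt 5 = 5 := Real.mul_self_sqrt (by norm_num)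
  set ε := (1 + Real.sqrt 5) / 2 with hε
  have h5 : Real.sqrt 5 = 2 * ε - 1 := by rw [hε]; ring
  have hr : ε * ε = ε + 1 := by rw [h5] at hsq; linarith
  have hε1 : 1 < ε := by linarith
  have hε0 : ε ≠ 0 := by linarith
  have hc := s.hc
  have hd := s.hd
  have ea : a = c * ε := by rw [h1]; field_simp
  have eb : b = d * ε⁻¹ := by rw [h2]; field_simp
  obtain ⟨σ, hσ, e⟩ := s.gen
  have m1 : ((c, -σ * d) : ℝ × ℝ) ∈ latticeGen v w := by
    rw [← e]; exact ⟨0, 1, by simp⟩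
  have m2 : ((c * ε, -(-σ * (d * ε⁻¹))) : ℝ × ℝ) ∈ latticeGen v w := by
    rw [← e, ← eb, ← ea]; exact ⟨1, 0, by simp⟩
  have up := golden_upper hc hd hε1 hr (by rcases hσ with rfl | rfl <;> simp) m1 m2
  have lo := s.le_disp
  have eA : (a + c) * (b + d) = c * d * (ε * ε * ε) := by
    rw [ea, eb]; field_simp
    linear_combination (-(ε * ε) - ε - 1) * hr
  rw [eA] at lo
  rw [le_antisymm up lo, ← ENNReal.ofReal_mul (by linarith), ← s.hD, ea, eb, h5]
  have hi : ε⁻¹ = ε - 1 := by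
    apply inv_eq_of_mul_eq_one_right
    linear_combination hr
  rw [hi]
  congr 1
  linear_combination (c * d * (2 * ε - 1) * (ε + 1)) * hr

/-- The lattice Λ₂ generated by (1,1) and (1+√2, 1−√2) has determinant 2√2 and
dispersion 3 + 2√2; moreover every two-dimensional lattice either has the minimal
normalized dispersion (2+√5)/√5 or normalized dispersion at least (3+2√2)/(2√2). -/
theorem stmt2 :
    |(1 : ℝ) * (1 - Real.sqrt 2) - 1 * (1 + Real.sqrt 2)| = 2 * Real.sqrt 2 ∧
    disp (latticeGen (1, 1) (1 + Real.sqrt 2, 1 - Real.sqrt 2)) =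
      ENNReal.ofReal (3 + 2 * Real.sqrt 2) ∧
    ∀ v w : ℝ × ℝ, LinearIndependent ℝ ![v, w] →
      ENNReal.ofReal (Real.sqrt 5) * disp (latticeGen v w) =
        ENNReal.ofReal ((2 + Real.sqrt 5) * |v.1 * w.2 - v.2 * w.1|) ∨
      ENNReal.ofReal (2 * Real.sqrt 2) * disp (latticeGen v w) ≥
        ENNReal.ofReal ((3 + 2 * Real.sqrt 2) * |v.1 * w.2 - v.2 * w.1|) := by
  have hs := sqrt2_bds
  refine ⟨?_, le_antisymm silver_upper silver_lower, ?_⟩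
  · rw [abs_of_neg] <;> linarith
  · intro v w hli
    by_cases hT : disp (latticeGen v w) = ⊤
    · right
      rw [hT, ENNReal.mul_top]
      · exact le_top
      · exact (ENNReal.ofReal_pos.2 (by linarith)).ne'
    · by_contra! hcon
      obtain ⟨hc1, hc2⟩ := hcon
      have hD : v.1 * w.2 - v.2 * w.1 ≠ 0 := by
        intro h0
        rw [LinearIndependent.pair_iff] at hli
        have a1 := hli w.2 (-v.2) (by ext <;> simp <;> linarith)
        have a2 := hli w.1 (-v.1) (by ext <;> simp <;> linarith)
        have a3 := hli 1 0 (by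
          ext
          · simpa using a2.2
          · simpa using a1.2)
        exact one_ne_zero a3.1
      obtain ⟨a, b, c, d, s⟩ := exists_SB hT hD
      have hadm := adm_of_lattice hT (not_le.2 hc2)
      obtain ⟨a', b', c', d', s', e1, e2⟩ := hadm.main ⟨a, b, c, d, s, rfl, rfl⟩
      exact hc1 (golden_of_SB s' e1 e2)
end

section
/- Let φ = (1+√5)/2 and let Λ be the lattice generated by (1, 1) and (−φ², φ⁻²). Then det(Λ) = 3 and disp(Λ) = 4 + √5; that is, the normalized dispersion of Λ equals (4+√5)/3 ≈ 2.07868. -/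
/-- Walking to the right inside a horizontal strip, one lands in the box. -/
lemma walk_hits (L : Set (ℝ × ℝ)) (hadd : ∀ p ∈ L, ∀ q ∈ L, p + q ∈ L)
    (hneg : ∀ p ∈ L, -p ∈ L) (a b c d : ℝ) (ha : 0 < a) (hb : 0 < b) (hc : 0 < c) (hd : 0 < d)
    (hu : (a, b) ∈ L) (hv : (-c, d) ∈ L) (x₁ x₂ y₁ y₂ : ℝ)
    (hW : a + c < x₂ - x₁) (hHb : b < y₂ - y₁) (hHd : d < y₂ - y₁) (N : ℕ) :
    ∀ x y : ℝ, (x, y) ∈ L → y₁ < y → y < y₂ → x < x₂ → x₁ - x < N * min a c →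
      ∃ p ∈ L, p ∈ Set.Ioo x₁ x₂ ×ˢ Set.Ioo y₁ y₂ := by
  induction N with
  | zero =>
    intro x y h h1 h2 h3 h4
    refine ⟨(x, y), h, ?_⟩
    simp only [Set.mem_prod, Set.mem_Ioo]
    norm_num at h4
    exact ⟨⟨by linarith, h3⟩, h1, h2⟩
  | succ N ih =>
    intro x y h h1 h2 h3 h4
    by_cases hx : x₁ < x
    · exact ⟨(x, y), h, by simp only [Set.mem_prod, Set.mem_Ioo]; exact ⟨⟨hx, h3⟩, h1, h2⟩⟩
    push Not at hx
    push_cast at h4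
    have m1 := min_le_left a c
    have m2 := min_le_right a c
    by_cases c1 : y + b < y₂
    · have := hadd _ h _ hu
      rw [Prod.mk_add_mk] at this
      exact ih _ _ this (by linarith) c1 (by linarith) (by linarith)
    · push Not at c1
      by_cases c2 : y₁ < y - d
      · have := hadd _ h _ (hneg _ hv)
        rw [Prod.neg_mk, Prod.mk_add_mk] at this
        exact ih _ _ this (by linarith) (by linarith) (by linarith) (by linarith)
      · push Not at c2
        have := hadd _ (hadd _ h _ hu) _ (hneg _ hv)
        rw [Prod.neg_mk, Prod.mk_add_mk, Prod.mk_add_mk] at this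
        exact ih _ _ this (by linarith) (by linarith) (by linarith) (by linarith)

lemma natmul_mem (L : Set (ℝ × ℝ)) (h0 : (0, 0) ∈ L) (hadd : ∀ p ∈ L, ∀ q ∈ L, p + q ∈ L)
    (a b : ℝ) (hu : (a, b) ∈ L) (N : ℕ) : (N * a, N * b) ∈ L := by
  induction N with
  | zero => simpa using h0
  | succ N ih =>
    have := hadd _ ih _ hu
    rw [Prod.mk_add_mk] at this
    push_cast
    convert this using 2 <;> ring

lemma box_hits (L : Set (ℝ × ℝ)) (h0 : (0, 0) ∈ L) (hadd : ∀ p ∈ L, ∀ q ∈ L, p + q ∈ L)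
    (hneg : ∀ p ∈ L, -p ∈ L) (a b c d : ℝ) (ha : 0 < a) (hb : 0 < b) (hc : 0 < c) (hd : 0 < d)
    (hu : (a, b) ∈ L) (hv : (-c, d) ∈ L) (x₁ x₂ y₁ y₂ : ℝ)
    (hW : a + c < x₂ - x₁) (hHb : b < y₂ - y₁) (hHd : d < y₂ - y₁) :
    ∃ p ∈ L, p ∈ Set.Ioo x₁ x₂ ×ˢ Set.Ioo y₁ y₂ := by
  obtain ⟨N1, hN1⟩ := exists_nat_gt (-x₂ / a)
  obtain ⟨N2, hN2⟩ := exists_nat_gt (-y₁ / b)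
  rw [div_lt_iff₀ ha] at hN1
  rw [div_lt_iff₀ hb] at hN2
  set N := N1 + N2 with hN
  have e1 : -x₂ < N * a := by
    rw [hN]; push_cast
    have : 0 ≤ (N2 : ℝ) * a := by positivity
    linarith
  have e2 : -y₁ < N * b := by
    rw [hN]; push_cast
    have : 0 ≤ (N1 : ℝ) * b := by positivity
    linarith
  have hq : 0 ≤ (y₁ + N * b) / d := div_nonneg (by linarith) hd.le
  set M := ⌊(y₁ + N * b) / d⌋₊ with hM
  have f1 := Nat.floor_le hq
  have f2 := Nat.lt_floor_add_one ((y₁ + N * b) / d)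
  rw [← hM] at f1 f2
  rw [le_div_iff₀ hd] at f1
  rw [div_lt_iff₀ hd] at f2
  have hmem := hadd _ (hneg _ (natmul_mem L h0 hadd a b hu N)) _
    (natmul_mem L h0 hadd (-c) d hv (M + 1))
  rw [Prod.neg_mk, Prod.mk_add_mk] at hmem
  have hmin : 0 < min a c := lt_min ha hc
  obtain ⟨K, hK⟩ := exists_nat_gt ((x₁ - (-(N * a) + ((M + 1 : ℕ) : ℝ) * -c)) / min a c)
  rw [div_lt_iff₀ hmin] at hK
  have hMc : 0 ≤ ((M : ℝ) + 1) * c := by positivity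
  refine walk_hits L hadd hneg a b c d ha hb hc hd hu hv x₁ x₂ y₁ y₂ hW hHb hHd K _ _ hmem
    ?_ ?_ ?_ hK
  · push_cast; linarith
  · push_cast; linarith
  · push_cast; linarith

/-- Same with a sign. -/
lemma box_hits' (L : Set (ℝ × ℝ)) (h0 : (0, 0) ∈ L) (hadd : ∀ p ∈ L, ∀ q ∈ L, p + q ∈ L)
    (hneg : ∀ p ∈ L, -p ∈ L) (e a b c d : ℝ) (he : e = 1 ∨ e = -1)
    (ha : 0 < a) (hb : 0 < b) (hc : 0 < c) (hd : 0 < d)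
    (hu : (e * a, b) ∈ L) (hv : (-e * c, d) ∈ L) (x₁ x₂ y₁ y₂ : ℝ)
    (hW : a + c < x₂ - x₁) (hHb : b < y₂ - y₁) (hHd : d < y₂ - y₁) :
    ∃ p ∈ L, p ∈ Set.Ioo x₁ x₂ ×ˢ Set.Ioo y₁ y₂ := by
  rcases he with rfl | rfl
  · exact box_hits L h0 hadd hneg a b c d ha hb hc hd (by simpa using hu) (by simpa using hv)
      x₁ x₂ y₁ y₂ hW hHb hHd
  · exact box_hits L h0 hadd hneg c d a b hc hd ha hb (by simpa using hv) (by simpa using hu)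
      x₁ x₂ y₁ y₂ (by linarith) hHd hHb

/-- The sequence of bases. -/
lemma basis_seq (L : Set (ℝ × ℝ)) (hadd : ∀ p ∈ L, ∀ q ∈ L, p + q ∈ L)
    (f : ℝ) (hf : f ^ 2 = f + 1) (hf1 : 1.6 < f) (hf2 : f < 1.62)
    (hu : (1, 1) ∈ L) (hv : (-f, 3 - f) ∈ L) (n : ℕ) :
    ∃ e b d : ℝ, (e = 1 ∨ e = -1) ∧ 0 < b ∧ 0 < d ∧ (e * (f - 1) ^ n, b) ∈ L ∧
      (-e * (f * (f - 1) ^ n), d) ∈ L ∧ f ^ 2 * (f - 1) ^ n * (b + d) ≤ 2 * f + 3 ∧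
      f ^ 3 * (f - 1) ^ n * b ≤ 2 * f + 3 := by
  induction n with
  | zero =>
    refine ⟨1, 1, 3 - f, Or.inl rfl, one_pos, by linarith, by simpa using hu, by simpa using hv,
      ?_, ?_⟩
    · have : f ^ 2 * (f - 1) ^ 0 * (1 + (3 - f)) = 2 * f + 3 := by
        linear_combination (3 - f) * hf
      exact this.le
    · have : f ^ 3 * (f - 1) ^ 0 * 1 = 2 * f + 1 := by linear_combination (f + 1) * hf
      linarith
  | succ n ih =>
    obtain ⟨e, b, d, he, hb, hd, h1, h2, h3, h4⟩ := ih
    refine ⟨-e, b + d, b, ?_, by linarith, hb, ?_, ?_, ?_, ?_⟩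
    · rcases he with rfl | rfl <;> simp
    · have := hadd _ h1 _ h2
      rw [Prod.mk_add_mk] at this
      convert this using 2
      ring
    · convert h1 using 2
      linear_combination (e * (f - 1) ^ n) * hf
    · have : f ^ 2 * (f - 1) ^ (n + 1) * (b + d + b) =
          (f - 1) * (f ^ 2 * (f - 1) ^ n * (b + d)) + (2 - f) * (f ^ 3 * (f - 1) ^ n * b) := by
        linear_combination ((f - 1) ^ n * b * f ^ 2) * hf
      rw [this]
      have k1 := mul_le_mul_of_nonneg_left h3 (by linarith : (0:ℝ) ≤ f - 1)
      have k2 := mul_le_mul_of_nonneg_left h4 (by linarith : (0:ℝ) ≤ 2 - f)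
      linarith
    · have : f ^ 3 * (f - 1) ^ (n + 1) * (b + d) = f ^ 2 * (f - 1) ^ n * (b + d) := by
        linear_combination ((f - 1) ^ n * (b + d) * f ^ 2) * hf
      rw [this]; exact h3

/-- Narrow boxes of large area are hit. -/
lemma narrow_hits (L : Set (ℝ × ℝ)) (h0 : (0, 0) ∈ L) (hadd : ∀ p ∈ L, ∀ q ∈ L, p + q ∈ L)
    (hneg : ∀ p ∈ L, -p ∈ L)
    (f : ℝ) (hf : f ^ 2 = f + 1) (hf1 : 1.6 < f) (hf2 : f < 1.62)
    (hu : (1, 1) ∈ L) (hv : (-f, 3 - f) ∈ L) (x₁ x₂ y₁ y₂ : ℝ) (hx : x₁ < x₂)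
    (hW : x₂ - x₁ ≤ f ^ 2) (hA : 2 * f + 3 < (x₂ - x₁) * (y₂ - y₁)) :
    ∃ p ∈ L, p ∈ Set.Ioo x₁ x₂ ×ˢ Set.Ioo y₁ y₂ := by
  have hf0 : 0 < f := by linarith
  have hW0 : 0 < x₂ - x₁ := by linarith
  obtain ⟨n, hn1, hn2⟩ := exists_nat_pow_near_of_lt_one (x := (x₂ - x₁) / f ^ 2) (y := f - 1)
    (by positivity) ((div_le_one (by positivity)).2 hW) (by linarith) (by linarith)
  rw [lt_div_iff₀ (by positivity)] at hn1
  rw [div_le_iff₀ (by positivity)] at hn2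
  obtain ⟨e, b, d, he, hb, hd, h1, h2, h3, h4⟩ := basis_seq L hadd f hf hf1 hf2 hu hv n
  have ht : 0 < (f - 1) ^ n := pow_pos (by linarith) n
  have hH : b + d < y₂ - y₁ := by
    by_contra hcon
    push Not at hcon
    have k1 : (x₂ - x₁) * (y₂ - y₁) ≤ (x₂ - x₁) * (b + d) :=
      mul_le_mul_of_nonneg_left hcon hW0.le
    have k2 : (x₂ - x₁) * (b + d) ≤ (f - 1) ^ n * f ^ 2 * (b + d) :=
      mul_le_mul_of_nonneg_right hn2 (by linarith)
    linarith
  have hsum := hadd _ h1 _ h2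
  rw [Prod.mk_add_mk] at hsum
  refine box_hits' L h0 hadd hneg e ((f - 1) ^ n) b ((f - 1) * (f - 1) ^ n) (b + d) he ht hb
    (mul_pos (by linarith) ht) (by linarith) h1 ?_ x₁ x₂ y₁ y₂ ?_ (by linarith) hH
  · convert hsum using 2
    ring
  · have : (f - 1) ^ n + (f - 1) * (f - 1) ^ n = (f - 1) ^ (n + 1) * f ^ 2 := by
      linear_combination (-(f - 1) ^ n * f) * hf
    linarith

/-- The lattice generated by (1,1) and (−φ², φ⁻²), where φ is the golden ratio,
has determinant 3 and dispersion 4 + √5. -/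
theorem stmt3 (φ : ℝ) (hφ : φ = (1 + Real.sqrt 5) / 2) :
    |(1 : ℝ) * (φ ^ 2)⁻¹ - 1 * (-(φ ^ 2))| = 3 ∧
    disp (latticeGen (1, 1) (-(φ ^ 2), (φ ^ 2)⁻¹)) = ENNReal.ofReal (4 + Real.sqrt 5) := by
  have h5 : Real.sqrt 5 ^ 2 = 5 := Real.sq_sqrt (by norm_num)
  have h5a : 2.2 < Real.sqrt 5 := Real.lt_sqrt_of_sq_lt (by norm_num)
  have h5b : Real.sqrt 5 < 2.24 := by
    rw [Real.sqrt_lt' (by norm_num)]; norm_num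
  have hf : φ ^ 2 = φ + 1 := by rw [hφ]; linear_combination (1/4) * h5
  have hf1 : 1.6 < φ := by linarith
  have hf2 : φ < 1.62 := by linarith
  have hC : 4 + Real.sqrt 5 = 2 * φ + 3 := by linarith
  have hinv : (φ ^ 2)⁻¹ = 2 - φ := by
    apply inv_eq_of_mul_eq_one_right
    linear_combination (1 - φ) * hf
  rw [hC, hinv, hf]
  refine ⟨by rw [abs_of_pos] <;> linarith, ?_⟩
  set L := latticeGen (1, 1) (-(φ + 1), 2 - φ) with hL
  have hmem : ∀ x y : ℝ, (x, y) ∈ L ↔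
      ∃ m n : ℤ, x = m - n * (φ + 1) ∧ y = m + n * (2 - φ) := by
    intro x y
    simp only [hL, latticeGen, Set.mem_setOf_eq, Prod.smul_mk, Prod.mk_add_mk, Prod.mk.injEq,
      smul_eq_mul]
    constructor
    · rintro ⟨m, n, h1, h2⟩
      exact ⟨m, n, by linarith, by linarith⟩
    · rintro ⟨m, n, h1, h2⟩
      exact ⟨m, n, by linarith, by linarith⟩
  have h0 : ((0 : ℝ), (0 : ℝ)) ∈ L := (hmem _ _).2 ⟨0, 0, by simp, by simp⟩
  have hadd : ∀ p ∈ L, ∀ q ∈ L, p + q ∈ L := by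
    rintro ⟨x, y⟩ hp ⟨x', y'⟩ hq
    obtain ⟨m, n, h1, h2⟩ := (hmem _ _).1 hp
    obtain ⟨m', n', h1', h2'⟩ := (hmem _ _).1 hq
    rw [Prod.mk_add_mk]
    refine (hmem _ _).2 ⟨m + m', n + n', ?_, ?_⟩
    · push_cast; linarith
    · push_cast; linarith
  have hneg : ∀ p ∈ L, -p ∈ L := by
    rintro ⟨x, y⟩ hp
    obtain ⟨m, n, h1, h2⟩ := (hmem _ _).1 hp
    rw [Prod.neg_mk]
    refine (hmem _ _).2 ⟨-m, -n, ?_, ?_⟩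
    · push_cast; linarith
    · push_cast; linarith
  have hu : ((1 : ℝ), (1 : ℝ)) ∈ L := (hmem _ _).2 ⟨1, 0, by simp, by simp⟩
  have hv : (-φ, 3 - φ) ∈ L := (hmem _ _).2 ⟨1, 1, by push_cast; ring, by push_cast; ring⟩
  have hw : (-(φ + 1), 2 - φ) ∈ L := (hmem _ _).2 ⟨0, 1, by push_cast; ring, by push_cast; ring⟩
  have hT : ∀ p q : ℝ, (p, q) ∈ L → ((φ + 1) * q, -(2 - φ) * p) ∈ L := by
    intro p q h
    obtain ⟨m, n, h1, h2⟩ := (hmem _ _).1 h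
    refine (hmem _ _).2 ⟨n, -m, ?_, ?_⟩
    · rw [h2]; push_cast; linear_combination (-(n : ℝ)) * hf
    · rw [h1]; push_cast; linear_combination (-(n : ℝ)) * hf
  have hone : (φ + 1) * (2 - φ) = 1 := by linear_combination -hf
  apply le_antisymm
  · apply sSup_le
    rintro A ⟨x₁, x₂, y₁, y₂, ⟨hx, hy, hempty⟩, rfl⟩
    apply ENNReal.ofReal_le_ofReal
    by_contra hA
    push Not at hA
    suffices h : ∃ p ∈ L, p ∈ Set.Ioo x₁ x₂ ×ˢ Set.Ioo y₁ y₂ by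
      obtain ⟨p, hp, hp2⟩ := h
      exact hempty p hp hp2
    by_cases c1 : x₂ - x₁ ≤ φ ^ 2
    · exact narrow_hits L h0 hadd hneg φ hf hf1 hf2 hu hv x₁ x₂ y₁ y₂ hx c1 hA
    push Not at c1
    by_cases c2 : y₂ - y₁ ≤ 1
    · have e : (-(φ + 1) * y₁ - -(φ + 1) * y₂) * ((2 - φ) * x₂ - (2 - φ) * x₁)
          = (x₂ - x₁) * (y₂ - y₁) := by
        linear_combination ((x₂ - x₁) * (y₂ - y₁)) * hone
      obtain ⟨⟨p, q⟩, hp, hp2⟩ := narrow_hits L h0 hadd hneg φ hf hf1 hf2 hu hv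
        (-(φ + 1) * y₂) (-(φ + 1) * y₁) ((2 - φ) * x₁) ((2 - φ) * x₂)
        (by nlinarith) (by nlinarith) (by rw [e]; exact hA)
      simp only [Set.mem_prod, Set.mem_Ioo] at hp2
      obtain ⟨⟨i1, i2⟩, i3, i4⟩ := hp2
      have g1 : (0 : ℝ) < φ + 1 := by linarith
      have g2 : (0 : ℝ) < 2 - φ := by linarith
      refine ⟨_, hT p q hp, ?_⟩
      simp only [Set.mem_prod, Set.mem_Ioo]
      have j1 := mul_lt_mul_of_pos_left i1 g2
      have j2 := mul_lt_mul_of_pos_left i2 g2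
      have j3 := mul_lt_mul_of_pos_left i3 g1
      have j4 := mul_lt_mul_of_pos_left i4 g1
      have r1 : (2 - φ) * (-(φ + 1) * y₂) = -y₂ := by linear_combination (-y₂) * hone
      have r2 : (2 - φ) * (-(φ + 1) * y₁) = -y₁ := by linear_combination (-y₁) * hone
      have r3 : (φ + 1) * ((2 - φ) * x₁) = x₁ := by linear_combination x₁ * hone
      have r4 : (φ + 1) * ((2 - φ) * x₂) = x₂ := by linear_combination x₂ * hone
      refine ⟨⟨by linarith, by linarith⟩, by linarith, by linarith⟩
    push Not at c2
    by_cases c3 : 3 - φ < y₂ - y₁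
    · exact box_hits L h0 hadd hneg 1 1 φ (3 - φ) one_pos one_pos (by linarith) (by linarith)
        hu hv x₁ x₂ y₁ y₂ (by linarith) c2 c3
    push Not at c3
    refine box_hits L h0 hadd hneg 1 1 (φ + 1) (2 - φ) one_pos one_pos (by linarith)
      (by linarith) hu hw x₁ x₂ y₁ y₂ ?_ c2 (by linarith)
    by_contra c4
    push Not at c4
    have : (x₂ - x₁) * (y₂ - y₁) ≤ (1 + (φ + 1)) * (3 - φ) :=
      mul_le_mul c4 c3 (by linarith) (by linarith)
    nlinarith
  · apply le_sSup
    refine ⟨-φ, 1, 0, 4 - φ, ⟨by linarith, by linarith, ?_⟩, ?_⟩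
    · rintro ⟨x, y⟩ hp hp2
      obtain ⟨m, n, h1, h2⟩ := (hmem _ _).1 hp
      simp only [Set.mem_prod, Set.mem_Ioo] at hp2
      obtain ⟨⟨i1, i2⟩, i3, i4⟩ := hp2
      have hxk : x = ((m - n : ℤ) : ℝ) - n * φ := by rw [h1]; push_cast; ring
      have hyk : y = ((m - n : ℤ) : ℝ) + n * (3 - φ) := by rw [h2]; push_cast; ring
      generalize m - n = k at hxk hyk
      rcases le_or_gt k 0 with hk | hk <;> rcases le_or_gt n 0 with hn | hn
      · have hk' : (k : ℝ) ≤ 0 := by exact_mod_cast hk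
        have hn' : (n : ℝ) ≤ 0 := by exact_mod_cast hn
        nlinarith
      · have hk' : (k : ℝ) ≤ 0 := by exact_mod_cast hk
        have hn' : (1 : ℝ) ≤ n := by exact_mod_cast hn
        nlinarith
      · have hk' : (1 : ℝ) ≤ k := by exact_mod_cast hk
        have hn' : (n : ℝ) ≤ 0 := by exact_mod_cast hn
        nlinarith
      · have hk' : (1 : ℝ) ≤ k := by exact_mod_cast hk
        have hn' : (1 : ℝ) ≤ n := by exact_mod_cast hn
        nlinarith
    · congr 1
      linear_combination hf
end

section
/- Let t, m ∈ ℤ with D = t² − 4m > 0 not a perfect square, and set Δ = (t+√D)/2 and Δ̄ = (t−√D)/2. Let Λ be the lattice generated by (1, 1) and (Δ, Δ̄), i.e. Λ = {(a + bΔ, a + bΔ̄) : a, b ∈ ℤ}, so that det(Λ) = √D. Then disp(Λ) = (√D/2 + 1)² − r/4, where r = 0 if D is even and r = 1 if D is odd. -/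
/-- The lattice as an additive subgroup. -/
def latG (a b : ℝ) : AddSubgroup (ℝ × ℝ) where
  carrier := {p | ∃ m n : ℤ, p = ((m : ℝ) + n * a, (m : ℝ) + n * b)}
  zero_mem' := ⟨0, 0, by ext <;> simp⟩
  add_mem' := by
    rintro _ _ ⟨m, n, rfl⟩ ⟨m', n', rfl⟩
    refine ⟨m + m', n + n', ?_⟩
    ext <;> simp <;> ring
  neg_mem' := by
    rintro _ ⟨m, n, rfl⟩
    refine ⟨-m, -n, ?_⟩
    ext <;> simp <;> ring

lemma mem_latG (a b : ℝ) (p : ℝ × ℝ) :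
    p ∈ latG a b ↔ ∃ m n : ℤ, p = ((m : ℝ) + n * a, (m : ℝ) + n * b) := Iff.rfl

lemma mem_latticeGen_iff (a b : ℝ) (p : ℝ × ℝ) :
    p ∈ latticeGen (1, 1) (a, b) ↔ p ∈ latG a b := by
  rw [mem_latG]
  simp [latticeGen]

/-- No zero divisors. -/
lemma sq_aux (D A b : ℤ) (hsq : ¬∃ k : ℤ, k ^ 2 = D) (h : A ^ 2 = b ^ 2 * D) : b = 0 := by
  by_contra hb
  have h1 : b ^ 2 ∣ A ^ 2 := ⟨D, h⟩
  rw [Int.pow_dvd_pow_iff (by norm_num)] at h1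
  obtain ⟨k, rfl⟩ := h1
  apply hsq
  refine ⟨k, ?_⟩
  have : b ^ 2 ≠ 0 := pow_ne_zero 2 hb
  apply mul_left_cancel₀ this
  linarith [mul_pow b k 2]

/-- Minimal-height elements exist. -/
lemma exists_min_height (a b : ℝ) (hab : 1 ≤ a - b) (w : ℝ) (Q : ℝ × ℝ → Prop)
    (hQ : ∀ p, Q p → |p.1| < w ∧ 0 < p.2) (hne : ∃ p ∈ latG a b, Q p) :
    ∃ p ∈ latG a b, Q p ∧ ∀ q ∈ latG a b, Q q → p.2 ≤ q.2 := by
  obtain ⟨p0, hp0, hQ0⟩ := hne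
  set S : Set (ℝ × ℝ) := {p | p ∈ latG a b ∧ Q p ∧ p.2 ≤ p0.2} with hS
  have hfin : S.Finite := by
    set N : ℝ := w + p0.2
    set M : ℤ := ⌈N⌉
    set M' : ℤ := ⌈w + M * |a|⌉
    apply ((((Set.finite_Icc (-M') M').prod (Set.finite_Icc (-M) M))).image
      (fun mn : ℤ × ℤ => (((mn.1 : ℝ) + mn.2 * a, (mn.1 : ℝ) + mn.2 * b) : ℝ × ℝ))).subset
    rintro _ ⟨⟨m, n, rfl⟩, hq, hy⟩
    refine ⟨(m, n), ?_, rfl⟩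
    obtain ⟨h1, h2⟩ := hQ _ hq
    simp only at h1 h2 hy
    have hn : |(n : ℝ)| ≤ N := by
      have : |(n : ℝ) * (a - b)| ≤ N := by
        rw [abs_lt] at h1
        rw [abs_le]
        constructor <;> simp only [N] <;> linarith
      rw [abs_mul] at this
      refine le_trans ?_ this
      apply le_mul_of_one_le_right (abs_nonneg _)
      exact hab.trans (le_abs_self _)
    have hn' : |(n : ℝ)| ≤ (M : ℝ) := hn.trans (Int.le_ceil _)
    have hm : |(m : ℝ)| ≤ (M' : ℝ) := by
      refine le_trans ?_ (Int.le_ceil _)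
      have e : (m : ℝ) = (m + n * a) - n * a := by ring
      rw [e]
      refine (abs_sub _ _).trans ?_
      rw [abs_mul]
      have := mul_le_mul_of_nonneg_right hn' (abs_nonneg a)
      linarith
    have hn2 : |n| ≤ M := by exact_mod_cast hn'
    have hm2 : |m| ≤ M' := by exact_mod_cast hm
    rw [abs_le] at hn2 hm2
    exact ⟨hm2, hn2⟩
  obtain ⟨p, hp, hmin⟩ := Set.exists_min_image S (fun p => p.2) hfin ⟨p0, hp0, hQ0, le_rfl⟩
  refine ⟨p, hp.1, hp.2.1, fun q hq hQq => ?_⟩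
  by_cases hle : q.2 ≤ p0.2
  · exact hmin q ⟨hq, hQq, hle⟩
  · exact hp.2.2.trans (not_le.1 hle).le

/-- Reducing `P` modulo `q`, when the heights have opposite signs. -/
lemma reduce_mod (G : AddSubgroup (ℝ × ℝ)) (hinj : ∀ p ∈ G, p.1 = 0 → p.2 = 0)
    (P q : ℝ × ℝ) (hP : P ∈ G) (hq : q ∈ G) (hP1 : 0 < P.1) (hq1 : 0 < q.1) (σ : ℝ)
    (hP2 : 0 < σ * P.2) (hq2 : σ * q.2 ≤ 0) :
    ∃ p ∈ G, 0 < p.1 ∧ p.1 < q.1 ∧ 0 < σ * p.2 := by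
  have hn0 : 0 ≤ ⌊P.1 / q.1⌋ := Int.floor_nonneg.2 (by positivity)
  have hn : (0 : ℝ) ≤ (⌊P.1 / q.1⌋ : ℝ) := by exact_mod_cast hn0
  set n := ⌊P.1 / q.1⌋
  have hm : P - n • q ∈ G := G.sub_mem hP (G.zsmul_mem hq n)
  have e1 : (P - n • q).1 = P.1 - n * q.1 := by simp
  have e2 : (P - n • q).2 = P.2 - n * q.2 := by simp
  have hpos : 0 < σ * (P - n • q).2 := by
    rw [e2]; nlinarith
  have h1 : (n : ℝ) * q.1 ≤ P.1 := by
    rw [← le_div_iff₀ hq1]; exact Int.floor_le _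
  have h2 : P.1 < ((n : ℝ) + 1) * q.1 := by
    rw [← div_lt_iff₀ hq1]; exact Int.lt_floor_add_one _
  refine ⟨_, hm, ?_, ?_, hpos⟩
  · have hne : (P - n • q).1 ≠ 0 := by
      intro h
      rw [hinj _ hm h] at hpos
      simp at hpos
    refine lt_of_le_of_ne ?_ hne.symm
    rw [e1]; linarith
  · rw [e1]; linarith

/-- One step of the staircase inside a vertical strip. -/
lemma step_up (G : AddSubgroup (ℝ × ℝ)) (u v : ℝ × ℝ) (hu : u ∈ G) (hv : v ∈ G)
    (x₁ x₂ : ℝ) (hu1 : u.1 < 0) (hu1' : x₁ - x₂ < u.1)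
    (hv1 : 0 < v.1) (hv1' : v.1 < x₂ - x₁) (p : ℝ × ℝ) (hp : p ∈ G)
    (h1 : x₁ < p.1) (h2 : p.1 < x₂) :
    ∃ q ∈ G, x₁ < q.1 ∧ q.1 < x₂ ∧ (q = p + u ∨ q = p + v ∨ q = p + (u + v)) := by
  by_cases hA : p.1 + v.1 < x₂
  · refine ⟨p + v, G.add_mem hp hv, ?_, ?_, by simp⟩ <;> simp <;> linarith
  by_cases hB : x₁ < p.1 + u.1
  · refine ⟨p + u, G.add_mem hp hu, ?_, ?_, by simp⟩ <;> simp <;> linarith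
  refine ⟨p + (u + v), G.add_mem hp (G.add_mem hu hv), ?_, ?_, by simp⟩ <;> simp <;> linarith

lemma height_le (G : AddSubgroup (ℝ × ℝ)) (u v : ℝ × ℝ) (hu : u ∈ G) (hv : v ∈ G)
    (x₁ x₂ y₁ y₂ : ℝ) (hu1 : u.1 < 0) (hu1' : x₁ - x₂ < u.1)
    (hv1 : 0 < v.1) (hv1' : v.1 < x₂ - x₁) (hu2 : 0 < u.2) (hv2 : 0 < v.2)
    (hemp : ∀ p ∈ G, x₁ < p.1 → p.1 < x₂ → y₁ < p.2 → p.2 < y₂ → False) :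
    y₂ - y₁ ≤ u.2 + v.2 := by
  by_contra hlt
  push Not at hlt
  obtain ⟨c, hc0, hcu, hcv⟩ : ∃ c : ℝ, 0 < c ∧ c ≤ u.2 ∧ c ≤ v.2 :=
    ⟨min u.2 v.2, lt_min hu2 hv2, min_le_left _ _, min_le_right _ _⟩
  obtain ⟨p0, hp0, h01, h02⟩ : ∃ p ∈ G, x₁ < p.1 ∧ p.1 < x₂ := by
    have a1 : (⌊x₁ / v.1⌋ : ℝ) * v.1 ≤ x₁ := by
      rw [← le_div_iff₀ hv1]; exact Int.floor_le _
    have a2 : x₁ < ((⌊x₁ / v.1⌋ : ℝ) + 1) * v.1 := by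
      rw [← div_lt_iff₀ hv1]; exact Int.lt_floor_add_one _
    refine ⟨(⌊x₁ / v.1⌋ + 1) • v, G.zsmul_mem hv _, ?_, ?_⟩
    · simp; linarith
    · simp; linarith
  have down : ∀ n : ℕ, ∃ p ∈ G, x₁ < p.1 ∧ p.1 < x₂ ∧ p.2 ≤ p0.2 - n * c := by
    intro n
    induction n with
    | zero => exact ⟨p0, hp0, h01, h02, by simp⟩
    | succ k ih =>
      obtain ⟨p, hp, h1, h2, h3⟩ := ih
      obtain ⟨q, hq, g1, g2, g3⟩ := step_up G (-v) (-u) (G.neg_mem hv) (G.neg_mem hu) x₁ x₂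
        (by simpa using hv1) (by simp; linarith) (by simpa using hu1) (by simp; linarith) p hp h1 h2
      refine ⟨q, hq, g1, g2, ?_⟩
      push_cast
      rcases g3 with rfl | rfl | rfl <;> simp <;> linarith
  obtain ⟨N, hN⟩ := exists_nat_gt ((p0.2 - y₁) / c)
  rw [div_lt_iff₀ hc0] at hN
  obtain ⟨p1, hp1, h11, h12, h13⟩ := down N
  have up : ∀ n : ℕ, ∃ p ∈ G, x₁ < p.1 ∧ p.1 < x₂ ∧ p.2 ≤ y₁ ∧ p1.2 + n * c ≤ p.2 := by
    intro n
    induction n with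
    | zero => exact ⟨p1, hp1, h11, h12, by linarith, by simp⟩
    | succ k ih =>
      obtain ⟨p, hp, h1, h2, h3, h4⟩ := ih
      obtain ⟨q, hq, g1, g2, g3⟩ := step_up G u v hu hv x₁ x₂ hu1 hu1' hv1 hv1' p hp h1 h2
      have b1 : p.2 + c ≤ q.2 := by rcases g3 with rfl | rfl | rfl <;> simp <;> linarith
      have b2 : q.2 ≤ p.2 + (u.2 + v.2) := by
        rcases g3 with rfl | rfl | rfl <;> simp <;> linarith
      refine ⟨q, hq, g1, g2, ?_, ?_⟩
      · by_contra hh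
        push Not at hh
        exact hemp q hq g1 g2 hh (by linarith)
      · push_cast; linarith
  obtain ⟨M, hM⟩ := exists_nat_gt ((y₁ - p1.2) / c)
  rw [div_lt_iff₀ hc0] at hM
  obtain ⟨p, _, _, _, h3, h4⟩ := up M
  linarith

/-- The two minimal vectors generate. -/
lemma generate (G : AddSubgroup (ℝ × ℝ)) (hinj : ∀ p ∈ G, p.1 = 0 → p.2 = 0)
    (hinj' : ∀ p ∈ G, p.2 = 0 → p.1 = 0) (w : ℝ)
    (u v : ℝ × ℝ) (hu : u ∈ G) (hv : v ∈ G)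
    (hu1 : u.1 < 0) (hu1' : -w < u.1) (hv1 : 0 < v.1) (hv1' : v.1 < w)
    (hu2 : 0 < u.2) (hv2 : 0 < v.2)
    (hum : ∀ q ∈ G, -w < q.1 → q.1 < 0 → 0 < q.2 → u.2 ≤ q.2)
    (hvm : ∀ q ∈ G, 0 < q.1 → q.1 < w → 0 < q.2 → v.2 ≤ q.2)
    (p : ℝ × ℝ) (hp : p ∈ G) : ∃ i j : ℤ, p = i • u + j • v := by
  have cell : ∀ q ∈ G, ∀ α β : ℝ, 0 ≤ α → α < 1 → 0 ≤ β → β < 1 →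
      q.1 = α * u.1 + β * v.1 → q.2 = α * u.2 + β * v.2 → q = 0 := by
    intro q hq α β ha ha' hb hb' e1 e2
    by_contra hne
    have hx : q.1 ≠ 0 := fun h => hne (Prod.ext h (hinj q hq h))
    have hy : q.2 ≠ 0 := fun h => hne (Prod.ext (hinj' q hq h) h)
    have hy0 : 0 < q.2 := by
      refine lt_of_le_of_ne ?_ hy.symm
      rw [e2]; positivity
    have k1 : β * v.1 < v.1 := by nlinarith
    have k2 : u.1 < α * u.1 := by nlinarith
    have k3 : α * u.1 ≤ 0 := by nlinarith
    have k4 : 0 ≤ β * v.1 := by positivity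
    have k5 : α * u.2 < u.2 := by nlinarith
    have k6 : β * v.2 < v.2 := by nlinarith
    rcases lt_or_gt_of_ne hx with h | h
    · have m1 := hum q hq (by linarith) h hy0
      have hs := G.sub_mem hq hu
      have hs1 : 0 < (q - u).1 := by simp; linarith
      have hs2 : (q - u).2 ≠ 0 := fun h0 => hs1.ne' (hinj' _ hs h0)
      have hs3 : 0 < (q - u).2 := lt_of_le_of_ne (by simp; linarith) hs2.symm
      have := hvm _ hs hs1 (by simp; linarith) hs3
      simp at this
      linarith
    · have m1 := hvm q hq h (by linarith) hy0
      have hs := G.sub_mem hq hv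
      have hs1 : (q - v).1 < 0 := by simp; linarith
      have hs2 : (q - v).2 ≠ 0 := fun h0 => hs1.ne (hinj' _ hs h0)
      have hs3 : 0 < (q - v).2 := lt_of_le_of_ne (by simp; linarith) hs2.symm
      have := hum _ hs (by simp; linarith) hs1 hs3
      simp at this
      linarith
  have hδ : 0 < v.1 * u.2 - u.1 * v.2 := by nlinarith [mul_pos hv1 hu2]
  set δ := v.1 * u.2 - u.1 * v.2 with hδe
  set α := (v.1 * p.2 - v.2 * p.1) / δ with hα
  set β := (u.2 * p.1 - u.1 * p.2) / δ with hβ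
  have E1 : p.1 = α * u.1 + β * v.1 := by
    rw [hα, hβ]; field_simp; rw [hδe]; ring
  have E2 : p.2 = α * u.2 + β * v.2 := by
    rw [hα, hβ]; field_simp; rw [hδe]; ring
  refine ⟨⌊α⌋, ⌊β⌋, ?_⟩
  have := cell (p - (⌊α⌋ • u + ⌊β⌋ • v))
    (G.sub_mem hp (G.add_mem (G.zsmul_mem hu _) (G.zsmul_mem hv _)))
    (Int.fract α) (Int.fract β) (Int.fract_nonneg _) (Int.fract_lt_one _)
    (Int.fract_nonneg _) (Int.fract_lt_one _)
    (by simp only [Prod.fst_sub, Prod.fst_add, Prod.smul_fst]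
        simp only [zsmul_eq_mul, Int.fract]
        linarith)
    (by simp only [Prod.snd_sub, Prod.snd_add, Prod.smul_snd]
        simp only [zsmul_eq_mul, Int.fract]
        linarith)
  exact sub_eq_zero.1 this

/-- Minimal vectors are far apart horizontally. -/
lemma width_le (G : AddSubgroup (ℝ × ℝ))
    (hinj' : ∀ p ∈ G, p.2 = 0 → p.1 = 0) (w : ℝ)
    (u v : ℝ × ℝ) (hu : u ∈ G) (hv : v ∈ G)
    (hu1 : u.1 < 0) (hv1 : 0 < v.1)
    (hu2 : 0 < u.2) (hv2 : 0 < v.2)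
    (hum : ∀ q ∈ G, -w < q.1 → q.1 < 0 → 0 < q.2 → u.2 ≤ q.2)
    (hvm : ∀ q ∈ G, 0 < q.1 → q.1 < w → 0 < q.2 → v.2 ≤ q.2) :
    w ≤ v.1 - u.1 := by
  by_contra hlt
  push Not at hlt
  rcases lt_trichotomy u.2 v.2 with h | h | h
  · have := hvm (v - u) (G.sub_mem hv hu) (by simp; linarith) (by simp; linarith)
      (by simp; linarith)
    simp at this
    linarith
  · have := hinj' (v - u) (G.sub_mem hv hu) (by simp; linarith)
    simp at this
    linarith
  · have := hum (u - v) (G.sub_mem hu hv) (by simp; linarith) (by simp; linarith)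
      (by simp; linarith)
    simp at this
    linarith

/-- The norm of a lattice point is an integer. -/
lemma norm_int (t m : ℤ) (a b : ℝ) (hs : a + b = t) (hp : a * b = m) (p : ℝ × ℝ)
    (h : p ∈ latG a b) : ∃ k : ℤ, p.1 * p.2 = k := by
  obtain ⟨i, j, rfl⟩ := h
  refine ⟨i ^ 2 + t * i * j + m * j ^ 2, ?_⟩
  push_cast
  rw [← hs, ← hp]
  ring

lemma upper_s4 (t m : ℤ) (a b s : ℝ) (hD : 0 < t ^ 2 - 4 * m)
    (hsq : ¬∃ k : ℤ, k ^ 2 = t ^ 2 - 4 * m) (hs0 : 0 < s) (hs : s ^ 2 = (t : ℝ) ^ 2 - 4 * m)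
    (ha : a = (t + s) / 2) (hb : b = (t - s) / 2) (x₁ x₂ y₁ y₂ : ℝ) (hx : x₁ < x₂)
    (hemp : ∀ p ∈ latG a b, x₁ < p.1 → p.1 < x₂ → y₁ < p.2 → p.2 < y₂ → False) (hy : y₁ < y₂) :
    (x₂ - x₁) * (y₂ - y₁) ≤ (s / 2 + 1) ^ 2 -
      (if (2 : ℤ) ∣ (t ^ 2 - 4 * m) then (0 : ℝ) else 1) / 4 := by
  have hab : a - b = s := by rw [ha, hb]; ring
  have hsum : a + b = t := by rw [ha, hb]; ring
  have hprod : a * b = m := by rw [ha, hb]; linarith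
  have hs1 : 1 ≤ s := by
    have : (1 : ℝ) ≤ (t : ℝ) ^ 2 - 4 * m := by exact_mod_cast hD
    nlinarith
  have key : ∀ i j : ℤ, ((2 * i + j * t : ℤ) : ℝ) ^ 2 = (j : ℝ) ^ 2 * s ^ 2 → j = 0 := by
    intro i j h
    apply sq_aux (t ^ 2 - 4 * m) (2 * i + j * t) j hsq
    rw [hs] at h
    exact_mod_cast h
  have hinj : ∀ p ∈ latG a b, p.1 = 0 → p.2 = 0 := by
    rintro _ ⟨i, j, rfl⟩ h
    simp only at h ⊢
    have hj := key i j (by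
      push_cast
      have : (2 * i + j * t : ℝ) = - (j * s) := by rw [ha] at h; linarith
      rw [this]; ring)
    subst hj
    simpa using h
  have hinj' : ∀ p ∈ latG a b, p.2 = 0 → p.1 = 0 := by
    rintro _ ⟨i, j, rfl⟩ h
    simp only at h ⊢
    have hj := key i j (by
      push_cast
      have : (2 * i + j * t : ℝ) = j * s := by rw [hb] at h; linarith
      rw [this]; ring)
    subst hj
    simpa using h
  set w := x₂ - x₁ with hw
  have hw0 : 0 < w := by linarith
  have hone : ((1, 1) : ℝ × ℝ) ∈ latG a b := ⟨1, 0, by simp⟩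
  have hsm : ((s, -s) : ℝ × ℝ) ∈ latG a b := by
    refine ⟨-t, 2, ?_⟩
    push_cast
    rw [ha, hb]
    ext <;> simp <;> ring
  have hmemA : ((a, b) : ℝ × ℝ) ∈ latG a b := ⟨0, 1, by simp⟩
  obtain ⟨q, hq, hq1, hq1'⟩ : ∃ q ∈ latG a b, 0 < q.1 ∧ q.1 < w := by
    obtain ⟨n, hn⟩ := exists_nat_gt (1 / w)
    have hn0 : (0 : ℝ) < n := lt_trans (by positivity) hn
    obtain ⟨j, k, hk, _, hle⟩ := Real.exists_int_int_abs_mul_sub_le a (n := n)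
      (by exact_mod_cast hn0)
    have hlt : |(k : ℝ) * a - j| < w := by
      refine hle.trans_lt ?_
      rw [div_lt_iff₀ (by positivity)]
      rw [div_lt_iff₀ hw0] at hn
      linarith
    have hmem : (((-j : ℤ) : ℝ) + k * a, ((-j : ℤ) : ℝ) + k * b) ∈ latG a b := ⟨-j, k, rfl⟩
    have hne : (k : ℝ) * a - j ≠ 0 := by
      intro h
      have := hk.ne' (key (-j) k (by
        push_cast
        have : (2 * -j + k * t : ℝ) = - (k * s) := by rw [ha] at h; linarith
        rw [this]; ring))
      exact this
    rw [abs_lt] at hlt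
    rcases lt_or_gt_of_ne hne with h | h
    · refine ⟨_, (latG a b).neg_mem hmem, ?_, ?_⟩ <;> simp <;> linarith
    · refine ⟨_, hmem, ?_, ?_⟩ <;> simp <;> linarith
  obtain ⟨v0, hv0, hv01, hv02, hv03⟩ : ∃ p ∈ latG a b, 0 < p.1 ∧ p.1 < w ∧ 0 < p.2 := by
    rcases le_or_gt q.2 0 with h | h
    · obtain ⟨p, hp, h1, h2, h3⟩ := reduce_mod (latG a b) hinj (1, 1) q hone hq (by simp) hq1 1
        (by simp) (by linarith)
      exact ⟨p, hp, h1, by linarith, by linarith⟩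
    · exact ⟨q, hq, hq1, hq1', h⟩
  obtain ⟨u0, hu0, hu01, hu02, hu03⟩ : ∃ p ∈ latG a b, -w < p.1 ∧ p.1 < 0 ∧ 0 < p.2 := by
    obtain ⟨p, hp, h1, h2, h3⟩ := reduce_mod (latG a b) hinj (s, -s) v0 hsm hv0 (by simpa) hv01 (-1)
        (by simpa) (by linarith)
    exact ⟨-p, (latG a b).neg_mem hp, by simp; linarith, by simpa using h1, by simp; linarith⟩
  obtain ⟨v, hv, ⟨hv1, hv1', hv2⟩, hvm⟩ := exists_min_height a b (by linarith) w
    (fun p => 0 < p.1 ∧ p.1 < w ∧ 0 < p.2)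
    (fun p h => ⟨abs_lt.2 ⟨by linarith [h.1], h.2.1⟩, h.2.2⟩) ⟨v0, hv0, hv01, hv02, hv03⟩
  obtain ⟨u, hu, ⟨hu1', hu1, hu2⟩, hum⟩ := exists_min_height a b (by linarith) w
    (fun p => -w < p.1 ∧ p.1 < 0 ∧ 0 < p.2)
    (fun p h => ⟨abs_lt.2 ⟨h.1, by linarith [h.2.1]⟩, h.2.2⟩) ⟨u0, hu0, hu01, hu02, hu03⟩
  have hum' : ∀ q ∈ latG a b, -w < q.1 → q.1 < 0 → 0 < q.2 → u.2 ≤ q.2 :=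
    fun q hq h1 h2 h3 => hum q hq ⟨h1, h2, h3⟩
  have hvm' : ∀ q ∈ latG a b, 0 < q.1 → q.1 < w → 0 < q.2 → v.2 ≤ q.2 :=
    fun q hq h1 h2 h3 => hvm q hq ⟨h1, h2, h3⟩
  have hW := width_le (latG a b) hinj' w u v hu hv hu1 hv1 hu2 hv2 hum' hvm'
  have hH := height_le (latG a b) u v hu hv x₁ x₂ y₁ y₂ hu1 (by linarith) hv1 (by linarith)
    hu2 hv2 hemp
  have hgen := generate (latG a b) hinj hinj' w u v hu hv hu1 hu1' hv1 hv1' hu2 hv2 hum' hvm'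
  have hδ : 0 < v.1 * u.2 - u.1 * v.2 := by nlinarith [mul_pos hv1 hu2]
  have hdet : v.1 * u.2 - u.1 * v.2 = s := by
    obtain ⟨i, j, e1⟩ := hgen _ hone
    obtain ⟨k, l, e2⟩ := hgen _ hmemA
    obtain ⟨c, d, eu⟩ := hu
    obtain ⟨e, f, ev⟩ := hv
    rw [Prod.ext_iff] at e1 e2 eu ev
    simp only [Prod.fst_add, Prod.snd_add, Prod.smul_fst, Prod.smul_snd] at e1 e2 eu ev
    simp only [zsmul_eq_mul] at e1 e2
    have d1 : v.1 * u.2 - u.1 * v.2 = ((c * f - d * e : ℤ) : ℝ) * s := by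
      rw [eu.1, eu.2, ev.1, ev.2, ← hab]; push_cast; ring
    have d2 : s = ((i * l - j * k : ℤ) : ℝ) * (u.1 * v.2 - v.1 * u.2) * (-1) := by
      calc s = a * 1 - 1 * b := by linarith
        _ = (k * u.1 + l * v.1) * (i * u.2 + j * v.2)
            - (i * u.1 + j * v.1) * (k * u.2 + l * v.2) := by
          rw [← e2.1, ← e2.2, ← e1.1, ← e1.2]
        _ = _ := by push_cast; ring
    have d3 : (((c * f - d * e) * (i * l - j * k) : ℤ) : ℝ) = 1 := by
      have : s * ((((c * f - d * e) * (i * l - j * k) : ℤ) : ℝ)) = s * 1 := by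
        rw [Int.cast_mul]
        linear_combination (-((i * l - j * k : ℤ) : ℝ)) * d1 - d2
      exact mul_left_cancel₀ hs0.ne' this
    have d4 : (c * f - d * e) * (i * l - j * k) = 1 := by exact_mod_cast d3
    have d5 : 0 < c * f - d * e := by
      have : (0 : ℝ) < ((c * f - d * e : ℤ) : ℝ) := by
        rw [d1] at hδ
        exact pos_of_mul_pos_left hδ hs0.le
      exact_mod_cast this
    have d6 : c * f - d * e = 1 := by
      rcases Int.mul_eq_one_iff_eq_one_or_neg_one.1 d4 with h | h <;> omega
    rw [d1, d6]; simp
  obtain ⟨P, hP⟩ := norm_int t m a b hsum hprod v hv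
  obtain ⟨Q, hQ⟩ := norm_int t m a b hsum hprod (-u) ((latG a b).neg_mem hu)
  simp only [Prod.fst_neg, Prod.snd_neg] at hQ
  obtain ⟨R, hR, hRQ⟩ : ∃ R : ℤ, R = -Q ∧ -(u.1 * u.2) = R := ⟨-Q, rfl, by push_cast; linarith⟩
  have hP1 : 1 ≤ P := by
    have : (0 : ℝ) < P := by rw [← hP]; positivity
    exact_mod_cast this
  have hR1 : 1 ≤ R := by
    have : (0 : ℝ) < R := by rw [← hRQ]; nlinarith
    exact_mod_cast this
  have hB : (v.1 * u.2 + u.1 * v.2) ^ 2 = ((t ^ 2 - 4 * m - 4 * (P * R) : ℤ) : ℝ) := by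
    push_cast
    rw [← hP, ← hRQ, ← hs, ← hdet]; ring
  have hB0 : 0 ≤ t ^ 2 - 4 * m - 4 * (P * R) := by
    have := sq_nonneg (v.1 * u.2 + u.1 * v.2)
    rw [hB] at this
    exact_mod_cast this
  have harea : (x₂ - x₁) * (y₂ - y₁) ≤ s + P + R := by
    have : (x₂ - x₁) * (y₂ - y₁) ≤ (v.1 - u.1) * (u.2 + v.2) :=
      mul_le_mul hW hH (by linarith) (by linarith)
    rw [← hP, ← hRQ, ← hdet]
    linarith
  have hPR : P + R ≤ P * R + 1 := by nlinarith
  have hfin : (4 * (P + R) : ℝ) ≤ s ^ 2 + 4 -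
      (if (2 : ℤ) ∣ (t ^ 2 - 4 * m) then (0 : ℝ) else 1) := by
    rw [hs]
    split_ifs with h2
    · have : 4 * (P + R) ≤ t ^ 2 - 4 * m + 4 := by linarith
      have : (4 * (P + R) : ℝ) ≤ t ^ 2 - 4 * m + 4 := by exact_mod_cast this
      linarith
    · have : 4 * (P + R) ≤ t ^ 2 - 4 * m + 4 - 1 := by omega
      have : (4 * (P + R) : ℝ) ≤ t ^ 2 - 4 * m + 4 - 1 := by exact_mod_cast this
      linarith
  linarith

lemma lower (t m : ℤ) (a b s : ℝ) (k r : ℤ) (hr0 : 0 ≤ r) (hrs : (r : ℝ) < s)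
    (ht : t = 2 * k + r)
    (ha : a = (t + s) / 2) (hb : b = (t - s) / 2) (p : ℝ × ℝ) (hp : p ∈ latG a b)
    (h1 : (r - s) / 2 < p.1) (h2 : p.1 < 1) (h3 : 0 < p.2) (h4 : p.2 < (r + s) / 2 + 1) :
    False := by
  obtain ⟨i, j, rfl⟩ := hp
  simp only at h1 h2 h3 h4
  have htr : (t : ℝ) = 2 * k + r := by exact_mod_cast ht
  have hr : (0 : ℝ) ≤ r := by exact_mod_cast hr0
  obtain ⟨i', hi'⟩ : ∃ i' : ℤ, i' = i + j * (k + r) := ⟨_, rfl⟩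
  obtain ⟨j', hj'⟩ : ∃ j' : ℤ, j' = -j := ⟨_, rfl⟩
  have hi'' : (i' : ℝ) = i + j * (k + r) := by rw [hi']; push_cast; ring
  have hj'' : (j' : ℝ) = -j := by rw [hj']; push_cast; ring
  have e1 : (i : ℝ) + j * a = i' + j' * ((r - s) / 2) := by rw [hi'', hj'', ha, htr]; ring
  have e2 : (i : ℝ) + j * b = i' + j' * ((r + s) / 2) := by rw [hi'', hj'', hb, htr]; ring
  rw [e1] at h1 h2
  rw [e2] at h3 h4
  rcases le_or_gt i' 0 with hi | hi <;> rcases le_or_gt j' 0 with hj | hj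
  · have hi : (i' : ℝ) ≤ 0 := by exact_mod_cast hi
    have hj : (j' : ℝ) ≤ 0 := by exact_mod_cast hj
    nlinarith
  · have hi : (i' : ℝ) ≤ 0 := by exact_mod_cast hi
    have hj : (1 : ℝ) ≤ j' := by exact_mod_cast hj
    nlinarith
  · have hi : (1 : ℝ) ≤ i' := by exact_mod_cast hi
    have hj : (j' : ℝ) ≤ 0 := by exact_mod_cast hj
    nlinarith
  · have hi : (1 : ℝ) ≤ i' := by exact_mod_cast hi
    have hj : (1 : ℝ) ≤ j' := by exact_mod_cast hj
    nlinarith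

/-- The dispersion of the lattice associated to the quadratic ring ℤ[Δ] of
discriminant D = t² − 4m equals (√D/2 + 1)² − r/4, with r = 0 for even D and
r = 1 for odd D. -/
theorem stmt4 (t m : ℤ) (Δ Δb : ℝ)
    (hD : 0 < t ^ 2 - 4 * m) (hsq : ¬∃ k : ℤ, k ^ 2 = t ^ 2 - 4 * m)
    (hΔ : Δ = ((t : ℝ) + Real.sqrt ((t : ℝ) ^ 2 - 4 * (m : ℝ))) / 2)
    (hΔb : Δb = ((t : ℝ) - Real.sqrt ((t : ℝ) ^ 2 - 4 * (m : ℝ))) / 2) :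
    disp (latticeGen (1, 1) (Δ, Δb)) =
      ENNReal.ofReal ((Real.sqrt ((t : ℝ) ^ 2 - 4 * (m : ℝ)) / 2 + 1) ^ 2 -
        (if (2 : ℤ) ∣ (t ^ 2 - 4 * m) then (0 : ℝ) else 1) / 4) := by
  set s := Real.sqrt ((t : ℝ) ^ 2 - 4 * (m : ℝ)) with hsdef
  have hDr : (0 : ℝ) < (t : ℝ) ^ 2 - 4 * m := by exact_mod_cast hD
  have hs0 : 0 < s := Real.sqrt_pos.2 hDr
  have hs : s ^ 2 = (t : ℝ) ^ 2 - 4 * m := Real.sq_sqrt hDr.le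
  apply le_antisymm
  · apply sSup_le
    rintro _ ⟨x₁, x₂, y₁, y₂, ⟨hx, hy, hemp⟩, rfl⟩
    apply ENNReal.ofReal_le_ofReal
    exact upper_s4 t m Δ Δb s hD hsq hs0 hs hΔ hΔb x₁ x₂ y₁ y₂ hx
      (fun p hp h1 h2 h3 h4 => hemp p ((mem_latticeGen_iff _ _ _).2 hp) ⟨⟨h1, h2⟩, ⟨h3, h4⟩⟩) hy
  · apply le_sSup
    obtain ⟨k, r, hr0, ht, hrs, hrr⟩ : ∃ k r : ℤ, 0 ≤ r ∧ t = 2 * k + r ∧ (r : ℝ) < s ∧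
        (if (2 : ℤ) ∣ (t ^ 2 - 4 * m) then (0 : ℝ) else 1) = (r : ℝ) ^ 2 := by
      rcases Int.even_or_odd' t with ⟨k, hk | hk⟩
      · refine ⟨k, 0, le_rfl, by omega, by simpa using hs0, ?_⟩
        rw [if_pos ⟨2 * k ^ 2 - 2 * m, by rw [hk]; ring⟩]
        simp
      · refine ⟨k, 1, by norm_num, by omega, ?_, ?_⟩
        · have h1 : t ^ 2 - 4 * m ≠ 1 := fun h => hsq ⟨1, by rw [h]; norm_num⟩
          have h2 : 2 ≤ t ^ 2 - 4 * m := by omega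
          have h3 : (2 : ℝ) ≤ (t : ℝ) ^ 2 - 4 * m := by exact_mod_cast h2
          push_cast
          nlinarith
        · rw [if_neg]
          · simp
          · rintro ⟨c, hc⟩
            have : t ^ 2 - 4 * m = 2 * (2 * k ^ 2 + 2 * k - 2 * m) + 1 := by rw [hk]; ring
            omega
    have hr : (0 : ℝ) ≤ r := by exact_mod_cast hr0
    refine ⟨(r - s) / 2, 1, 0, (r + s) / 2 + 1, ⟨by linarith, by linarith, ?_⟩, ?_⟩
    · rintro p hp ⟨⟨h1, h2⟩, ⟨h3, h4⟩⟩
      exact lower t m Δ Δb s k r hr0 hrs ht hΔ hΔb p ((mem_latticeGen_iff _ _ _).1 hp) h1 h2 h3 h4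
    · rw [hrr]
      congr 1
      ring
end

section
/- In the two-sided continued fraction setting for irrational Δ > 1 and Δ̃ ∈ (−1, 0), with Λ the lattice generated by (1, 1) and (−Δ, −Δ̃): fix i ∈ ℤ with aᵢ ≥ 2, let r ∈ {0, 1} with r ≡ aᵢ (mod 2), and set L(x) = x/4 + 1 + 1/x − r/(4x) for x > 0. Then L(aᵢ) < max{(1 − j + Δᵢ)(1 + j − Δ̃ᵢ)/(Δᵢ − Δ̃ᵢ) : j ∈ ℤ, 0 ≤ j < aᵢ} < L(aᵢ + 2) < L(aᵢ) + 1/2. Consequently disp(Λ) > L(aᵢ)·det(Λ). -/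
/-- There is an empty box of normalized area `c`. -/
def hasBox (D T c : ℝ) : Prop :=
  ∃ x₁ x₂ y₁ y₂ : ℝ, isEmptyBox (latticeGen (1, 1) (-D, -T)) x₁ x₂ y₁ y₂ ∧
    (x₂ - x₁) * (y₂ - y₁) = c * (D - T)

theorem mem_lat (D T x y : ℝ) : (x, y) ∈ latticeGen (1, 1) (-D, -T) ↔
    ∃ m n : ℤ, x = m - n * D ∧ y = m - n * T := by
  simp only [latticeGen, Set.mem_ofPred_eq, Prod.smul_mk, Prod.mk_add_mk, Prod.mk.injEq, smul_eq_mul]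
  constructor
  · rintro ⟨m, n, h1, h2⟩
    exact ⟨m, n, by rw [h1]; ring, by rw [h2]; ring⟩
  · rintro ⟨m, n, h1, h2⟩
    exact ⟨m, n, by rw [h1]; ring, by rw [h2]; ring⟩

theorem hasBox_step (D T D' T' c : ℝ) (n : ℤ) (h1 : n < D) (h2 : T < n)
    (hD : D' = 1 / (D - n)) (hT : T' = -1 / (n - T)) : hasBox D T c ↔ hasBox D' T' c := by
  have p1 : 0 < D - n := by linarith
  have p2 : 0 < n - T := by linarith
  have q1 : 0 < D' := by rw [hD]; positivity
  have q2 : T' < 0 := by rw [hT]; exact div_neg_of_neg_of_pos (by norm_num) p2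
  have e1 : D' * (D - n) = 1 := by rw [hD]; field_simp
  have e2 : T' * (T - n) = 1 := by rw [hT]; field_simp; ring
  have e3 : D' - T' = (D - T) * (D' * (-T')) := by
    linear_combination (T') * e1 - D' * e2
  have e4 : D - T = (D' - T') * ((D - n) * (n - T)) := by
    linear_combination (-(n - T)) * e1 + (-(D - n)) * e2
  constructor
  · rintro ⟨x₁, x₂, y₁, y₂, ⟨hx, hy, he⟩, hA⟩
    refine ⟨D' * x₁, D' * x₂, T' * y₂, T' * y₁, ⟨by nlinarith, by nlinarith, ?_⟩, ?_⟩
    · rintro ⟨x, y⟩ hp ⟨⟨hx1, hx2⟩, ⟨hy1, hy2⟩⟩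
      rw [mem_lat] at hp
      obtain ⟨m, k, hx', hy'⟩ := hp
      simp only at hx1 hx2 hy1 hy2
      have ex : x = D' * (x * (D - n)) := by linear_combination -x * e1
      have ey : y = T' * (y * (T - n)) := by linear_combination -y * e2
      refine he (x * (D - n), y * (T - n)) ?_ ⟨⟨?_, ?_⟩, ⟨?_, ?_⟩⟩
      · rw [mem_lat]
        refine ⟨-(m * n + k), -m, ?_, ?_⟩
        · push_cast; rw [hx']; linear_combination -k * e1
        · push_cast; rw [hy']; linear_combination -k * e2
      · rw [ex] at hx1; exact lt_of_mul_lt_mul_left hx1 q1.le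
      · rw [ex] at hx2; exact lt_of_mul_lt_mul_left hx2 q1.le
      · rw [ey] at hy2; exact (mul_lt_mul_left_of_neg q2).1 hy2
      · rw [ey] at hy1; exact (mul_lt_mul_left_of_neg q2).1 hy1
    · rw [e3]; linear_combination (D' * (-T')) * hA
  · rintro ⟨x₁, x₂, y₁, y₂, ⟨hx, hy, he⟩, hA⟩
    refine ⟨(D - n) * x₁, (D - n) * x₂, (T - n) * y₂, (T - n) * y₁,
      ⟨by nlinarith, by nlinarith, ?_⟩, ?_⟩
    · rintro ⟨x, y⟩ hp ⟨⟨hx1, hx2⟩, ⟨hy1, hy2⟩⟩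
      rw [mem_lat] at hp
      obtain ⟨m, k, hx', hy'⟩ := hp
      simp only at hx1 hx2 hy1 hy2
      have p3 : T - n < 0 := by linarith
      have ex : x = (D - n) * (x * D') := by linear_combination -x * e1
      have ey : y = (T - n) * (y * T') := by linear_combination -y * e2
      refine he (x * D', y * T') ?_ ⟨⟨?_, ?_⟩, ⟨?_, ?_⟩⟩
      · rw [mem_lat]
        refine ⟨-k, -m + k * n, ?_, ?_⟩
        · push_cast; rw [hx']; linear_combination -k * e1
        · push_cast; rw [hy']; linear_combination -k * e2
      · rw [ex] at hx1; exact lt_of_mul_lt_mul_left hx1 p1.le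
      · rw [ex] at hx2; exact lt_of_mul_lt_mul_left hx2 p1.le
      · rw [ey] at hy2; exact (mul_lt_mul_left_of_neg p3).1 hy2
      · rw [ey] at hy1; exact (mul_lt_mul_left_of_neg p3).1 hy1
    · rw [e4]; linear_combination ((D - n) * (n - T)) * hA

theorem hasBox_level (D T : ℝ) (hD : 1 < D) (hT : T < 0) (j : ℤ) (hj0 : 0 ≤ j) (hj : j < D) :
    hasBox D T ((1 - (j : ℝ) + D) * (1 + (j : ℝ) - T) / (D - T)) := by
  have hj0' : (0 : ℝ) ≤ j := by exact_mod_cast hj0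
  have hs : 0 < D - T := by linarith
  refine ⟨j - D, 1, 0, 1 + j - T, ⟨by linarith, by linarith, ?_⟩, ?_⟩
  · rintro ⟨x, y⟩ hp ⟨⟨hx1, hx2⟩, ⟨hy1, hy2⟩⟩
    rw [mem_lat] at hp
    obtain ⟨m, n, hx', hy'⟩ := hp
    simp only at hx1 hx2 hy1 hy2
    rw [hx'] at hx1 hx2
    rw [hy'] at hy1 hy2
    rcases lt_trichotomy n 0 with h | h | h
    · have h' : (n : ℝ) ≤ -1 := by exact_mod_cast (by omega : n ≤ -1)
      nlinarith
    · subst h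
      simp only [Int.cast_zero, zero_mul, sub_zero] at *
      have a1 : 0 < m := by exact_mod_cast hy1
      have a2 : m < 1 := by exact_mod_cast hx2
      omega
    · rcases (by omega : n = 1 ∨ 2 ≤ n) with h | h
      · subst h
        have a1 : j < m := by
          have : (j : ℝ) < m := by push_cast at hx1; linarith
          exact_mod_cast this
        have a2 : m < 1 + j := by
          have : (m : ℝ) < 1 + j := by push_cast at hy2; linarith
          exact_mod_cast this
        omega
      · have h' : (2 : ℝ) ≤ n := by exact_mod_cast h
        nlinarith
  · field_simp; ring

theorem lower_bd (x t : ℝ) (a : ℤ) (hx : 0 < x) (ht : 0 < t)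
    (hai : 2 ≤ a) (r : ℤ) (hr : r = 0 ∨ r = 1) (hrmod : r % 2 = a % 2) :
    ∃ j : ℤ, 0 ≤ j ∧ j < a ∧
      (a : ℝ) / 4 + 1 + 1 / (a : ℝ) - (r : ℝ) / (4 * (a : ℝ)) <
        (1 - (j : ℝ) + (a + x)) * (1 + (j : ℝ) + t) / (a + x + t) := by
  have ha2 : (2 : ℝ) ≤ a := by exact_mod_cast hai
  have ha0 : (0 : ℝ) < a := by linarith
  refine ⟨a / 2, by omega, by omega, ?_⟩
  rcases hr with rfl | rfl
  · obtain ⟨k, hk⟩ : ∃ k, a = 2 * k := ⟨a / 2, by omega⟩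
    have hk2 : a / 2 = k := by omega
    have hk' : (k : ℝ) = a / 2 := by rw [hk]; push_cast; ring
    rw [hk2, hk', lt_div_iff₀ (by positivity)]
    have : (a : ℝ) / 4 + 1 + 1 / (a : ℝ) - ((0 : ℤ) : ℝ) / (4 * (a : ℝ)) = (a + 2) ^ 2 / (4 * a) := by
      push_cast; field_simp; ring
    rw [this, div_mul_eq_mul_div, div_lt_iff₀ (by positivity)]
    have u1 : 0 ≤ ((a : ℝ) + 2) * (x + t) * (a - 2) :=
      mul_nonneg (by positivity) (by linarith)
    have u2 : 0 < a * x * t := by positivity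
    nlinarith
  · obtain ⟨k, hk⟩ : ∃ k, a = 2 * k + 1 := ⟨a / 2, by omega⟩
    have hk2 : a / 2 = k := by omega
    have hk' : (k : ℝ) = (a - 1) / 2 := by rw [hk]; push_cast; ring
    have ha3 : (3 : ℝ) ≤ a := by exact_mod_cast (by omega : 3 ≤ a)
    rw [hk2, hk', lt_div_iff₀ (by positivity)]
    have : (a : ℝ) / 4 + 1 + 1 / (a : ℝ) - ((1 : ℤ) : ℝ) / (4 * (a : ℝ)) =
        (a + 1) * (a + 3) / (4 * a) := by
      push_cast; field_simp; ring
    rw [this, div_mul_eq_mul_div, div_lt_iff₀ (by positivity)]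
    have u1 : 0 ≤ ((a : ℝ) + 1) * x * (a - 3) :=
      mul_nonneg (by positivity) (by linarith)
    have u3 : 0 ≤ ((a : ℝ) + 3) * t * (a - 1) :=
      mul_nonneg (by positivity) (by linarith)
    have u2 : 0 < a * x * t := by positivity
    nlinarith

theorem upper_bd (x t : ℝ) (a : ℤ) (hx : 0 < x) (ht : 0 < t) (hx1 : x < 1) (ht1 : t < 1)
    (hai : 2 ≤ a) (r : ℤ) (hr : r = 0 ∨ r = 1) (hrmod : r % 2 = a % 2)
    (j : ℤ) (hj0 : 0 ≤ j) (hja : j < a) :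
    (1 - (j : ℝ) + (a + x)) * (1 + (j : ℝ) + t) / (a + x + t) <
      ((a : ℝ) + 2) / 4 + 1 + 1 / ((a : ℝ) + 2) - (r : ℝ) / (4 * ((a : ℝ) + 2)) := by
  have ha2 : (2 : ℝ) ≤ a := by exact_mod_cast hai
  have hj0' : (0 : ℝ) ≤ j := by exact_mod_cast hj0
  have hja' : (j : ℝ) + 1 ≤ a := by exact_mod_cast hja
  have key : (r : ℝ) ≤ (a - 2 * j) ^ 2 := by
    rcases hr with rfl | rfl
    · push_cast; positivity
    · have : (1 : ℤ) ≤ (a - 2 * j) ^ 2 := by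
        have : a - 2 * j ≠ 0 := by omega
        have := sq_pos_of_ne_zero this
        omega
      exact_mod_cast this
  have hr1 : (r : ℝ) ≤ 1 := by rcases hr with rfl | rfl <;> norm_num
  have eL : ((a : ℝ) + 2) / 4 + 1 + 1 / ((a : ℝ) + 2) - (r : ℝ) / (4 * ((a : ℝ) + 2)) =
      ((a + 4) ^ 2 - r) / (4 * (a + 2)) := by field_simp; ring
  rw [eL, div_lt_div_iff₀ (by positivity) (by positivity)]
  have hs : 0 < a + x + t := by positivity
  rcases (by omega : j = 0 ∨ 1 ≤ j) with h | h
  · subst h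
    push_cast
    have f2 : (1 - 0 + (a + x)) * (1 + 0 + t) < 2 * (a + x + t) := by nlinarith
    have f3 : 8 * ((a : ℝ) + 2) ≤ (a + 4) ^ 2 - r := by nlinarith
    nlinarith
  · have h' : (1 : ℝ) ≤ j := by exact_mod_cast h
    have s1 : (1 - (j : ℝ) + (a + x)) * (a + 1 + t) ≤ (2 - (j : ℝ) + a) * (a + x + t) := by
      nlinarith [mul_nonneg (sub_nonneg.2 hx1.le) (by linarith : (0 : ℝ) ≤ t + j - 1)]
    have s2 : (1 + (j : ℝ) + t) * (a + 2) < (2 + (j : ℝ)) * (a + 1 + t) := by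
      nlinarith [mul_pos (sub_pos.2 ht1) (by linarith : (0 : ℝ) < a - j)]
    have s3 : 4 * ((2 - (j : ℝ) + a) * (2 + j)) ≤ (a + 4) ^ 2 - r := by nlinarith
    have s4 : 0 < a + 1 + t := by positivity
    have s5 : 0 < 1 - (j : ℝ) + (a + x) := by linarith
    have s6 : (1 - (j : ℝ) + (a + x)) * ((1 + (j : ℝ) + t) * (a + 2)) <
      (1 - (j : ℝ) + (a + x)) * ((2 + (j : ℝ)) * (a + 1 + t)) := mul_lt_mul_of_pos_left s2 s5
    have s7 := mul_le_mul_of_nonneg_right s1 (by linarith : 0 ≤ 2 + (j : ℝ))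
    have s8 := mul_le_mul_of_nonneg_right s3 hs.le
    nlinarith

/-- Bounds on the normalized areas of the maximal empty boxes at level i in terms
of the continued fraction coefficient aᵢ: with L(x) = x/4 + 1 + 1/x − r/(4x),
L(aᵢ) < max over 0 ≤ j < aᵢ of (1−j+Δᵢ)(1+j−Δ̃ᵢ)/(Δᵢ−Δ̃ᵢ) < L(aᵢ+2) < L(aᵢ) + 1/2,
and consequently disp(Λ) > L(aᵢ)·det(Λ). -/
theorem stmt5
    (Δ Δt : ℝ) (hΔirr : Irrational Δ) (hΔtirr : Irrational Δt)
    (hΔ1 : 1 < Δ) (hΔtmem : Δt ∈ Set.Ioo (-1 : ℝ) 0)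
    (a : ℤ → ℤ) (Δs Δts : ℤ → ℝ)
    (h0 : Δs 0 = Δ) (h0t : Δts 0 = Δt)
    (hpos : ∀ i : ℤ, 0 ≤ i → a i = ⌊Δs i⌋ ∧ Δs (i + 1) = 1 / (Δs i - a i) ∧
      Δts (i + 1) = -1 / (a i - Δts i))
    (hneg : ∀ i : ℤ, i ≤ 0 → a (i - 1) = ⌊-1 / Δts i⌋ ∧
      Δts (i - 1) = a (i - 1) + 1 / Δts i ∧ Δs (i - 1) = a (i - 1) + 1 / Δs i)
    (i : ℤ) (hai : 2 ≤ a i) (r : ℤ) (hr : r = 0 ∨ r = 1) (hrmod : r % 2 = a i % 2) :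
    (∃ j : ℤ, 0 ≤ j ∧ j < a i ∧
      (a i : ℝ) / 4 + 1 + 1 / (a i : ℝ) - (r : ℝ) / (4 * (a i : ℝ)) <
        (1 - (j : ℝ) + Δs i) * (1 + (j : ℝ) - Δts i) / (Δs i - Δts i)) ∧
    (∀ j : ℤ, 0 ≤ j → j < a i →
      (1 - (j : ℝ) + Δs i) * (1 + (j : ℝ) - Δts i) / (Δs i - Δts i) <
        ((a i : ℝ) + 2) / 4 + 1 + 1 / ((a i : ℝ) + 2) - (r : ℝ) / (4 * ((a i : ℝ) + 2))) ∧
    ((a i : ℝ) + 2) / 4 + 1 + 1 / ((a i : ℝ) + 2) - (r : ℝ) / (4 * ((a i : ℝ) + 2)) <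
      ((a i : ℝ) / 4 + 1 + 1 / (a i : ℝ) - (r : ℝ) / (4 * (a i : ℝ))) + 1 / 2 ∧
    ENNReal.ofReal (((a i : ℝ) / 4 + 1 + 1 / (a i : ℝ) - (r : ℝ) / (4 * (a i : ℝ))) * (Δ - Δt)) <
      disp (latticeGen (1, 1) (-Δ, -Δt)) := by

  have invp : ∀ n : ℕ, Irrational (Δs n) ∧ 1 < Δs n ∧ -1 < Δts n ∧ Δts n < 0 := by
    intro n
    induction n with
    | zero =>
      simp only [Nat.cast_zero, h0, h0t]
      exact ⟨hΔirr, hΔ1, hΔtmem.1, hΔtmem.2⟩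
    | succ n ih =>
      obtain ⟨i1, i2, i3, i4⟩ := ih
      obtain ⟨g1, g2, g3⟩ := hpos n (by positivity)
      have b1 : (a n : ℝ) < Δs n :=
        lt_of_le_of_ne (by rw [g1]; exact Int.floor_le _) (fun h => i1.ne_int (a n) h.symm)
      have b2 : Δs n < a n + 1 := by rw [g1]; exact Int.lt_floor_add_one _
      have b3 : (1 : ℝ) ≤ a n := by
        have : 1 ≤ a n := by rw [g1]; exact Int.le_floor.2 (by push_cast; exact i2.le)
        exact_mod_cast this
      push_cast
      rw [g2, g3]
      refine ⟨?_, ?_, ?_, ?_⟩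
      · rw [one_div]; exact (i1.sub_intCast _).inv
      · rw [lt_div_iff₀ (by linarith)]; linarith
      · rw [lt_div_iff₀ (by linarith)]; linarith
      · exact div_neg_of_neg_of_pos (by norm_num) (by linarith)
  have invn : ∀ n : ℕ, Irrational (Δts (-n)) ∧ 1 < Δs (-n) ∧ -1 < Δts (-n) ∧ Δts (-n) < 0 := by
    intro n
    induction n with
    | zero =>
      simp only [Nat.cast_zero, neg_zero, h0, h0t]
      exact ⟨hΔtirr, hΔ1, hΔtmem.1, hΔtmem.2⟩
    | succ n ih =>
      obtain ⟨i1, i2, i3, i4⟩ := ih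
      obtain ⟨g1, g2, g3⟩ := hneg (-n) (by omega)
      have e : (-((n + 1 : ℕ) : ℤ)) = -n - 1 := by push_cast; ring
      rw [e]
      set b := a (-n - 1) with hb
      have irr : Irrational (-1 / Δts (-n)) := by
        rw [neg_div, one_div]; exact i1.inv.neg
      have b1 : (b : ℝ) < -1 / Δts (-n) :=
        lt_of_le_of_ne (by rw [g1]; exact Int.floor_le _) (fun h => irr.ne_int b h.symm)
      have b2 : -1 / Δts (-n) < b + 1 := by rw [g1]; exact Int.lt_floor_add_one _
      have b0 : 1 < -1 / Δts (-n) := by rw [lt_div_iff_of_neg i4]; linarith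
      have b3 : (1 : ℝ) ≤ b := by
        have : 1 ≤ b := by rw [g1]; exact Int.le_floor.2 (by push_cast; exact b0.le)
        exact_mod_cast this
      have b4 : 0 < 1 / Δs (-n) := by positivity
      rw [neg_div] at b1 b2
      rw [g2, g3]
      refine ⟨?_, by linarith, by linarith, by linarith⟩
      rw [one_div]; exact i1.inv.intCast_add _
  have inv : ∀ i : ℤ, ((a i : ℝ) < Δs i ∧ Δs i < a i + 1 ∧ 1 ≤ (a i : ℝ) ∧ -1 < Δts i ∧ Δts i < 0) ∧
      Δs (i + 1) = 1 / (Δs i - a i) ∧ Δts (i + 1) = -1 / (a i - Δts i) := by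
    intro i
    rcases le_or_gt 0 i with hi | hi
    · obtain ⟨n, rfl⟩ := Int.eq_ofNat_of_zero_le hi
      obtain ⟨i1, i2, i3, i4⟩ := invp n
      obtain ⟨g1, g2, g3⟩ := hpos n (by positivity)
      refine ⟨⟨?_, ?_, ?_, i3, i4⟩, g2, g3⟩
      · exact lt_of_le_of_ne (by rw [g1]; exact Int.floor_le _) (fun h => i1.ne_int (a n) h.symm)
      · rw [g1]; exact Int.lt_floor_add_one _
      · have : 1 ≤ a n := by rw [g1]; exact Int.le_floor.2 (by push_cast; exact i2.le)
        exact_mod_cast this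
    · obtain ⟨n, hn⟩ := Int.eq_ofNat_of_zero_le (by omega : 0 ≤ -(i + 1))
      obtain rfl : i = -n - 1 := by omega
      obtain ⟨i1, i2, i3, i4⟩ := invn n
      obtain ⟨_, _, k3, k4⟩ := invn (n + 1)
      have e : (-((n + 1 : ℕ) : ℤ)) = -n - 1 := by push_cast; ring
      rw [e] at k3 k4
      obtain ⟨g1, g2, g3⟩ := hneg (-n) (by omega)
      rw [sub_add_cancel]
      have b0 : 1 < -1 / Δts (-n) := by rw [lt_div_iff_of_neg i4]; linarith
      have b4 : 0 < 1 / Δs (-n) := by positivity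
      have b5 : 1 / Δs (-n) < 1 := by rw [div_lt_one (by linarith)]; exact i2
      refine ⟨⟨?_, ?_, ?_, k3, k4⟩, ?_, ?_⟩
      · rw [g3]; linarith
      · rw [g3]; linarith
      · have : 1 ≤ a (-n - 1) := by rw [g1]; exact Int.le_floor.2 (by push_cast; exact b0.le)
        exact_mod_cast this
      · rw [g3]; simp
      · rw [g2]; simp [neg_div]
  have stepB : ∀ (i : ℤ) (c : ℝ), hasBox (Δs i) (Δts i) c ↔ hasBox (Δs (i + 1)) (Δts (i + 1)) c := by
    intro i c
    obtain ⟨⟨i1, i2, i3, i4, i5⟩, g2, g3⟩ := inv i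
    exact hasBox_step _ _ _ _ c (a i) i1 (by linarith) g2 g3
  have allB : ∀ (i : ℤ) (c : ℝ), hasBox (Δs i) (Δts i) c ↔ hasBox Δ Δt c := by
    intro i c
    induction i using Int.induction_on with
    | zero => rw [h0, h0t]
    | succ n ih => rw [← stepB]; exact ih
    | pred n ih => rw [stepB, sub_add_cancel]; exact ih
  obtain ⟨⟨i1, i2, i3, i4, i5⟩, -, -⟩ := inv i
  have ha2 : (2 : ℝ) ≤ a i := by exact_mod_cast hai
  have hr1 : (r : ℝ) ≤ 1 := by rcases hr with rfl | rfl <;> norm_num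
  have hlow := lower_bd (Δs i - a i) (-Δts i) (a i) (by linarith) (by linarith) hai r hr hrmod
  have hup := upper_bd (Δs i - a i) (-Δts i) (a i) (by linarith) (by linarith) (by linarith)
    (by linarith) hai r hr hrmod
  simp only [add_sub_cancel, ← sub_eq_add_neg] at hlow hup
  refine ⟨hlow, hup, ?_, ?_⟩
  · have e1 : (r : ℝ) / (4 * (a i : ℝ)) = (r / 4) * (1 / a i) := by field_simp
    have e2 : (r : ℝ) / (4 * ((a i : ℝ) + 2)) = (r / 4) * (1 / (a i + 2)) := by field_simp
    have e3 : 1 / ((a i : ℝ) + 2) < 1 / a i := one_div_lt_one_div_of_lt (by linarith) (by linarith)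
    rw [e1, e2]
    nlinarith
  · obtain ⟨j, hj0, hj, hlt⟩ := hlow
    have hj' : (j : ℝ) < a i := by exact_mod_cast hj
    have hB := (allB i _).1 (hasBox_level (Δs i) (Δts i) (by linarith) i5 j hj0 (by linarith))
    obtain ⟨x₁, x₂, y₁, y₂, hE, hA⟩ := hB
    have hd : 0 < Δ - Δt := by have := hΔtmem.2; linarith
    refine lt_of_lt_of_le ?_ (le_sSup ⟨x₁, x₂, y₁, y₂, hE, rfl⟩)
    rw [ENNReal.ofReal_lt_ofReal_iff (mul_pos (sub_pos.2 hE.1) (sub_pos.2 hE.2.1)), hA]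
    exact mul_lt_mul_of_pos_right hlt hd
end

section
/- In the two-sided continued fraction setting for irrational Δ > 1 and Δ̃ ∈ (−1, 0), with Λ the lattice generated by (1, 1) and (−Δ, −Δ̃): disp(Λ) < ∞ if and only if the sequence (aᵢ)ᵢ∈ℤ is bounded. -/
/-- solve a two-sided first order recursion -/
lemma exists_rec (c : ℤ → ℝ) (hc : ∀ i, c i ≠ 0) :
    ∃ S : ℤ → ℝ, S 0 = 1 ∧ ∀ i, S (i + 1) * c (i + 1) = - S i := by
  let f : ℕ → ℝ := fun n => ∏ j ∈ Finset.range n, (-(c ((j : ℤ) + 1))⁻¹)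
  let g : ℕ → ℝ := fun n => ∏ j ∈ Finset.range n, (-(c (-(j : ℤ))))
  refine ⟨fun i => if 0 ≤ i then f i.toNat else g (-i).toNat, by simp [f], ?_⟩
  intro i
  by_cases hi : 0 ≤ i
  · lift i to ℕ using hi
    have h1 : (0 : ℤ) ≤ (i : ℤ) + 1 := by positivity
    have h2 : ((i : ℤ) + 1).toNat = i + 1 := by omega
    simp only [h1, if_true, h2, Int.toNat_natCast, Nat.cast_nonneg]
    simp only [f, Finset.prod_range_succ]
    have := hc ((i : ℤ) + 1)
    field_simp
  · obtain ⟨n, rfl⟩ : ∃ n : ℕ, i = -((n : ℤ) + 1) := ⟨(-i - 1).toNat, by omega⟩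
    have h3 : (-(-((n : ℤ) + 1))).toNat = n + 1 := by omega
    have h4 : -((n : ℤ) + 1) + 1 = -(n : ℤ) := by ring
    have h5 : (if 0 ≤ -(n : ℤ) then f (-(n : ℤ)).toNat else g (-(-(n : ℤ))).toNat) = g n := by
      by_cases hn : n = 0
      · subst hn; simp [f, g]
      · rw [if_neg (by omega)]; simp
    simp only [hi, if_false, h3, h4]
    rw [h5]
    simp only [g, Finset.prod_range_succ]
    ring

/-- scaled lattice -/
def ScLat (s t d e : ℝ) : Set (ℝ × ℝ) := {p | ∃ m n : ℤ, p = (s * (m - n * d), t * (m - n * e))}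

lemma Lat_step (s t s' t' d e d' e' : ℝ) (a : ℤ) (hd' : d' ≠ 0) (he' : e' ≠ 0)
    (hd : d = a + 1 / d') (he : e = a + 1 / e') (hs : s' * d' = -s) (ht : t' * e' = -t) :
    ScLat s' t' d' e' = ScLat s t d e := by
  have hs' : s = -(s' * d') := by linarith
  have ht' : t = -(t' * e') := by linarith
  subst hs' ht' hd he
  ext p
  constructor
  · rintro ⟨m, n, rfl⟩
    refine ⟨m * a + n, m, ?_⟩
    ext <;> push_cast <;> field_simp <;> ring
  · rintro ⟨m, n, rfl⟩
    refine ⟨n, m - n * a, ?_⟩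
    ext <;> push_cast <;> field_simp <;> ring

lemma det_step (s t s' t' d e d' e' : ℝ) (a : ℤ) (hd' : d' ≠ 0) (he' : e' ≠ 0)
    (hd : d = a + 1 / d') (he : e = a + 1 / e') (hs : s' * d' = -s) (ht : t' * e' = -t) :
    |s' * t' * (d' - e')| = |s * t * (d - e)| := by
  have hs' : s = -(s' * d') := by linarith
  have ht' : t = -(t' * e') := by linarith
  subst hs' ht' hd he
  rw [← abs_neg]
  congr 1
  field_simp
  ring

/-- a big empty box -/
lemma big_box (s t d e : ℝ) (hs : s ≠ 0) (ht : t ≠ 0) (hde : e < d) :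
    ENNReal.ofReal (|s * t * (d - e)| * (d - e) / 4) ≤ disp (ScLat s t d e) := by
  have hD : 0 < d - e := by linarith
  apply le_sSup
  -- a coordinate interval between `s * x` and `s * y`
  have key : ∀ m n : ℤ, ∀ x y : ℝ, x = m - n * d → y = m - n * e →
      -((d - e) / 2) < x → x < 0 → 0 < y → y < (d - e) / 2 → False := by
    intro m n x y hx hy h1 h2 h3 h4
    have e1 : y - x = n * (d - e) := by rw [hx, hy]; ring
    have l1 : (0 : ℝ) < n * (d - e) := by linarith
    have l2 : (n : ℝ) * (d - e) < 1 * (d - e) := by linarith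
    have l3 : (n : ℝ) < 1 := lt_of_mul_lt_mul_right l2 hD.le
    have l4 : (0 : ℝ) < n := by
      by_contra h
      push Not at h
      nlinarith
    have l5 : n < 1 := by exact_mod_cast l3
    have l6 : 0 < n := by exact_mod_cast l4
    omega
  have habs : |s * t * (d - e)| = |s| * |t| * (d - e) := by
    rw [abs_mul, abs_mul, abs_of_pos hD]
  rw [habs]
  rcases lt_or_gt_of_ne hs with hs | hs <;> rcases lt_or_gt_of_ne ht with ht | ht
  · refine ⟨0, s * (-((d - e) / 2)), t * ((d - e) / 2), 0, ⟨by nlinarith, by nlinarith, ?_⟩, ?_⟩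
    · rintro _ ⟨m, n, rfl⟩ ⟨⟨h1, h2⟩, h3, h4⟩
      simp only at h1 h2 h3 h4
      refine key m n _ _ rfl rfl ?_ ?_ ?_ ?_ <;> by_contra hh <;> push Not at hh <;> nlinarith
    · rw [abs_of_neg hs, abs_of_neg ht]; congr 1; ring
  · refine ⟨0, s * (-((d - e) / 2)), 0, t * ((d - e) / 2), ⟨by nlinarith, by nlinarith, ?_⟩, ?_⟩
    · rintro _ ⟨m, n, rfl⟩ ⟨⟨h1, h2⟩, h3, h4⟩
      simp only at h1 h2 h3 h4
      refine key m n _ _ rfl rfl ?_ ?_ ?_ ?_ <;> by_contra hh <;> push Not at hh <;> nlinarith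
    · rw [abs_of_neg hs, abs_of_pos ht]; congr 1; ring
  · refine ⟨s * (-((d - e) / 2)), 0, t * ((d - e) / 2), 0, ⟨by nlinarith, by nlinarith, ?_⟩, ?_⟩
    · rintro _ ⟨m, n, rfl⟩ ⟨⟨h1, h2⟩, h3, h4⟩
      simp only at h1 h2 h3 h4
      refine key m n _ _ rfl rfl ?_ ?_ ?_ ?_ <;> by_contra hh <;> push Not at hh <;> nlinarith
    · rw [abs_of_pos hs, abs_of_neg ht]; congr 1; ring
  · refine ⟨s * (-((d - e) / 2)), 0, 0, t * ((d - e) / 2), ⟨by nlinarith, by nlinarith, ?_⟩, ?_⟩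
    · rintro _ ⟨m, n, rfl⟩ ⟨⟨h1, h2⟩, h3, h4⟩
      simp only at h1 h2 h3 h4
      refine key m n _ _ rfl rfl ?_ ?_ ?_ ?_ <;> by_contra hh <;> push Not at hh <;> nlinarith
    · rw [abs_of_pos hs, abs_of_pos ht]; congr 1; ring

/-- an empty box is thin in one direction -/
lemma thin_box (s t d e : ℝ) (hs : s ≠ 0) (ht : t ≠ 0) (hd : 1 < d) (he0 : e < 0) (he1 : -1 < e)
    (x₁ x₂ y₁ y₂ : ℝ) (h : isEmptyBox (ScLat s t d e) x₁ x₂ y₁ y₂) :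
    x₂ - x₁ ≤ |s| * (1 + d) ∨ y₂ - y₁ ≤ |t| * 2 := by
  by_contra hcon
  push Not at hcon
  obtain ⟨hX, hY⟩ := hcon
  obtain ⟨-, -, h⟩ := h
  have hD : d - e ≠ 0 := by linarith
  set cx := (x₁ + x₂) / 2 / s with hcx
  set cy := (y₁ + y₂) / 2 / t with hcy
  have ecx : s * cx = (x₁ + x₂) / 2 := by rw [hcx]; field_simp
  have ecy : t * cy = (y₁ + y₂) / 2 := by rw [hcy]; field_simp
  set β := (cy - cx) / (d - e) with hβ
  set α := cx + β * d with hα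
  have e1 : cx = α - β * d := by rw [hα]; ring
  have e2 : cy = α - β * e := by
    have : β * (d - e) = cy - cx := by rw [hβ]; field_simp
    rw [hα]; linarith
  have b1 : |α - round α| ≤ 1 / 2 := abs_sub_round α
  have b2 : |β - round β| ≤ 1 / 2 := abs_sub_round β
  have hsp : 0 < |s| := abs_pos.mpr hs
  have htp : 0 < |t| := abs_pos.mpr ht
  have f1 : |s * (round α - round β * d) - (x₁ + x₂) / 2| ≤ |s| * ((1 + d) / 2) := by
    rw [← ecx, ← mul_sub, abs_mul]
    apply mul_le_mul_of_nonneg_left _ hsp.le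
    rw [e1]
    rw [abs_le] at b1 b2 ⊢
    constructor <;> nlinarith
  have f2 : |t * (round α - round β * e) - (y₁ + y₂) / 2| < |t| * 1 := by
    rw [← ecy, ← mul_sub, abs_mul]
    apply mul_lt_mul_of_pos_left _ htp
    rw [e2]
    rw [abs_le] at b1 b2
    rw [abs_lt]
    constructor <;> nlinarith
  refine h _ ⟨round α, round β, rfl⟩ ?_
  rw [abs_le] at f1
  rw [abs_lt] at f2
  refine ⟨⟨?_, ?_⟩, ?_, ?_⟩ <;> simp only <;> linarith

lemma main_abs (a : ℤ → ℤ) (d e : ℤ → ℝ)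
    (hd1 : ∀ i, 1 < d i) (he0 : ∀ i, e i < 0) (he1 : ∀ i, -1 < e i)
    (hd : ∀ i, d i = a i + 1 / d (i + 1)) (he : ∀ i, e i = a i + 1 / e (i + 1)) :
    disp (ScLat 1 1 (d 0) (e 0)) < ⊤ ↔ ∃ M : ℤ, ∀ i : ℤ, a i ≤ M := by
  have hdn : ∀ i, d i ≠ 0 := fun i => by linarith [hd1 i]
  have hen : ∀ i, e i ≠ 0 := fun i => (he0 i).ne
  obtain ⟨S, S0, hS⟩ := exists_rec d hdn
  obtain ⟨T, T0, hT⟩ := exists_rec e hen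
  have hL : ∀ i, ScLat (S i) (T i) (d i) (e i) = ScLat 1 1 (d 0) (e 0) := by
    intro i
    have step := fun i => Lat_step _ _ _ _ _ _ _ _ (a i) (hdn (i + 1)) (hen (i + 1)) (hd i) (he i)
      (hS i) (hT i)
    induction i using Int.induction_on with
    | zero => rw [S0, T0]
    | succ i ih => rw [step, ih]
    | pred i ih => rw [← step, sub_add_cancel, ih]
  have hdet : ∀ i, |S i * T i * (d i - e i)| = d 0 - e 0 := by
    intro i
    have step := fun i => det_step _ _ _ _ _ _ _ _ (a i) (hdn (i + 1)) (hen (i + 1)) (hd i) (he i)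
      (hS i) (hT i)
    induction i using Int.induction_on with
    | zero => rw [S0, T0, one_mul, one_mul, abs_of_pos]; linarith [hd1 0, he0 0]
    | succ i ih => rw [step, ih]
    | pred i ih => rw [← step, sub_add_cancel, ih]
  have hD0 : 0 < d 0 - e 0 := by linarith [hd1 0, he0 0]
  have hS0 : ∀ i, S i ≠ 0 := by
    intro i hi
    have := hdet i
    rw [hi] at this; simp at this; linarith
  have hT0 : ∀ i, T i ≠ 0 := by
    intro i hi
    have := hdet i
    rw [hi] at this; simp at this; linarith
  have had : ∀ i, (a i : ℝ) < d i ∧ d i < a i + 1 := by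
    intro i
    have h1 := hd1 (i + 1)
    have h2 : 0 < 1 / d (i + 1) := by positivity
    have h3 : 1 / d (i + 1) < 1 := by rw [div_lt_one (by linarith)]; exact h1
    have := hd i
    constructor <;> linarith
  have ha1 : ∀ i, 1 ≤ a i := by
    intro i
    have h1 : (0 : ℝ) < a i := by linarith [(had i).2, hd1 i]
    have : 0 < a i := by exact_mod_cast h1
    omega
  constructor
  · intro hfin
    set C := (disp (ScLat 1 1 (d 0) (e 0))).toReal with hC
    refine ⟨⌈4 * C / (d 0 - e 0)⌉, fun i => ?_⟩
    have hb := big_box (S i) (T i) (d i) (e i) (hS0 i) (hT0 i) (by linarith [hd1 i, he0 i])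
    rw [hL, hdet, ENNReal.ofReal_le_iff_le_toReal hfin.ne] at hb
    have h1 : d i - e i ≤ 4 * C / (d 0 - e 0) := by
      rw [le_div_iff₀ hD0]; linarith
    have h2 : (a i : ℝ) ≤ ⌈4 * C / (d 0 - e 0)⌉ := by
      have := Int.le_ceil (4 * C / (d 0 - e 0))
      linarith [(had i).1, he0 i]
    exact_mod_cast h2
  · rintro ⟨M, hM⟩
    have hMd : ∀ i, d i < M + 1 := fun i => by
      have : (a i : ℝ) ≤ M := by exact_mod_cast hM i
      linarith [(had i).2]
    have hM0 : (0 : ℝ) < M + 1 := by linarith [hMd 0, hd1 0]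
    set r : ℝ := 1 + 1 / (M + 1) with hr
    have hr1 : 1 < r := by rw [hr]; have : (0:ℝ) < 1 / (M + 1) := by positivity
                           linarith
    have hrd : ∀ i, r ≤ d i := by
      intro i
      rw [hd i, hr]
      have h1 : (1 : ℝ) ≤ a i := by exact_mod_cast ha1 i
      have h2 : 1 / ((M : ℝ) + 1) ≤ 1 / d (i + 1) :=
        one_div_le_one_div_of_le (by linarith [hd1 (i + 1)]) (hMd _).le
      linarith
    have hSabs : ∀ i, |S (i + 1)| * d (i + 1) = |S i| := by
      intro i
      have := congrArg abs (hS i)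
      rwa [abs_mul, abs_neg, abs_of_pos (by linarith [hd1 (i + 1)] : 0 < d (i + 1))] at this
    have hSr : ∀ i, |S (i + 1)| * r ≤ |S i| := fun i => by
      rw [← hSabs i]; exact mul_le_mul_of_nonneg_left (hrd _) (abs_nonneg _)
    have hup : ∀ n : ℕ, |S n| * r ^ n ≤ 1 := by
      intro n
      induction n with
      | zero => simp [S0]
      | succ n ih =>
        refine le_trans ?_ ih
        have := mul_le_mul_of_nonneg_right (hSr n) (pow_nonneg (by linarith : 0 ≤ r) n)
        rw [pow_succ]; push_cast
        linarith
    have hdown : ∀ n : ℕ, r ^ n ≤ |S (-(n : ℤ))| := by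
      intro n
      induction n with
      | zero => simp [S0]
      | succ n ih =>
        have := hSr (-((n + 1 : ℕ) : ℤ))
        rw [show -((n + 1 : ℕ) : ℤ) + 1 = -(n : ℤ) by push_cast; ring] at this
        rw [pow_succ]
        refine le_trans ?_ this
        exact mul_le_mul_of_nonneg_right ih (by linarith)
    have hbound : disp (ScLat 1 1 (d 0) (e 0)) ≤
        ENNReal.ofReal (2 * (M + 2) * (d 0 - e 0)) := by
      apply sSup_le
      rintro A ⟨x₁, x₂, y₁, y₂, hbox, rfl⟩
      apply ENNReal.ofReal_le_ofReal
      have hX : 0 < x₂ - x₁ := by linarith [hbox.1]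
      have hY : 0 < y₂ - y₁ := by linarith [hbox.2.1]
      set X := x₂ - x₁
      set Y := y₂ - y₁
      have hM2 : (0 : ℝ) < M + 2 := by linarith
      -- crossing index
      have hcross : ∃ i, X ≤ |S i| * (M + 2) ∧ |S (i + 1)| * (M + 2) < X := by
        by_contra hcon
        push Not at hcon
        obtain ⟨k, hk⟩ := pow_unbounded_of_one_lt (X / (M + 2)) hr1
        obtain ⟨l, hl⟩ := pow_unbounded_of_one_lt ((M + 2) / X) hr1
        have hall : ∀ n : ℕ, X ≤ |S (-(k : ℤ) + n)| * (M + 2) := by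
          intro n
          induction n with
          | zero =>
            rw [div_lt_iff₀ hM2] at hk
            have := mul_le_mul_of_nonneg_right (hdown k) hM2.le
            simp only [Nat.cast_zero, add_zero]
            linarith
          | succ n ih =>
            have := hcon _ ih
            rw [add_assoc] at this
            exact_mod_cast this
        have h1 := hall (k + l)
        rw [show -(k : ℤ) + ((k + l : ℕ) : ℤ) = (l : ℤ) by push_cast; ring] at h1
        have h2 := hup l
        rw [div_lt_iff₀ hX] at hl
        have hrl : 0 < r ^ l := pow_pos (by linarith) l
        have h3 := mul_le_mul_of_nonneg_right h1 hrl.le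
        have h4 := mul_le_mul_of_nonneg_right h2 hM2.le
        linarith
      obtain ⟨i, hi1, hi2⟩ := hcross
      have hb := thin_box (S (i + 1)) (T (i + 1)) (d (i + 1)) (e (i + 1)) (hS0 _) (hT0 _) (hd1 _)
        (he0 _) (he1 _) x₁ x₂ y₁ y₂ (by rw [hL]; exact hbox)
      have hYb : Y ≤ |T (i + 1)| * 2 := by
        rcases hb with hb | hb
        · exfalso
          have := mul_le_mul_of_nonneg_left (hMd (i + 1)).le (abs_nonneg (S (i + 1)))
          have : X ≤ |S (i + 1)| * (1 + d (i + 1)) := hb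
          linarith
        · exact hb
      have hdd := hdet (i + 1)
      have hpos : 0 < d (i + 1) - e (i + 1) := by linarith [hd1 (i + 1), he0 (i + 1)]
      rw [abs_mul, abs_mul, abs_of_pos hpos] at hdd
      have h6 : |S i| * |T (i + 1)| ≤ d 0 - e 0 := by
        rw [← hdd, ← hSabs i]
        have := mul_nonneg (abs_nonneg (S (i + 1))) (abs_nonneg (T (i + 1)))
        nlinarith [he0 (i + 1)]
      calc X * Y ≤ (|S i| * (M + 2)) * (|T (i + 1)| * 2) :=
            mul_le_mul hi1 hYb hY.le (by positivity)
        _ = 2 * (M + 2) * (|S i| * |T (i + 1)|) := by ring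
        _ ≤ 2 * (M + 2) * (d 0 - e 0) := mul_le_mul_of_nonneg_left h6 (by positivity)
    exact lt_of_le_of_lt hbound ENNReal.ofReal_lt_top

/-- A lattice has finite dispersion if and only if its two-sided continued fraction
sequence is bounded. -/
theorem stmt6
    (Δ Δt : ℝ) (hΔirr : Irrational Δ) (hΔtirr : Irrational Δt)
    (hΔ1 : 1 < Δ) (hΔtmem : Δt ∈ Set.Ioo (-1 : ℝ) 0)
    (a : ℤ → ℤ) (Δs Δts : ℤ → ℝ)
    (h0 : Δs 0 = Δ) (h0t : Δts 0 = Δt)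
    (hpos : ∀ i : ℤ, 0 ≤ i → a i = ⌊Δs i⌋ ∧ Δs (i + 1) = 1 / (Δs i - a i) ∧
      Δts (i + 1) = -1 / (a i - Δts i))
    (hneg : ∀ i : ℤ, i ≤ 0 → a (i - 1) = ⌊-1 / Δts i⌋ ∧
      Δts (i - 1) = a (i - 1) + 1 / Δts i ∧ Δs (i - 1) = a (i - 1) + 1 / Δs i) :
    disp (latticeGen (1, 1) (-Δ, -Δt)) < ⊤ ↔ ∃ M : ℤ, ∀ i : ℤ, a i ≤ M := by
  have hP : ∀ n : ℕ, Irrational (Δs n) ∧ 1 < Δs n ∧ -1 < Δts n ∧ Δts n < 0 ∧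
      Δs n = a n + 1 / Δs (n + 1) ∧ Δts n = a n + 1 / Δts (n + 1) := by
    have aux : ∀ n : ℕ, Irrational (Δs n) ∧ 1 < Δs n ∧ -1 < Δts n ∧ Δts n < 0 →
      (Irrational (Δs (n + 1)) ∧ 1 < Δs (n + 1) ∧ -1 < Δts (n + 1) ∧ Δts (n + 1) < 0) ∧
      Δs n = a n + 1 / Δs (n + 1) ∧ Δts n = a n + 1 / Δts (n + 1) := by
      rintro n ⟨q1, q2, q3, q4⟩
      obtain ⟨p1, p2, p3⟩ := hpos n (by positivity)
      have hirr : Irrational (Δs n - a n) := q1.sub_intCast _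
      have g1 : (a n : ℝ) ≤ Δs n := by rw [p1]; exact Int.floor_le _
      have g2 : Δs n < a n + 1 := by rw [p1]; exact Int.lt_floor_add_one _
      have g3 : 0 < Δs n - a n := lt_of_le_of_ne (by linarith) (Ne.symm hirr.ne_zero)
      have g4 : 1 ≤ a n := by rw [p1]; exact Int.le_floor.mpr (by push_cast; linarith)
      have g5 : (1 : ℝ) ≤ a n := by exact_mod_cast g4
      have g6 : 0 < a n - Δts n := by linarith
      rw [p2, p3]
      refine ⟨⟨by rw [one_div]; exact hirr.inv, ?_, ?_, ?_⟩, ?_, ?_⟩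
      · rw [lt_div_iff₀ g3]; linarith
      · rw [lt_div_iff₀ g6]; linarith
      · exact div_neg_of_neg_of_pos (by norm_num) g6
      · rw [one_div_one_div]; ring
      · rw [one_div_div]; ring
    have base : ∀ n : ℕ, Irrational (Δs n) ∧ 1 < Δs n ∧ -1 < Δts n ∧ Δts n < 0 := by
      intro n
      induction n with
      | zero => simp only [Nat.cast_zero, h0, h0t]; exact ⟨hΔirr, hΔ1, hΔtmem.1, hΔtmem.2⟩
      | succ n ih => exact_mod_cast (aux n ih).1
    intro n
    obtain ⟨b1, b2, b3, b4⟩ := base n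
    exact ⟨b1, b2, b3, b4, (aux n (base n)).2⟩
  have hN : ∀ n : ℕ, (Irrational (Δts (-(n : ℤ))) ∧ 1 < Δs (-(n : ℤ)) ∧ -1 < Δts (-(n : ℤ)) ∧
      Δts (-(n : ℤ)) < 0) ∧
      Δs (-(n : ℤ) - 1) = a (-(n : ℤ) - 1) + 1 / Δs (-(n : ℤ)) ∧
      Δts (-(n : ℤ) - 1) = a (-(n : ℤ) - 1) + 1 / Δts (-(n : ℤ)) := by
    have aux : ∀ n : ℕ, (Irrational (Δts (-(n : ℤ))) ∧ 1 < Δs (-(n : ℤ)) ∧ -1 < Δts (-(n : ℤ)) ∧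
      Δts (-(n : ℤ)) < 0) → (Irrational (Δts (-(n : ℤ) - 1)) ∧ 1 < Δs (-(n : ℤ) - 1) ∧
      -1 < Δts (-(n : ℤ) - 1) ∧ Δts (-(n : ℤ) - 1) < 0) := by
      rintro n ⟨q1, q2, q3, q4⟩
      obtain ⟨p1, p2, p3⟩ := hneg (-(n : ℤ)) (by simp)
      have hirr : Irrational (Δts (-(n : ℤ) - 1)) := by
        rw [p2, one_div]; exact q1.inv.intCast_add _
      have g0 : 1 / Δts (-(n : ℤ)) = -(-1 / Δts (-(n : ℤ))) := by ring
      have g1 : (a (-(n : ℤ) - 1) : ℝ) ≤ -1 / Δts (-(n : ℤ)) := by rw [p1]; exact Int.floor_le _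
      have g2 : -1 / Δts (-(n : ℤ)) < a (-(n : ℤ) - 1) + 1 := by
        rw [p1]; exact Int.lt_floor_add_one _
      have g3 : 1 ≤ a (-(n : ℤ) - 1) := by
        rw [p1]; apply Int.le_floor.mpr
        rw [le_div_iff_of_neg q4]; push_cast; linarith
      have g5 : (1 : ℝ) ≤ a (-(n : ℤ) - 1) := by exact_mod_cast g3
      refine ⟨hirr, ?_, ?_, ?_⟩
      · have : 0 < 1 / Δs (-(n : ℤ)) := by positivity
        rw [p3]; linarith
      · rw [p2, g0]; linarith
      · exact lt_of_le_of_ne (by rw [p2, g0]; linarith) hirr.ne_zero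
    have base : ∀ n : ℕ, (Irrational (Δts (-(n : ℤ))) ∧ 1 < Δs (-(n : ℤ)) ∧ -1 < Δts (-(n : ℤ)) ∧
      Δts (-(n : ℤ)) < 0) := by
      intro n
      induction n with
      | zero => simp only [Nat.cast_zero, neg_zero, h0, h0t]; exact ⟨hΔtirr, hΔ1, hΔtmem.1, hΔtmem.2⟩
      | succ n ih =>
        have := aux n ih
        rw [show -(n : ℤ) - 1 = -((n + 1 : ℕ) : ℤ) by push_cast; ring] at this
        exact this
    intro n
    obtain ⟨p1, p2, p3⟩ := hneg (-(n : ℤ)) (by simp)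
    exact ⟨base n, p3, p2⟩
  have hall : ∀ i : ℤ, 1 < Δs i ∧ -1 < Δts i ∧ Δts i < 0 ∧
      Δs i = a i + 1 / Δs (i + 1) ∧ Δts i = a i + 1 / Δts (i + 1) := by
    intro i
    by_cases hi : 0 ≤ i
    · lift i to ℕ using hi
      exact (hP i).2
    · obtain ⟨n, rfl⟩ : ∃ n : ℕ, i = -(n : ℤ) - 1 := ⟨(-i - 1).toNat, by omega⟩
      have h1 := (hN (n + 1)).1
      rw [show -((n + 1 : ℕ) : ℤ) = -(n : ℤ) - 1 by push_cast; ring] at h1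
      rw [sub_add_cancel]
      exact ⟨h1.2.1, h1.2.2.1, h1.2.2.2, (hN n).2⟩
  have hLat : latticeGen (1, 1) (-Δ, -Δt) = ScLat 1 1 (Δs 0) (Δts 0) := by
    rw [h0, h0t]
    ext p
    constructor
    · rintro ⟨m, n, rfl⟩
      refine ⟨m, n, ?_⟩
      ext <;> simp <;> ring
    · rintro ⟨m, n, rfl⟩
      refine ⟨m, n, ?_⟩
      ext <;> simp <;> ring
  rw [hLat]
  exact main_abs a Δs Δts (fun i => (hall i).1) (fun i => (hall i).2.2.1) (fun i => (hall i).2.1)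
    (fun i => (hall i).2.2.2.1) (fun i => (hall i).2.2.2.2)
end

section
/- Let Δ > 1 and Δ̃ ∈ (−1, 0) be irrational reals and let Λ be the lattice generated by (1, 1) and (−Δ, −Δ̃). Suppose B = (α, β) × (0, h) is a maximal empty axis-parallel box amidst Λ with α < 0 < β and 0 < h, and suppose (α, α̃) ∈ Λ and (β, β̃) ∈ Λ with 0 < α̃ < h and 0 < β̃ < h. Then h = α̃ + β̃ and the area of B satisfies (β − α)·h = |α·α̃| + |β·β̃| + Δ − Δ̃. -/
/-- An empty axis-parallel box amidst `Λ` is maximal if no axis-parallel box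
strictly containing it is empty amidst `Λ`. -/
def maximalEmptyBox (Λ : Set (ℝ × ℝ)) (x₁ x₂ y₁ y₂ : ℝ) : Prop :=
  isEmptyBox Λ x₁ x₂ y₁ y₂ ∧
  ∀ x₁' x₂' y₁' y₂' : ℝ, isEmptyBox Λ x₁' x₂' y₁' y₂' →
    Set.Ioo x₁ x₂ ×ˢ Set.Ioo y₁ y₂ ⊆ Set.Ioo x₁' x₂' ×ˢ Set.Ioo y₁' y₂' →
    Set.Ioo x₁ x₂ ×ˢ Set.Ioo y₁ y₂ = Set.Ioo x₁' x₂' ×ˢ Set.Ioo y₁' y₂'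

set_option maxHeartbeats 1000000 in
/-- For a maximal empty box B = (α,β) × (0,h) amidst the lattice generated by
(1,1) and (−Δ,−Δ̃), bounded on the left by (α,α̃) and on the right by (β,β̃):
h = α̃ + β̃ and the area of B is |α·α̃| + |β·β̃| + Δ − Δ̃. -/
theorem stmt7 (Δ Δt : ℝ) (hΔirr : Irrational Δ) (hΔtirr : Irrational Δt)
    (hΔ1 : 1 < Δ) (hΔtmem : Δt ∈ Set.Ioo (-1 : ℝ) 0)
    (α β h αt βt : ℝ)
    (hmax : maximalEmptyBox (latticeGen (1, 1) (-Δ, -Δt)) α β 0 h)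
    (hα : α < 0) (hβ : 0 < β) (hh : 0 < h)
    (hαmem : (α, αt) ∈ latticeGen (1, 1) (-Δ, -Δt))
    (hβmem : (β, βt) ∈ latticeGen (1, 1) (-Δ, -Δt))
    (hαt : 0 < αt ∧ αt < h) (hβt : 0 < βt ∧ βt < h) :
    h = αt + βt ∧ (β - α) * h = |α * αt| + |β * βt| + Δ - Δt := by
  obtain ⟨hd1, hd0⟩ := hΔtmem
  obtain ⟨⟨_, _, hemp⟩, hmx⟩ := hmax
  have E0 : 0 < Δ - Δt := by linarith
  have emp : ∀ m n : ℤ, α < m - n * Δ → m - n * Δ < β → 0 < m - n * Δt →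
      m - n * Δt < h → False := by
    intro m n h1 h2 h3 h4
    refine hemp (m - n * Δ, m - n * Δt) ⟨m, n, ?_⟩ ⟨⟨h1, h2⟩, ⟨h3, h4⟩⟩
    ext <;> simp <;> ring
  obtain ⟨a1, a2, ha⟩ := hαmem
  obtain ⟨b1, b2, hb⟩ := hβmem
  have ax : α = a1 - a2 * Δ := by
    have := congrArg Prod.fst ha
    simp at this; linarith
  have ay : αt = a1 - a2 * Δt := by
    have := congrArg Prod.snd ha
    simp at this; linarith
  have bx : β = b1 - b2 * Δ := by
    have := congrArg Prod.fst hb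
    simp at this; linarith
  have byy : βt = b1 - b2 * Δt := by
    have := congrArg Prod.snd hb
    simp at this; linarith
  obtain ⟨hα1, hα2⟩ := hαt
  obtain ⟨hβ1, hβ2⟩ := hβt
  -- a lattice point on the top side
  have top : ∃ m n : ℤ, α < m - n * Δ ∧ m - n * Δ < β ∧ (m - n * Δt : ℝ) = h := by
    have ext : ∀ h' : ℝ, h < h' → ∃ m n : ℤ, α < m - n * Δ ∧ m - n * Δ < β ∧
        h ≤ m - n * Δt ∧ m - n * Δt < h' := by
      intro h' hh'
      by_contra hcon
      push Not at hcon
      have heq := hmx α β 0 h' ⟨by linarith, by linarith, ?_⟩ ?_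
      · have : ((0 : ℝ), h) ∈ Set.Ioo α β ×ˢ Set.Ioo 0 h' := ⟨⟨hα, hβ⟩, ⟨hh, hh'⟩⟩
        rw [← heq] at this
        exact lt_irrefl _ this.2.2
      · rintro p ⟨m, n, hp⟩ ⟨⟨h1, h2⟩, ⟨h3, h4⟩⟩
        have px : p.1 = m - n * Δ := by rw [hp]; simp; ring
        have py : p.2 = m - n * Δt := by rw [hp]; simp; ring
        rw [px] at h1 h2
        rw [py] at h3 h4
        rcases lt_or_ge ((m : ℝ) - n * Δt) h with h5 | h5
        · exact emp m n h1 h2 h3 h5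
        · exact absurd h4 (not_lt.mpr (hcon m n h1 h2 h5))
      · rintro p ⟨⟨h1, h2⟩, ⟨h3, h4⟩⟩
        exact ⟨⟨h1, h2⟩, ⟨h3, h4.trans hh'⟩⟩
    let S : Set (ℤ × ℤ) := {p | α < p.1 - p.2 * Δ ∧ p.1 - p.2 * Δ < β ∧
        h ≤ p.1 - p.2 * Δt ∧ p.1 - p.2 * Δt < h + 1}
    have Sfin : S.Finite := by
      refine Set.Finite.subset
        ((Set.finite_Icc ⌊(Δ * h - Δt * α) / (Δ - Δt)⌋ ⌈(Δ * (h + 1) - Δt * β) / (Δ - Δt)⌉).prod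
        (Set.finite_Icc ⌊(h - β) / (Δ - Δt)⌋ ⌈(h + 1 - α) / (Δ - Δt)⌉)) ?_
      rintro ⟨m, n⟩ ⟨h1, h2, h3, h4⟩
      simp only at h1 h2 h3 h4
      refine ⟨⟨?_, ?_⟩, ⟨?_, ?_⟩⟩
      · have : (Δ * h - Δt * α) / (Δ - Δt) ≤ m := by
          rw [div_le_iff₀ E0]; nlinarith
        exact_mod_cast (Int.floor_le _).trans this
      · have : m ≤ (Δ * (h + 1) - Δt * β) / (Δ - Δt) := by
          rw [le_div_iff₀ E0]; nlinarith
        exact_mod_cast this.trans (Int.le_ceil _)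
      · have : (h - β) / (Δ - Δt) ≤ n := by
          rw [div_le_iff₀ E0]; nlinarith
        exact_mod_cast (Int.floor_le _).trans this
      · have : n ≤ (h + 1 - α) / (Δ - Δt) := by
          rw [le_div_iff₀ E0]; nlinarith
        exact_mod_cast this.trans (Int.le_ceil _)
    have Sne : S.Nonempty := by
      obtain ⟨m, n, hmn⟩ := ext (h + 1) (by linarith)
      exact ⟨(m, n), hmn⟩
    obtain ⟨⟨m, n⟩, ⟨h1, h2, h3, h4⟩, hmin⟩ :=
      Set.exists_min_image S (fun p => (p.1 : ℝ) - p.2 * Δt) Sfin Sne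
    simp only at h1 h2 h3 h4
    refine ⟨m, n, h1, h2, ?_⟩
    by_contra hne
    obtain ⟨m', n', k1, k2, k3, k4⟩ := ext (m - n * Δt) (lt_of_le_of_ne h3 (Ne.symm hne))
    have := hmin (m', n') ⟨k1, k2, k3, k4.trans h4⟩
    simp only at this
    linarith
  obtain ⟨c1, c2, cx1, cx2, cy⟩ := top
  have k1 : β ≤ c1 - c2 * Δ - α := by
    by_contra hc
    push Not at hc
    refine emp (c1 - a1) (c2 - a2) ?_ ?_ ?_ ?_ <;> push_cast <;> linarith
  have k2 : c1 - c2 * Δ - β ≤ α := by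
    by_contra hc
    push Not at hc
    refine emp (c1 - b1) (c2 - b2) ?_ ?_ ?_ ?_ <;> push_cast <;> linarith
  have irr : ∀ m n : ℤ, (m : ℝ) - n * Δ = 0 → m = 0 ∧ n = 0 := by
    intro m n hmn
    have hn : n = 0 := by
      by_contra hn
      have hn' : (n : ℝ) ≠ 0 := by exact_mod_cast hn
      apply hΔirr
      refine ⟨(m : ℚ) / n, ?_⟩
      push_cast
      rw [div_eq_iff hn']; linarith
    subst hn
    simp at hmn
    exact ⟨by exact_mod_cast hmn, rfl⟩
  have hsum : h = αt + βt := by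
    obtain ⟨e1, e2⟩ := irr (c1 - a1 - b1) (c2 - a2 - b2) (by push_cast; linarith)
    have e1' : (c1 : ℝ) = a1 + b1 := by
      have : c1 = a1 + b1 := by linarith
      exact_mod_cast this
    have e2' : (c2 : ℝ) = a2 + b2 := by
      have : c2 = a2 + b2 := by linarith
      exact_mod_cast this
    rw [← cy, ay, byy, e1', e2']; ring
  refine ⟨hsum, ?_⟩
  have D0 : 0 < β * αt - α * βt := by
    have := mul_pos hβ hα1
    have := mul_pos (neg_pos.mpr hα) hβ1
    linarith
  -- the vectors generate the lattice
  have gen : ∀ m n : ℤ, ∃ i j : ℤ, (m : ℝ) - n * Δ = i * α + j * β ∧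
      (m : ℝ) - n * Δt = i * αt + j * βt := by
    intro m n
    obtain ⟨s, t, hs, ht⟩ : ∃ s t : ℝ, (m : ℝ) - n * Δ = s * α + t * β ∧
        (m : ℝ) - n * Δt = s * αt + t * βt := by
      refine ⟨(β * (m - n * Δt) - βt * (m - n * Δ)) / (β * αt - α * βt),
        (αt * (m - n * Δ) - α * (m - n * Δt)) / (β * αt - α * βt), ?_, ?_⟩
      · rw [div_mul_eq_mul_div, div_mul_eq_mul_div, ← add_div, eq_div_iff D0.ne']; ring
      · rw [div_mul_eq_mul_div, div_mul_eq_mul_div, ← add_div, eq_div_iff D0.ne']; ring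
    have s0 := Int.fract_nonneg s
    have s1 := Int.fract_lt_one s
    have t0 := Int.fract_nonneg t
    have t1 := Int.fract_lt_one t
    have sf := Int.floor_add_fract s
    have tf := Int.floor_add_fract t
    have px : ((m - ⌊s⌋ * a1 - ⌊t⌋ * b1 : ℤ) : ℝ) - ((n - ⌊s⌋ * a2 - ⌊t⌋ * b2 : ℤ) : ℝ) * Δ
        = Int.fract s * α + Int.fract t * β := by
      have : Int.fract s * α + Int.fract t * β = (s - ⌊s⌋) * α + (t - ⌊t⌋) * β := rfl
      rw [this]
      push_cast
      linear_combination hs + ⌊s⌋ * ax + ⌊t⌋ * bx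
    have py : ((m - ⌊s⌋ * a1 - ⌊t⌋ * b1 : ℤ) : ℝ) - ((n - ⌊s⌋ * a2 - ⌊t⌋ * b2 : ℤ) : ℝ) * Δt
        = Int.fract s * αt + Int.fract t * βt := by
      have : Int.fract s * αt + Int.fract t * βt = (s - ⌊s⌋) * αt + (t - ⌊t⌋) * βt := rfl
      rw [this]
      push_cast
      linear_combination ht + ⌊s⌋ * ay + ⌊t⌋ * byy
    have hz : Int.fract s * αt + Int.fract t * βt ≤ 0 := by
      by_contra hpos
      push Not at hpos
      refine emp (m - ⌊s⌋ * a1 - ⌊t⌋ * b1) (n - ⌊s⌋ * a2 - ⌊t⌋ * b2) ?_ ?_ ?_ ?_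
      · rw [px]; nlinarith
      · rw [px]; nlinarith
      · rw [py]; exact hpos
      · rw [py, hsum]; nlinarith
    have u1 := mul_nonneg s0 hα1.le
    have u2 := mul_nonneg t0 hβ1.le
    have fs : Int.fract s = 0 := by
      have : Int.fract s * αt = 0 := by linarith
      exact (mul_eq_zero.mp this).resolve_right hα1.ne'
    have ft : Int.fract t = 0 := by
      have : Int.fract t * βt = 0 := by linarith
      exact (mul_eq_zero.mp this).resolve_right hβ1.ne'
    rw [fs, add_zero] at sf
    rw [ft, add_zero] at tf
    exact ⟨⌊s⌋, ⌊t⌋, by rw [sf, tf]; exact hs, by rw [sf, tf]; exact ht⟩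
  obtain ⟨i1, j1, e1, e2⟩ := gen 1 0
  obtain ⟨i2, j2, e3, e4⟩ := gen 0 (-1)
  have det : β * αt - α * βt = Δ - Δt := by
    have hk : β * αt - α * βt = ((b1 * a2 - a1 * b2 : ℤ) : ℝ) * (Δ - Δt) := by
      rw [ax, ay, bx, byy]; push_cast; ring
    have hk' : Δ - Δt = ((j2 * i1 - i2 * j1 : ℤ) : ℝ) * (β * αt - α * βt) := by
      push_cast at e1 e2 e3 e4 ⊢
      simp only [zero_mul, sub_zero, zero_sub, neg_mul, one_mul, neg_neg] at e1 e2 e3 e4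
      have : Δ - Δt = Δ * (i1 * αt + j1 * βt) - Δt * (i1 * α + j1 * β) := by
        rw [← e1, ← e2]; ring
      rw [this, e3, e4]; ring
    generalize (b1 * a2 - a1 * b2 : ℤ) = k at hk
    generalize (j2 * i1 - i2 * j1 : ℤ) = k' at hk'
    have kp : 0 < (k : ℝ) := by
      rw [hk] at D0; exact pos_of_mul_pos_left D0 E0.le
    have kp' : 0 < (k' : ℝ) := by
      have := E0
      rw [hk'] at this; exact pos_of_mul_pos_left this D0.le
    have g1 : (1 : ℝ) ≤ k := by
      have : 0 < k := by exact_mod_cast kp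
      exact_mod_cast this
    have g2 : (1 : ℝ) ≤ k' := by
      have : 0 < k' := by exact_mod_cast kp'
      exact_mod_cast this
    have q1 := le_mul_of_one_le_left E0.le g1
    have q2 := le_mul_of_one_le_left D0.le g2
    exact le_antisymm (q2.trans_eq hk'.symm) (q1.trans_eq hk.symm)
  rw [abs_of_neg (mul_neg_of_neg_of_pos hα hα1), abs_of_pos (mul_pos hβ hβ1), hsum]
  linear_combination det
end
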